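/- Let d ≥ 2, α ∈ (1,2), and let μ be a nondegenerate α-stable distribution on ℝ^d with no shift, characteristic exponent Φ_μ(z) = |z|^α V(u_z), and density g. Fix j ∈ ℤ_+ and set S_{j,k} = (−i)^j proj_j(V^k). Then for every n ≥ 0, as r → ∞, sup_{u ∈ S^{d−1}} | proj_j(g(r·))(u) − Σ_{k=0}^n ((−2^α)^k π^{−d/2}/(k! r^{kα+d})) (Γ((j+kα+d)/2)/Γ((j−kα)/2)) S_{j,k}(u) | = O(r^{−(n+1)α−d}). Furthermore, if X ∼ μ with density of |X| denoted g_{|X|}, then for every n ≥ 0, as r → ∞, g_{|X|}(r) = Σ_{k=0}^n ((−2^α)^k π^{−d/2}/(k! r^{kα+1})) (Γ((kα+d)/2)/Γ(−kα/2)) ∫_{S^{d−1}} V^k dω + O(r^{−(n+1)α−1}), where the k = 0 term is interpreted as 0 since 1/Γ(0) = 0. -/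

import Mathlib

open MeasureTheory Real Filter Topology
open scoped RealInnerProductSpace ENNReal NNReal

noncomputable section

namespace StablePaper

abbrev Ed (d : ℕ) : Type := EuclideanSpace ℝ (Fin d)

abbrev Sph (d : ℕ) := Metric.sphere (0 : Ed d) 1

/-- The surface measure `ω` on the unit sphere `S^{d-1}`. -/
def ωd (d : ℕ) : Measure (Sph d) := (volume : Measure (Ed d)).toSphere

/-- `u_z = z/|z|` for `z ≠ 0`, as a point of the unit sphere. -/
def unitize {d : ℕ} (z : Ed d) (hz : z ≠ 0) : Sph d :=
  ⟨‖z‖⁻¹ • z, by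
    rw [mem_sphere_iff_norm, sub_zero, norm_smul, norm_inv, norm_norm,
      inv_mul_cancel₀ (norm_ne_zero_iff.mpr hz)]⟩

/-- Negation on the unit sphere. -/
def negS {d : ℕ} (u : Sph d) : Sph d :=
  ⟨-(u : Ed d), by
    rw [mem_sphere_iff_norm, sub_zero, norm_neg]
    have := u.2
    rwa [mem_sphere_iff_norm, sub_zero] at this⟩

/-- Rising factorial (Pochhammer symbol) `(b)_n`. -/
def risingFactorial (b : ℝ) (n : ℕ) : ℝ := ∏ i ∈ Finset.range n, (b + i)

/-- The Gegenbauer polynomial `C_j^b(t)` (for `b > 0`), via its explicit sum formula. -/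
def gegenbauer (b : ℝ) (j : ℕ) (t : ℝ) : ℝ :=
  ∑ m ∈ Finset.range (j / 2 + 1),
    (-1 : ℝ) ^ m * 2 ^ (j - 2 * m) * risingFactorial b (j - m) /
      ((Nat.factorial m : ℝ) * (Nat.factorial (j - 2 * m) : ℝ)) * t ^ (j - 2 * m)

/-- The normalized (ultraspherical) polynomial `C̃_j^b(t) = C_j^b(t)/C_j^b(1)`;
for `b = 0` it is the Chebyshev polynomial `T_j`. -/
def gegenbauerN (b : ℝ) (j : ℕ) (t : ℝ) : ℝ :=
  if b = 0 then (Polynomial.Chebyshev.T ℝ (j : ℤ)).eval t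
  else gegenbauer b j t / gegenbauer b j 1

/-- `c_{j,d} = dim ℋ_{j,d}`. -/
def cdim (d j : ℕ) : ℕ :=
  if j = 0 then 1 else Nat.choose (j + d - 2) j + Nat.choose (j + d - 3) (j - 1)

/-- The surface area `A(S^{d-1}) = 2 π^{d/2} / Γ(d/2)`. -/
def sphereArea (d : ℕ) : ℝ := 2 * Real.pi ^ ((d : ℝ) / 2) / Real.Gamma ((d : ℝ) / 2)

/-- Projection onto spherical harmonics of degree `j` (real-valued version):
`(proj_j f)(u) = (c_{j,d}/A(S^{d-1})) ∫ C̃_j^{(d-2)/2}(⟨u,v⟩) f(v) ω(dv)`. -/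
def projR (d j : ℕ) (f : Sph d → ℝ) (u : Sph d) : ℝ :=
  (cdim d j : ℝ) / sphereArea d *
    ∫ v, gegenbauerN (((d : ℝ) - 2) / 2) j ⟪(u : Ed d), (v : Ed d)⟫ * f v ∂(ωd d)

/-- Projection onto spherical harmonics of degree `j` (complex-valued version). -/
def projC (d j : ℕ) (f : Sph d → ℂ) (u : Sph d) : ℂ :=
  ((cdim d j : ℂ) / (sphereArea d : ℂ)) *
    ∫ v, (gegenbauerN (((d : ℝ) - 2) / 2) j ⟪(u : Ed d), (v : Ed d)⟫ : ℂ) * f v ∂(ωd d)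

/-- The coefficients `w_j(α)`. -/
def w (d : ℕ) (α : ℝ) (j : ℕ) : ℝ :=
  Real.pi ^ ((d : ℝ) / 2) * Real.Gamma (α + 1) /
    (2 ^ (α - 1) * Real.Gamma (((j : ℝ) + α + d) / 2) * Real.Gamma ((α - j) / 2 + 1))

/-- The characteristic exponent of an `α`-stable distribution (`α ≠ 1`) with
spectral spherical measure `Λ`. -/
def charExp (d : ℕ) (α : ℝ) (Λ : Measure (Sph d)) (z : Ed d) : ℂ :=
  ∫ v, (|⟪z, (v : Ed d)⟫| ^ α : ℝ) *
      (1 - Complex.I * (Real.tan (Real.pi * α / 2) : ℂ) *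
        (Real.sign ⟪z, (v : Ed d)⟫ : ℂ)) ∂Λ

/-- `V(u)`, so that `Φ_μ(z) = |z|^α V(u_z)`. -/
def Vfun (d : ℕ) (α : ℝ) (Λ : Measure (Sph d)) (u : Sph d) : ℂ :=
  charExp d α Λ (u : Ed d)

/-- The characteristic exponent of a `1`-stable distribution with
spectral spherical measure `Λ`. -/
def charExp1 (d : ℕ) (Λ : Measure (Sph d)) (z : Ed d) : ℂ :=
  ∫ v, ((|⟪z, (v : Ed d)⟫| : ℝ) : ℂ) +
      Complex.I * ((2 / Real.pi * (⟪z, (v : Ed d)⟫ *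
        Real.log |⟪z, (v : Ed d)⟫|) : ℝ) : ℂ) ∂Λ

/-- The spectral spherical measure `λ(dv) = P(v) ω(dv)`. -/
def specMeasure (d : ℕ) (P : Sph d → ℝ) : Measure (Sph d) :=
  (ωd d).withDensity (fun v => ENNReal.ofReal (P v))

/-- `μ` has Fourier transform `exp (-Φ)` where `Φ` is the `α`-stable characteristic
exponent with spectral spherical measure `Λ` (case `α ≠ 1`). -/
def IsStableChar (d : ℕ) (α : ℝ) (Λ : Measure (Sph d)) (μ : Measure (Ed d)) : Prop :=
  ∀ z : Ed d, ∫ x, Complex.exp (Complex.I * (⟪z, x⟫ : ℂ)) ∂μ =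
    Complex.exp (- charExp d α Λ z)

/-- `μ` has Fourier transform `exp (-Φ)` where `Φ` is the `1`-stable characteristic
exponent with spectral spherical measure `Λ`. -/
def IsStableChar1 (d : ℕ) (Λ : Measure (Sph d)) (μ : Measure (Ed d)) : Prop :=
  ∀ z : Ed d, ∫ x, Complex.exp (Complex.I * (⟪z, x⟫ : ℂ)) ∂μ =
    Complex.exp (- charExp1 d Λ z)

/-- `μ` is nondegenerate: its support is not contained in any proper affine subspace. -/
def Nondegenerate (d : ℕ) (μ : Measure (Ed d)) : Prop :=
  ∀ (a : Ed d) (W : Submodule ℝ (Ed d)), W ≠ ⊤ →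
    μ ((fun x => a + x) '' (W : Set (Ed d))) < 1

/-- `P` is the restriction to the sphere of a polynomial on `ℝ^d`. -/
def IsPolyRestriction (d : ℕ) (P : Sph d → ℝ) : Prop :=
  ∃ p : MvPolynomial (Fin d) ℝ,
    ∀ u : Sph d, P u = MvPolynomial.eval (fun i => (u : Ed d) i) p

/-- `P` is the restriction to the sphere of a polynomial of degree at most `q`. -/
def IsPolyRestrictionDeg (d q : ℕ) (P : Sph d → ℝ) : Prop :=
  ∃ p : MvPolynomial (Fin d) ℝ, p.totalDegree ≤ q ∧
    ∀ u : Sph d, P u = MvPolynomial.eval (fun i => (u : Ed d) i) p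

/-- `f` is a spherical harmonic of degree `j`: the restriction to the sphere of a
homogeneous harmonic polynomial of degree `j`. -/
def IsSphericalHarmonicC (d j : ℕ) (f : Sph d → ℂ) : Prop :=
  ∃ p : MvPolynomial (Fin d) ℂ, p.IsHomogeneous j ∧
    (∑ i : Fin d, MvPolynomial.pderiv i (MvPolynomial.pderiv i p)) = 0 ∧
    ∀ u : Sph d, f u = MvPolynomial.eval (fun i => ((u : Ed d) i : ℂ)) p

/-- `S_{j,k} = (-i)^j proj_j (V^k)`. -/
def SHk (d : ℕ) (α : ℝ) (Λ : Measure (Sph d)) (j k : ℕ) (u : Sph d) : ℂ :=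
  (-Complex.I) ^ j * projC d j (fun v => (Vfun d α Λ v) ^ k) u

/-- `S_{j,p} = (-i)^j proj_j (V^p)` for real exponents `p` (principal branch). -/
def SHp (d : ℕ) (α : ℝ) (Λ : Measure (Sph d)) (j : ℕ) (p : ℝ) (u : Sph d) : ℂ :=
  (-Complex.I) ^ j * projC d j (fun v => (Vfun d α Λ v) ^ (p : ℂ)) u

/-- `g` is the density of the stable distribution with characteristic exponent
`charExp d α Λ`, given by the Fourier inversion formula. -/
def IsDensityOf (d : ℕ) (α : ℝ) (Λ : Measure (Sph d)) (g : Ed d → ℝ) : Prop :=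
  ∀ x : Ed d, (g x : ℂ) =
    (((2 * Real.pi) ^ d)⁻¹ : ℝ) *
      ∫ z : Ed d, Complex.exp (-(Complex.I * (⟪x, z⟫ : ℂ))) *
        Complex.exp (- charExp d α Λ z)

/-- Harmonic numbers `s_n`. -/
def harmonicNum (n : ℕ) : ℝ := ∑ i ∈ Finset.range n, (1 : ℝ) / (i + 1)

def betaD (d : ℕ) : ℝ :=
  if Even d then 1 - Real.log 2 - harmonicNum (d / 2) / 2
  else 1 - harmonicNum (d + 1) + harmonicNum ((d + 1) / 2) / 2

/-- The coefficients `w*_j` (for odd `j`). -/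
def wstar (d j : ℕ) : ℝ :=
  if j = 1 then Real.pi ^ ((d : ℝ) / 2) * betaD d / Real.Gamma ((d : ℝ) / 2 + 1)
  else (-1 : ℝ) ^ ((j - 3) / 2) * Real.pi ^ ((d : ℝ) / 2) *
      Real.Gamma (((j : ℝ) - 1) / 2) / (2 * Real.Gamma (((d : ℝ) + 1 + j) / 2))

/-- The Bessel function of the first kind `J_τ`. -/
def besselJ (τ : ℝ) (x : ℝ) : ℝ :=
  ∑' k : ℕ, (-1 : ℝ) ^ k * (x / 2) ^ (2 * (k : ℝ) + τ) /
    ((Nat.factorial k : ℝ) * Real.Gamma ((k : ℝ) + τ + 1))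

/-- The `(j,k)`-term `((-2^α)^k π^{-d/2} / (k! ρ^{kα+d})) (Γ((j+kα+d)/2)/Γ((j-kα)/2)) S_{j,k}(u)`
of the spherical-harmonic series for the density (`α ∈ (0,1)`), at radius `ρ`. -/
def phiTerm (d : ℕ) (α : ℝ) (Λ : Measure (Sph d)) (j k : ℕ) (ρ : ℝ) (u : Sph d) : ℂ :=
  ((((-((2 : ℝ) ^ α)) ^ k * Real.pi ^ (-(d : ℝ) / 2) /
      ((Nat.factorial k : ℝ) * ρ ^ ((k : ℝ) * α + d)) *
      (Real.Gamma (((j : ℝ) + k * α + d) / 2) /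
        Real.Gamma (((j : ℝ) - k * α) / 2))) : ℝ) : ℂ) * SHk d α Λ j k u

/-- The `k`-th term `((-2^α)^k π^{-d/2} / (k! r^{kα+1})) (Γ((kα+d)/2)/Γ(-kα/2)) ∫ V^k dω`
of the series for the density of `|X|`. -/
def radTerm (d : ℕ) (α : ℝ) (Λ : Measure (Sph d)) (k : ℕ) (r : ℝ) : ℂ :=
  ((((-((2 : ℝ) ^ α)) ^ k * Real.pi ^ (-(d : ℝ) / 2) /
      ((Nat.factorial k : ℝ) * r ^ ((k : ℝ) * α + 1)) *
      (Real.Gamma (((k : ℝ) * α + d) / 2) / Real.Gamma (-((k : ℝ) * α) / 2))) : ℝ) : ℂ) *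
    ∫ u, (Vfun d α Λ u) ^ k ∂(ωd d)

end StablePaper

namespace StablePaper

/-! ### The normalized Bessel function -/

/-- `besselN c x = ∑ₗ (-x/4)^l / (l! Γ(c+l))`, so that
`J_{c-1}(s) = (s/2)^{c-1} besselN c (s^2)`. -/
def besselN (c x : ℝ) : ℝ :=
  ∑' l : ℕ, (-x / 4) ^ l / ((Nat.factorial l : ℝ) * Real.Gamma (c + l))

lemma gamma_le_gamma_add_nat {c : ℝ} (hc : 1 ≤ c) (l : ℕ) :
    Real.Gamma c ≤ Real.Gamma (c + l) := by
  induction l with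
  | zero => simp
  | succ l ih =>
    have h0 : (0 : ℝ) ≤ l := Nat.cast_nonneg l
    have h : c + ((l + 1 : ℕ) : ℝ) = (c + l) + 1 := by push_cast; ring
    rw [h, Real.Gamma_add_one (by linarith)]
    have : 0 < Real.Gamma (c + l) := Real.Gamma_pos_of_pos (by linarith)
    nlinarith

lemma norm_besselN_term_le {c : ℝ} (hc : 1 ≤ c) {x R : ℝ} (hx : |x| ≤ R) (l : ℕ) :
    ‖(-x / 4) ^ l / ((Nat.factorial l : ℝ) * Real.Gamma (c + l))‖ ≤
      (R ^ l / (Nat.factorial l : ℝ)) * (Real.Gamma c)⁻¹ := by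
  have hG : 0 < Real.Gamma c := Real.Gamma_pos_of_pos (by linarith)
  have hG' := gamma_le_gamma_add_nat hc l
  have hR : |x / 4| ≤ R := by
    rw [abs_div]; norm_num; linarith [abs_nonneg x]
  have hf : (0 : ℝ) < Nat.factorial l := by positivity
  rw [neg_div, norm_div, norm_pow, norm_mul, norm_neg, Real.norm_eq_abs, Real.norm_eq_abs,
    Real.norm_eq_abs, abs_of_pos hf, abs_of_pos (hG.trans_le hG'), ← div_div, div_eq_mul_inv _
    (Real.Gamma (c + l))]
  have hR0 : 0 ≤ R := (abs_nonneg x).trans hx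
  gcongr

lemma summable_besselN {c : ℝ} (hc : 1 ≤ c) (x : ℝ) :
    Summable fun l : ℕ => (-x / 4) ^ l / ((Nat.factorial l : ℝ) * Real.Gamma (c + l)) :=
  Summable.of_norm_bounded ((Real.summable_pow_div_factorial |x|).mul_right _)
    (norm_besselN_term_le hc le_rfl)

lemma hasSum_besselN {c : ℝ} (hc : 1 ≤ c) (x : ℝ) :
    HasSum (fun l : ℕ => (-x / 4) ^ l / ((Nat.factorial l : ℝ) * Real.Gamma (c + l)))
      (besselN c x) := (summable_besselN hc x).hasSum

lemma besselN_zero (c : ℝ) : besselN c 0 = (Real.Gamma c)⁻¹ := by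
  rw [besselN, tsum_eq_single 0]
  · simp
  · intro l hl
    simp [hl]

/-- The relation `J_{ν-1} + J_{ν+1} = (2ν/s) J_ν`. -/
lemma besselN_recurrence {c : ℝ} (hc : 1 ≤ c) (x : ℝ) :
    x * besselN (c + 2) x = 4 * (c * besselN (c + 1) x - besselN c x) := by
  have h1 := ((hasSum_besselN (c := c + 1) (by linarith) x).mul_left c).sub (hasSum_besselN hc x)
  have h2 := (hasSum_besselN (c := c + 2) (by linarith) x).mul_left (x / 4)
  rw [← hasSum_nat_add_iff' 1] at h1
  have h3 := h1.unique (h2.congr_fun ?_)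
  · simp only [Finset.sum_range_one, pow_zero, Nat.factorial_zero, Nat.cast_one, one_mul,
      Nat.cast_zero, add_zero] at h3
    have hg : c * (1 / Real.Gamma (c + 1)) - 1 / Real.Gamma c = 0 := by
      rw [Real.Gamma_add_one (by linarith)]
      have : Real.Gamma c ≠ 0 := (Real.Gamma_pos_of_pos (by linarith)).ne'
      have : c ≠ 0 := by linarith
      field_simp
      simp
    rw [hg] at h3
    linarith
  · intro l
    have h0 : (0 : ℝ) ≤ l := Nat.cast_nonneg l
    have e1 : c + 1 + ((l + 1 : ℕ) : ℝ) = c + 2 + l := by push_cast; ring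
    have e2 : c + 2 + (l : ℝ) = (c + 1 + l) + 1 := by ring
    have e3 : c + ((l + 1 : ℕ) : ℝ) = c + 1 + l := by push_cast; ring
    rw [e1, e3, e2, Real.Gamma_add_one (by linarith), Nat.factorial_succ]
    have : Real.Gamma (c + 1 + l) ≠ 0 := (Real.Gamma_pos_of_pos (by linarith)).ne'
    have : c + 1 + (l : ℝ) ≠ 0 := by linarith
    have : (Nat.factorial l : ℝ) ≠ 0 := by positivity
    push_cast
    field_simp
    ring

lemma hasDerivAt_besselN {c : ℝ} (hc : 1 ≤ c) (x : ℝ) :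
    HasDerivAt (besselN c) (-(1 / 4) * besselN (c + 1) x) x := by
  set R := |x| + 1
  have hR : 0 < R := by positivity
  set u : ℕ → ℝ := fun l => (l * R ^ (l - 1) / (Nat.factorial l : ℝ)) * (Real.Gamma c)⁻¹
  have hG : 0 < Real.Gamma c := Real.Gamma_pos_of_pos (by linarith)
  have hu : Summable u := by
    refine Summable.mul_right _ ?_
    rw [← summable_nat_add_iff 1]
    refine (Real.summable_pow_div_factorial R).congr fun l => ?_
    rw [Nat.factorial_succ]
    have : (Nat.factorial l : ℝ) ≠ 0 := by positivity
    push_cast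
    field_simp
  have key := hasDerivAt_tsum_of_isPreconnected (t := Metric.ball (0 : ℝ) R)
    (g := fun (l : ℕ) y => (-y / 4) ^ l / ((Nat.factorial l : ℝ) * Real.Gamma (c + l)))
    (g' := fun (l : ℕ) y => (l * (-y / 4) ^ (l - 1) * (-1 / 4)) /
      ((Nat.factorial l : ℝ) * Real.Gamma (c + l))) hu Metric.isOpen_ball
      (convex_ball (0 : ℝ) R).isPreconnected ?_ ?_ (Metric.mem_ball_self hR)
      (summable_besselN hc 0) (y := x) ?_
  · refine key.congr_deriv ?_
    refine HasSum.tsum_eq ((hasSum_nat_add_iff' 1).1 ?_)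
    simp only [Finset.sum_range_one, Nat.cast_zero, zero_mul, zero_div, sub_zero]
    refine ((hasSum_besselN (c := c + 1) (by linarith) x).mul_left _).congr_fun fun l => ?_
    have e3 : c + ((l + 1 : ℕ) : ℝ) = c + 1 + l := by push_cast; ring
    rw [e3, Nat.factorial_succ]
    have h0 : (0 : ℝ) ≤ l := Nat.cast_nonneg l
    have : Real.Gamma (c + 1 + l) ≠ 0 := (Real.Gamma_pos_of_pos (by linarith)).ne'
    have : (Nat.factorial l : ℝ) ≠ 0 := by positivity
    push_cast
    field_simp
  · intro l y _
    refine HasDerivAt.div_const ?_ _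
    exact (((hasDerivAt_id y).neg.div_const 4).pow l)
  · intro l y hy
    have hy' : |y| ≤ R := by
      have := mem_ball_zero_iff.1 hy; rw [Real.norm_eq_abs] at this; exact this.le
    have hG' := gamma_le_gamma_add_nat hc l
    have hf : (0 : ℝ) < Nat.factorial l := by positivity
    have hb : |y / 4| ≤ R := by rw [abs_div]; norm_num; linarith [abs_nonneg y]
    rw [neg_div, norm_div, norm_mul, norm_mul, norm_pow, norm_mul, norm_neg, Real.norm_eq_abs,
      Real.norm_eq_abs, Real.norm_eq_abs (Nat.factorial l : ℝ),
      Real.norm_eq_abs (Real.Gamma _), abs_of_pos hf,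
      abs_of_pos (hG.trans_le hG'), ← div_div, div_eq_mul_inv _ (Real.Gamma (c + l))]
    have : ‖(-1 / 4 : ℝ)‖ ≤ 1 := by norm_num
    have hl : |(l : ℝ)| = l := abs_of_nonneg (Nat.cast_nonneg l)
    rw [hl]
    calc (l : ℝ) * |y / 4| ^ (l - 1) * ‖(-1 / 4 : ℝ)‖ / (Nat.factorial l) * (Real.Gamma (c + l))⁻¹
        ≤ (l : ℝ) * R ^ (l - 1) * 1 / (Nat.factorial l) * (Real.Gamma c)⁻¹ := by gcongr
      _ = _ := by rw [mul_one]
  · rw [mem_ball_zero_iff, Real.norm_eq_abs]; simp [R]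

lemma continuous_besselN {c : ℝ} (hc : 1 ≤ c) : Continuous (besselN c) :=
  continuous_iff_continuousAt.2 fun x => (hasDerivAt_besselN hc x).continuousAt

lemma hasDerivAt_besselN_succ {c : ℝ} (hc : 1 ≤ c) {x : ℝ} (hx : 0 < x) :
    HasDerivAt (besselN (c + 1)) ((besselN c x - c * besselN (c + 1) x) / x) x := by
  refine (hasDerivAt_besselN (by linarith) x).congr_deriv ?_
  rw [add_assoc, one_add_one_eq_two, eq_div_iff hx.ne']
  linarith [besselN_recurrence hc x]

/-- The energy `A^2 + x B^2 / 4` decreases, which bounds both solutions. -/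
lemma besselN_energy_le {c : ℝ} (hc : 1 ≤ c) {x : ℝ} (hx : 0 ≤ x) :
    besselN c x ^ 2 + x * besselN (c + 1) x ^ 2 / 4 ≤ (Real.Gamma c)⁻¹ ^ 2 := by
  have hanti : AntitoneOn (fun y => besselN c y ^ 2 + y * besselN (c + 1) y ^ 2 / 4)
      (Set.Ici 0) := by
    refine antitoneOn_of_deriv_nonpos (convex_Ici 0) ?_ ?_ ?_
    · have h1 := continuous_besselN hc
      have h2 := continuous_besselN (c := c + 1) (by linarith)
      fun_prop
    · rw [interior_Ici]
      intro y _
      have h1 := (hasDerivAt_besselN hc y).differentiableAt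
      have h2 := (hasDerivAt_besselN (c := c + 1) (by linarith) y).differentiableAt
      exact DifferentiableAt.differentiableWithinAt (by fun_prop)
    · rw [interior_Ici]
      intro y hy
      have h1 := (hasDerivAt_besselN hc y).pow 2
      have h2 := (((hasDerivAt_id y).mul
        ((hasDerivAt_besselN_succ hc hy).pow 2)).div_const 4)
      have h3 := (h1.add h2).deriv
      have h4 : deriv (fun y => besselN c y ^ 2 + y * besselN (c + 1) y ^ 2 / 4) y =
        (1 - 2 * c) / 4 * besselN (c + 1) y ^ 2 := by
        refine h3.trans ?_
        have : y ≠ 0 := (Set.mem_Ioi.1 hy).ne'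
        simp only [Pi.pow_apply, id]
        field_simp
        ring
      rw [h4]
      have := sq_nonneg (besselN (c + 1) y)
      nlinarith
  have := hanti (Set.self_mem_Ici) (Set.mem_Ici.2 hx) hx
  simpa [besselN_zero] using this

lemma abs_besselN_le {c : ℝ} (hc : 1 ≤ c) {x : ℝ} (hx : 0 ≤ x) :
    |besselN c x| ≤ (Real.Gamma c)⁻¹ := by
  have h := besselN_energy_le hc hx
  have hG : 0 < Real.Gamma c := Real.Gamma_pos_of_pos (by linarith)
  refine abs_le_of_sq_le_sq ?_ (by positivity)
  have : 0 ≤ x * besselN (c + 1) x ^ 2 / 4 := by positivity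
  linarith

lemma abs_besselN_add_nat_le {c : ℝ} (hc : 1 ≤ c) (p : ℕ) :
    ∃ C : ℝ, 0 ≤ C ∧ ∀ x : ℝ, 1 ≤ x → |besselN (c + p) x| ≤ C * x ^ (-((p : ℝ) / 2)) := by
  have hG : 0 < Real.Gamma c := Real.Gamma_pos_of_pos (by linarith)
  induction p using Nat.twoStepInduction with
  | zero =>
    refine ⟨(Real.Gamma c)⁻¹, by positivity, fun x hx => ?_⟩
    simpa using abs_besselN_le hc (by linarith : (0 : ℝ) ≤ x)
  | one =>
    refine ⟨2 * (Real.Gamma c)⁻¹, by positivity, fun x hx => ?_⟩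
    have h := besselN_energy_le hc (by linarith : (0 : ℝ) ≤ x)
    have hx0 : 0 < x := by linarith
    refine abs_le_of_sq_le_sq ?_ (by positivity)
    have e : (x ^ (-(((1 : ℕ) : ℝ) / 2))) ^ 2 = x⁻¹ := by
      rw [← Real.rpow_natCast, ← Real.rpow_mul hx0.le, ← Real.rpow_neg_one]; norm_num
    rw [mul_pow, e, ← div_eq_mul_inv, le_div_iff₀ hx0]
    have : 0 ≤ besselN c x ^ 2 := sq_nonneg _
    push_cast
    linarith
  | more p h0 h1 =>
    obtain ⟨C0, hC0, h0⟩ := h0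
    obtain ⟨C1, hC1, h1⟩ := h1
    have hp : (0 : ℝ) ≤ p := Nat.cast_nonneg p
    refine ⟨4 * ((c + p) * C1 + C0), by positivity, fun x hx => ?_⟩
    have hx0 : 0 < x := by linarith
    have hr := besselN_recurrence (c := c + p) (by linarith) x
    have e1 : c + ((p + 2 : ℕ) : ℝ) = c + p + 2 := by push_cast; ring
    have e2 : c + ((p + 1 : ℕ) : ℝ) = c + p + 1 := by push_cast; ring
    have e3 : x ^ (-(((p + 2 : ℕ) : ℝ) / 2)) = x ^ (-((p : ℝ) / 2)) / x := by
      rw [← Real.rpow_sub_one hx0.ne']; congr 1; push_cast; ring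
    have h0 := h0 x hx
    have h1 := h1 x hx
    have h1' : |besselN (c + p + 1) x| ≤ C1 * x ^ (-((p : ℝ) / 2)) := by
      rw [e2] at h1
      refine h1.trans ?_
      refine mul_le_mul_of_nonneg_left ?_ hC1
      exact Real.rpow_le_rpow_of_exponent_le hx (by push_cast; linarith)
    rw [e1, e3, ← mul_div_assoc, le_div_iff₀ hx0, ← abs_of_pos hx0, ← abs_mul, abs_of_pos hx0,
      mul_comm, hr, abs_mul, abs_of_pos (by norm_num : (0 : ℝ) < 4)]
    calc 4 * |(c + p) * besselN (c + p + 1) x - besselN (c + p) x|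
        ≤ 4 * ((c + p) * |besselN (c + p + 1) x| + |besselN (c + p) x|) := by
          gcongr
          refine (abs_sub _ _).trans ?_
          rw [abs_mul, abs_of_pos (by linarith : 0 < c + p)]
      _ ≤ 4 * ((c + p) * (C1 * x ^ (-((p : ℝ) / 2))) + C0 * x ^ (-((p : ℝ) / 2))) := by
          gcongr
      _ = _ := by ring

/-! ### Laplace and Mellin transforms of the normalized Bessel function -/

lemma integrableOn_Ioi_of_power_bounds {E : Type*} [NormedAddCommGroup E] [NormedSpace ℝ E]
    {F : ℝ → E} (hF : ContinuousOn F (Set.Ioi 0)) {C q p : ℝ} (hq : 0 < q) (hp : 0 < p)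
    (h0 : ∀ x, 0 < x → x ≤ 1 → ‖F x‖ ≤ C * x ^ (q - 1))
    (h1 : ∀ x, 1 ≤ x → ‖F x‖ ≤ C * x ^ (-p - 1)) :
    IntegrableOn F (Set.Ioi 0) ∧ ‖∫ x in Set.Ioi (0 : ℝ), F x‖ ≤ C * (1 / q + 1 / p) := by
  have hm0 : AEStronglyMeasurable F (volume.restrict (Set.Ioc 0 1)) :=
    (hF.mono fun x hx => hx.1).aestronglyMeasurable measurableSet_Ioc
  have hm1 : AEStronglyMeasurable F (volume.restrict (Set.Ioi 1)) :=
    (hF.mono fun x (hx : (1 : ℝ) < x) => (lt_trans one_pos hx : (0 : ℝ) < x)).aestronglyMeasurable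
      measurableSet_Ioi
  have hi0 : IntegrableOn (fun x : ℝ => C * x ^ (q - 1)) (Set.Ioc 0 1) :=
    ((intervalIntegrable_iff_integrableOn_Ioc_of_le zero_le_one).1
      (intervalIntegral.intervalIntegrable_rpow' (by linarith))).const_mul C
  have hi1 : IntegrableOn (fun x : ℝ => C * x ^ (-p - 1)) (Set.Ioi 1) :=
    (integrableOn_Ioi_rpow_of_lt (by linarith) one_pos).const_mul C
  have hF0 : IntegrableOn F (Set.Ioc 0 1) :=
    Integrable.mono' hi0 hm0 ((ae_restrict_iff' measurableSet_Ioc).2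
      (ae_of_all _ fun x hx => h0 x hx.1 hx.2))
  have hF1 : IntegrableOn F (Set.Ioi 1) :=
    Integrable.mono' hi1 hm1 ((ae_restrict_iff' measurableSet_Ioi).2
      (ae_of_all _ fun x hx => h1 x (le_of_lt hx)))
  have hu : Set.Ioc (0 : ℝ) 1 ∪ Set.Ioi 1 = Set.Ioi 0 := Set.Ioc_union_Ioi_eq_Ioi zero_le_one
  refine ⟨by rw [← hu]; exact hF0.union hF1, ?_⟩
  rw [← hu, setIntegral_union (Set.Ioc_disjoint_Ioi le_rfl) measurableSet_Ioi hF0 hF1]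
  refine (norm_add_le _ _).trans ?_
  rw [mul_add]
  refine add_le_add ?_ ?_
  · refine (norm_integral_le_of_norm_le hi0 ((ae_restrict_iff' measurableSet_Ioc).2
      (ae_of_all _ fun x hx => h0 x hx.1 hx.2))).trans ?_
    rw [integral_const_mul, ← intervalIntegral.integral_of_le zero_le_one,
      integral_rpow (Or.inl (by linarith))]
    simp [hq.ne']
  · refine (norm_integral_le_of_norm_le hi1 ((ae_restrict_iff' measurableSet_Ioi).2
      (ae_of_all _ fun x hx => h1 x (le_of_lt hx)))).trans ?_
    rw [integral_const_mul, integral_Ioi_rpow_of_lt (by linarith) one_pos]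
    have : -p - 1 + 1 = -p := by ring
    rw [this, Real.one_rpow, neg_div_neg_eq]

lemma integral_exp_mul_besselN {c t : ℝ} (hc : 1 ≤ c) (ht : 0 < t) :
    ∫ x in Set.Ioi (0 : ℝ), Real.exp (-(t * x)) * (x ^ (c - 1) * besselN c x) =
      t ^ (-c) * Real.exp (-(1 / (4 * t))) := by
  set F : ℕ → ℝ → ℝ := fun l x => Real.exp (-(t * x)) * (x ^ (c - 1) *
    ((-x / 4) ^ l / ((Nat.factorial l : ℝ) * Real.Gamma (c + l))))
  have hbase : ∀ l : ℕ, IntegrableOn (fun x : ℝ => x ^ (c + l - 1) * Real.exp (-(t * x)))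
      (Set.Ioi 0) := fun l => by
    have h0 : (0 : ℝ) ≤ l := Nat.cast_nonneg l
    have := integrableOn_rpow_mul_exp_neg_mul_rpow (s := c + l - 1) (p := 1) (b := t)
      (by linarith) one_pos ht
    simpa [neg_mul] using this
  have hint : ∀ l : ℕ, ∫ x in Set.Ioi (0 : ℝ), x ^ (c + l - 1) * Real.exp (-(t * x)) =
      (1 / t) ^ (c + l) * Real.Gamma (c + l) := fun l => by
    have h0 : (0 : ℝ) ≤ l := Nat.cast_nonneg l
    exact Real.integral_rpow_mul_exp_neg_mul_Ioi (by linarith) ht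
  have hFeq : ∀ l : ℕ, ∀ x ∈ Set.Ioi (0 : ℝ), F l x =
      ((-1 / 4) ^ l / ((Nat.factorial l : ℝ) * Real.Gamma (c + l))) *
        (x ^ (c + l - 1) * Real.exp (-(t * x))) := fun l x hx => by
    have e : x ^ (c + l - 1) = x ^ (c - 1) * x ^ l := by
      rw [← Real.rpow_natCast, ← Real.rpow_add hx]; congr 1; ring
    have e2 : (-x / 4) ^ l = (-1 / 4) ^ l * x ^ l := by rw [← mul_pow]; congr 1; ring
    simp only [F]
    rw [e, e2]
    ring
  have hnorm : ∀ l : ℕ, ∫ x in Set.Ioi (0 : ℝ), ‖F l x‖ =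
      (1 / t) ^ c * ((1 / (4 * t)) ^ l / (Nat.factorial l : ℝ)) := fun l => by
    have h0 : (0 : ℝ) ≤ l := Nat.cast_nonneg l
    have hG : 0 < Real.Gamma (c + l) := Real.Gamma_pos_of_pos (by linarith)
    have hf : (0 : ℝ) < Nat.factorial l := by positivity
    have : ∀ x ∈ Set.Ioi (0 : ℝ), ‖F l x‖ =
        ((1 / 4) ^ l / ((Nat.factorial l : ℝ) * Real.Gamma (c + l))) *
        (x ^ (c + l - 1) * Real.exp (-(t * x))) := fun x hx => by
      rw [hFeq l x hx, norm_mul, norm_div, norm_pow, norm_div, norm_neg, norm_one,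
        Real.norm_of_nonneg (by positivity : 0 ≤ (Nat.factorial l : ℝ) * Real.Gamma (c + l)),
        Real.norm_of_nonneg (mul_nonneg (Real.rpow_nonneg (le_of_lt hx) _) (Real.exp_pos _).le)]
      norm_num
    rw [setIntegral_congr_fun measurableSet_Ioi this, integral_const_mul, hint,
      Real.rpow_add (by positivity), Real.rpow_natCast]
    have : (1 / (4 * t)) ^ l = (1 / 4) ^ l * (1 / t) ^ l := by rw [← mul_pow]; congr 1; field_simp
    rw [this]
    field_simp
  have hval : ∀ l : ℕ, ∫ x in Set.Ioi (0 : ℝ), F l x =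
      (1 / t) ^ c * ((-(1 / (4 * t))) ^ l / (Nat.factorial l : ℝ)) := fun l => by
    have h0 : (0 : ℝ) ≤ l := Nat.cast_nonneg l
    have hG : 0 < Real.Gamma (c + l) := Real.Gamma_pos_of_pos (by linarith)
    have hf : (0 : ℝ) < Nat.factorial l := by positivity
    rw [setIntegral_congr_fun measurableSet_Ioi (hFeq l), integral_const_mul, hint,
      Real.rpow_add (by positivity), Real.rpow_natCast]
    have : (-(1 / (4 * t))) ^ l = (-1 / 4) ^ l * (1 / t) ^ l := by
      rw [← mul_pow]; congr 1; field_simp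
    rw [this]
    field_simp
  have hFi : ∀ l, Integrable (F l) (volume.restrict (Set.Ioi 0)) := fun l =>
    ((integrableOn_congr_fun (hFeq l) measurableSet_Ioi).2 ((hbase l).const_mul _))
  have hs : Summable fun l => ∫ x in Set.Ioi (0 : ℝ), ‖F l x‖ := by
    simp_rw [hnorm]
    exact (Real.summable_pow_div_factorial _).mul_left _
  have key := hasSum_integral_of_summable_integral_norm hFi hs
  have e : ∀ x, ∑' l, F l x = Real.exp (-(t * x)) * (x ^ (c - 1) * besselN c x) := fun x => by
    simp only [F, besselN, tsum_mul_left]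
  simp_rw [e] at key
  refine key.unique ?_
  simp_rw [hval]
  have h2 := (NormedSpace.expSeries_div_hasSum_exp (-(1 / (4 * t)) : ℝ)).mul_left ((1 / t) ^ c)
  rw [← Real.exp_eq_exp_ℝ] at h2
  rwa [Real.rpow_neg ht.le, ← Real.inv_rpow ht.le, ← one_div]

lemma integral_rpow_mul_exp_neg_inv {q : ℝ} (hq : 0 < q) :
    ∫ t in Set.Ioi (0 : ℝ), t ^ (-q - 1) * Real.exp (-(1 / (4 * t))) =
      4 ^ q * Real.Gamma q := by
  have h := integral_comp_rpow_Ioi (fun y : ℝ => y ^ (q - 1) * Real.exp (-((1 / 4) * y)))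
    (p := -1) (by norm_num)
  rw [Real.integral_rpow_mul_exp_neg_mul_Ioi hq (by norm_num)] at h
  rw [show (4 : ℝ) = 1 / (1 / 4) by norm_num, ← h]
  refine setIntegral_congr_fun measurableSet_Ioi fun t ht => ?_
  have ht' : 0 < t := ht
  simp only [smul_eq_mul, abs_neg, abs_one, one_mul]
  rw [← Real.rpow_mul ht'.le, ← mul_assoc, ← Real.rpow_add ht', Real.rpow_neg_one]
  congr 2
  · ring
  · field_simp

lemma integral_rpow_mul_besselN {c q : ℝ} (hc : 1 ≤ c) (hq : 0 < q) (hqc : q < c)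
    (hint : IntegrableOn (fun x : ℝ => x ^ (q - 1) * besselN c x) (Set.Ioi 0)) :
    ∫ x in Set.Ioi (0 : ℝ), x ^ (q - 1) * besselN c x =
      4 ^ q * Real.Gamma q / Real.Gamma (c - q) := by
  have hG : 0 < Real.Gamma (c - q) := Real.Gamma_pos_of_pos (by linarith)
  set K : ℝ → ℝ → ℝ := fun x t =>
    (t ^ (c - q - 1) * Real.exp (-(x * t))) * (x ^ (c - 1) * besselN c x)
  have hinner : ∀ x, 0 < x → ∫ t in Set.Ioi (0 : ℝ), t ^ (c - q - 1) * Real.exp (-(x * t)) =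
      x ^ (q - c) * Real.Gamma (c - q) := fun x hx => by
    rw [Real.integral_rpow_mul_exp_neg_mul_Ioi (by linarith) hx, one_div, Real.inv_rpow hx.le,
      ← Real.rpow_neg hx.le, neg_sub]
  have hinneri : ∀ x, 0 < x →
      IntegrableOn (fun t : ℝ => t ^ (c - q - 1) * Real.exp (-(x * t))) (Set.Ioi 0) :=
    fun x hx => by
      have := integrableOn_rpow_mul_exp_neg_mul_rpow (s := c - q - 1) (p := 1) (b := x)
        (by linarith) one_pos hx
      simpa [neg_mul] using this
  have hKm : AEStronglyMeasurable (Function.uncurry K)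
      ((volume.restrict (Set.Ioi (0 : ℝ))).prod (volume.restrict (Set.Ioi (0 : ℝ)))) := by
    have hb : Measurable (besselN c) := (continuous_besselN hc).measurable
    refine Measurable.aestronglyMeasurable ?_
    simp only [Function.uncurry_def, K]
    fun_prop
  have hpow : ∀ x : ℝ, 0 < x → x ^ (q - c) * x ^ (c - 1) = x ^ (q - 1) := fun x hx => by
    rw [← Real.rpow_add hx]; congr 1; ring
  have hKi : Integrable (Function.uncurry K)
      ((volume.restrict (Set.Ioi (0 : ℝ))).prod (volume.restrict (Set.Ioi (0 : ℝ)))) := by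
    rw [integrable_prod_iff hKm]
    constructor
    · refine (ae_restrict_iff' measurableSet_Ioi).2 (ae_of_all _ fun x hx => ?_)
      exact (hinneri x hx).mul_const (x ^ (c - 1) * besselN c x)
    · have : ∀ x ∈ Set.Ioi (0 : ℝ), ∫ t in Set.Ioi (0 : ℝ), ‖Function.uncurry K (x, t)‖ =
          Real.Gamma (c - q) * ‖x ^ (q - 1) * besselN c x‖ := fun x hx => by
        have hx' : 0 < x := hx
        have : ∀ t ∈ Set.Ioi (0 : ℝ), ‖Function.uncurry K (x, t)‖ =
            t ^ (c - q - 1) * Real.exp (-(x * t)) * ‖x ^ (c - 1) * besselN c x‖ := fun t ht => by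
          simp only [Function.uncurry, K]
          rw [norm_mul, Real.norm_of_nonneg
            (mul_nonneg (Real.rpow_nonneg (le_of_lt ht) _) (Real.exp_pos _).le)]
        rw [setIntegral_congr_fun measurableSet_Ioi this, integral_mul_const, hinner x hx,
          norm_mul, norm_mul, ← hpow x hx, norm_mul, Real.norm_of_nonneg
            (Real.rpow_nonneg hx'.le (q - c))]
        ring
      exact (integrableOn_congr_fun this measurableSet_Ioi).2 (hint.norm.const_mul _)
  have hswap := integral_integral_swap hKi
  have hL : ∫ x in Set.Ioi (0 : ℝ), ∫ t in Set.Ioi (0 : ℝ), K x t =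
      Real.Gamma (c - q) * ∫ x in Set.Ioi (0 : ℝ), x ^ (q - 1) * besselN c x := by
    rw [← integral_const_mul]
    refine setIntegral_congr_fun measurableSet_Ioi fun x hx => ?_
    simp only [K]
    rw [integral_mul_const, hinner x hx, ← hpow x hx]
    ring
  have hR : ∫ t in Set.Ioi (0 : ℝ), ∫ x in Set.Ioi (0 : ℝ), K x t = 4 ^ q * Real.Gamma q := by
    rw [← integral_rpow_mul_exp_neg_inv hq]
    refine setIntegral_congr_fun measurableSet_Ioi fun t ht => ?_
    have : ∀ x, K x t = t ^ (c - q - 1) * (Real.exp (-(t * x)) * (x ^ (c - 1) * besselN c x)) :=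
      fun x => by simp only [K]; rw [mul_comm x t]; ring
    simp_rw [this]
    rw [integral_const_mul, integral_exp_mul_besselN hc ht, ← mul_assoc, ← Real.rpow_add ht]
    congr 2
    ring
  rw [hL, hR] at hswap
  rw [eq_div_iff hG.ne', mul_comm, hswap]

/-! ### Holomorphic functions on the right half-plane -/

/-- Taylor remainder of `exp (-w)` at the origin. -/
def expRemainder (m : ℕ) (w : ℂ) : ℂ :=
  Complex.exp (-w) - ∑ k ∈ Finset.range m, (-w) ^ k / (Nat.factorial k : ℂ)

lemma hasDerivAt_expRemainder_succ (m : ℕ) (w : ℂ) :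
    HasDerivAt (expRemainder (m + 1)) (-expRemainder m w) w := by
  have h1 : HasDerivAt (fun w : ℂ => Complex.exp (-w)) (-Complex.exp (-w)) w := by
    simpa using (hasDerivAt_neg w).cexp
  have h2 : HasDerivAt (fun w : ℂ => ∑ k ∈ Finset.range (m + 1), (-w) ^ k / (Nat.factorial k : ℂ))
      (∑ k ∈ Finset.range (m + 1), ((k : ℂ) * (-w) ^ (k - 1) * (-1)) / (Nat.factorial k : ℂ)) w :=
    HasDerivAt.fun_sum fun k _ => ((hasDerivAt_neg w).fun_pow k).div_const _
  refine (h1.sub h2).congr_deriv ?_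
  rw [Finset.sum_range_succ', expRemainder]
  have : ∀ k ∈ Finset.range m, ((k + 1 : ℕ) : ℂ) * (-w) ^ (k + 1 - 1) * (-1) /
      (Nat.factorial (k + 1) : ℂ) = -((-w) ^ k / (Nat.factorial k : ℂ)) := fun k _ => by
    have h1 : (Nat.factorial k : ℂ) ≠ 0 := by exact_mod_cast Nat.factorial_ne_zero k
    have h2 : ((k : ℂ) + 1) ≠ 0 := by exact_mod_cast Nat.succ_ne_zero k
    rw [Nat.factorial_succ, Nat.add_sub_cancel]
    push_cast
    field_simp
  rw [Finset.sum_congr rfl this, Finset.sum_neg_distrib]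
  simp
  ring

lemma norm_expRemainder_le (m : ℕ) {w : ℂ} (hw : 0 ≤ w.re) : ‖expRemainder m w‖ ≤ ‖w‖ ^ m := by
  induction m generalizing w with
  | zero => simpa [expRemainder, Complex.norm_exp] using hw
  | succ m ih =>
    have hd : ∀ s ∈ Set.Icc (0 : ℝ) 1, HasDerivWithinAt
        (fun s : ℝ => expRemainder (m + 1) ((s : ℂ) * w))
        (-expRemainder m ((s : ℂ) * w) * w) (Set.Icc 0 1) s := fun s _ => by
      have h1 : HasDerivAt (fun z : ℂ => z * w) w (s : ℂ) := by
        simpa using (hasDerivAt_id (s : ℂ)).mul_const w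
      have h2 := (hasDerivAt_expRemainder_succ m ((s : ℂ) * w)).comp (s : ℂ) h1
      exact h2.comp_ofReal.hasDerivWithinAt
    have h := norm_image_sub_le_of_norm_deriv_le_segment_01' (C := ‖w‖ ^ (m + 1)) hd fun s hs => by
      have hre : 0 ≤ ((s : ℂ) * w).re := by
        rw [Complex.re_ofReal_mul]; exact mul_nonneg hs.1 hw
      rw [norm_mul, norm_neg, pow_succ]
      refine mul_le_mul_of_nonneg_right ((ih hre).trans ?_) (norm_nonneg _)
      rw [norm_mul, Complex.norm_real, Real.norm_of_nonneg hs.1]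
      exact pow_le_pow_left₀ (mul_nonneg hs.1 (norm_nonneg _))
        (mul_le_of_le_one_left (norm_nonneg _) hs.2.le) _
    have h0 : expRemainder (m + 1) 0 = 0 := by
      simp [expRemainder, Finset.sum_range_succ']
    simpa [h0] using h

lemma differentiable_expRemainder (m : ℕ) : Differentiable ℂ (expRemainder m) := by
  unfold expRemainder
  fun_prop

lemma isOpen_rightHalfPlane : IsOpen {z : ℂ | 0 < z.re} :=
  isOpen_lt continuous_const Complex.continuous_re

lemma analyticAt_of_pos {f : ℂ → ℂ} (hf : DifferentiableOn ℂ f {z : ℂ | 0 < z.re}) {x : ℝ}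
    (hx : 0 < x) : AnalyticAt ℂ f x :=
  hf.analyticAt (isOpen_rightHalfPlane.mem_nhds (by simpa using hx))

lemma hasDerivAt_iteratedDeriv_of_pos {f : ℂ → ℂ}
    (hf : DifferentiableOn ℂ f {z : ℂ | 0 < z.re}) (p : ℕ) {x : ℝ} (hx : 0 < x) :
    HasDerivAt (fun y : ℝ => iteratedDeriv p f y) (iteratedDeriv (p + 1) f x) x := by
  have h : AnalyticAt ℂ (iteratedDeriv p f) x := by
    rw [iteratedDeriv_eq_iterate]
    exact (analyticAt_of_pos hf hx).iterated_deriv p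
  rw [iteratedDeriv_succ]
  exact h.differentiableAt.hasDerivAt.comp_ofReal

lemma continuousOn_iteratedDeriv_of_pos {f : ℂ → ℂ}
    (hf : DifferentiableOn ℂ f {z : ℂ | 0 < z.re}) (p : ℕ) :
    ContinuousOn (fun y : ℝ => iteratedDeriv p f y) (Set.Ioi 0) := fun _ hx =>
  (hasDerivAt_iteratedDeriv_of_pos hf p hx).continuousAt.continuousWithinAt

lemma norm_iteratedDeriv_le_of_pos {f : ℂ → ℂ}
    (hf : DifferentiableOn ℂ f {z : ℂ | 0 < z.re}) (p : ℕ) {x δ K : ℝ} (hx : 0 < x)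
    (hδ : 0 < δ) (hδ1 : δ < 1) (hK : ∀ z : ℂ, ‖z - x‖ ≤ δ * x → ‖f z‖ ≤ K) :
    ‖iteratedDeriv p f x‖ ≤ Nat.factorial p * K / (δ * x) ^ p := by
  have hsub : Metric.closedBall (x : ℂ) (δ * x) ⊆ {z : ℂ | 0 < z.re} := fun z hz => by
    rw [Metric.mem_closedBall, dist_eq_norm] at hz
    have h1 := (abs_le.1 ((Complex.abs_re_le_norm (z - x)).trans hz)).1
    simp only [Complex.sub_re, Complex.ofReal_re] at h1
    have : δ * x < x := by nlinarith
    simp only [Set.mem_ofPred_eq]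
    linarith
  refine Complex.norm_iteratedDeriv_le_of_forall_mem_sphere_norm_le p (by positivity) ?_
    fun z hz => hK z ?_
  · refine DifferentiableOn.diffContOnCl (hf.mono ?_)
    exact Metric.closure_ball_subset_closedBall.trans hsub
  · rw [Metric.mem_sphere, dist_eq_norm] at hz
    exact hz.le

lemma differentiableOn_cpow_rightHalfPlane (s : ℂ) :
    DifferentiableOn ℂ (fun z : ℂ => z ^ s) {z : ℂ | 0 < z.re} := fun z hz =>
  ((hasDerivAt_id z).cpow_const (Or.inl hz)).differentiableAt.differentiableWithinAt

lemma iteratedDeriv_cpow_of_pos (s : ℝ) (p : ℕ) {x : ℝ} (hx : 0 < x) :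
    iteratedDeriv p (fun z : ℂ => z ^ (s : ℂ)) x =
      (((-1) ^ p * (∏ i ∈ Finset.range p, (-s + i)) * x ^ (s - p) : ℝ) : ℂ) := by
  have key : ∀ z : ℂ, 0 < z.re → iteratedDeriv p (fun z : ℂ => z ^ (s : ℂ)) z =
      (((-1) ^ p * ∏ i ∈ Finset.range p, (-s + i) : ℝ) : ℂ) * z ^ ((s : ℂ) - p) := by
    induction p with
    | zero => intro z _; simp
    | succ p ih =>
      intro z hz
      have he : iteratedDeriv p (fun z : ℂ => z ^ (s : ℂ)) =ᶠ[𝓝 z] fun z =>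
          (((-1) ^ p * ∏ i ∈ Finset.range p, (-s + i) : ℝ) : ℂ) * z ^ ((s : ℂ) - p) :=
        Filter.eventually_of_mem (isOpen_rightHalfPlane.mem_nhds hz) fun y hy => ih y hy
      have hd : HasDerivAt (fun z : ℂ => z ^ ((s : ℂ) - p))
          (((s : ℂ) - p) * z ^ ((s : ℂ) - p - 1) * 1) z :=
        (hasDerivAt_id z).cpow_const (Or.inl hz)
      rw [iteratedDeriv_succ, he.deriv_eq, (hd.const_mul _).deriv, Finset.prod_range_succ]
      have : (s : ℂ) - ((p + 1 : ℕ) : ℂ) = (s : ℂ) - p - 1 := by push_cast; ring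
      rw [this, pow_succ]
      push_cast
      ring
  have e := Complex.ofReal_cpow hx.le (s - p)
  rw [key x (by simpa using hx), Complex.ofReal_mul (_ * _) (x ^ (s - p)), e]
  push_cast
  ring

/-! ### Integration by parts against the normalized Bessel function -/

lemma hasDerivAt_rpow_mul_besselN {c x : ℝ} (hc : 1 ≤ c) (hx : 0 < x) :
    HasDerivAt (fun y => y ^ c * besselN (c + 1) y) (x ^ (c - 1) * besselN c x) x := by
  have h1 := (Real.hasDerivAt_rpow_const (p := c) (Or.inl hx.ne')).mul
    (hasDerivAt_besselN_succ hc hx)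
  refine h1.congr_deriv ?_
  have : x ^ c = x ^ (c - 1) * x := by
    rw [← Real.rpow_add_one hx.ne']; congr 1; ring
  rw [this]
  field_simp
  ring

lemma integral_iteratedDeriv_mul_besselN {f : ℂ → ℂ} {a c : ℝ} (hc : 1 ≤ c) (hac : a < c)
    (hf : DifferentiableOn ℂ f {z : ℂ | 0 < z.re})
    (hb : ∀ p : ℕ, ∃ C : ℝ, ∀ x : ℝ, 0 < x → ‖iteratedDeriv p f x‖ ≤ C * x ^ (-a - p) ∧
      ‖iteratedDeriv p f x‖ ≤ C * x ^ (-(c + 1) - p)) (M : ℕ) :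
    ∫ x in Set.Ioi (0 : ℝ), f x * ((x ^ (c - 1) * besselN c x : ℝ) : ℂ) =
      ∫ x in Set.Ioi (0 : ℝ), ((-1) ^ M * iteratedDeriv M f x) *
        ((x ^ (c + M - 1) * besselN (c + M) x : ℝ) : ℂ) := by
  have hcM : ∀ p : ℕ, 1 ≤ c + p := fun p => by
    have : (0 : ℝ) ≤ p := Nat.cast_nonneg p
    linarith
  have hcont : ∀ (p : ℕ) (s b : ℝ), 1 ≤ b → ContinuousOn (fun x : ℝ =>
      iteratedDeriv p f x * ((x ^ s * besselN b x : ℝ) : ℂ)) (Set.Ioi 0) := fun p s b hb' => by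
    refine (continuousOn_iteratedDeriv_of_pos hf p).mul
      (Complex.continuous_ofReal.comp_continuousOn ?_)
    exact (continuousOn_id.rpow_const fun x hx => Or.inl (ne_of_gt hx)).mul
      (continuous_besselN hb').continuousOn
  have hbd : ∀ (p : ℕ) (s b : ℝ), 1 ≤ b → ∃ C : ℝ, ∀ x : ℝ, 0 < x →
      ‖iteratedDeriv p f x * ((x ^ s * besselN b x : ℝ) : ℂ)‖ ≤ C * x ^ (s - a - p) ∧
      ‖iteratedDeriv p f x * ((x ^ s * besselN b x : ℝ) : ℂ)‖ ≤ C * x ^ (s - (c + 1) - p) :=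
    fun p s b hb' => by
      obtain ⟨C, hC⟩ := hb p
      refine ⟨C * (Real.Gamma b)⁻¹, fun x hx => ?_⟩
      have hβ := abs_besselN_le hb' hx.le
      have hn : ‖((x ^ s * besselN b x : ℝ) : ℂ)‖ ≤ x ^ s * (Real.Gamma b)⁻¹ := by
        rw [Complex.norm_real, norm_mul, Real.norm_of_nonneg (Real.rpow_nonneg hx.le _)]
        exact mul_le_mul_of_nonneg_left hβ (Real.rpow_nonneg hx.le _)
      have aux : ∀ e : ℝ, ‖iteratedDeriv p f x‖ ≤ C * x ^ (e - p) →
          ‖iteratedDeriv p f x * ((x ^ s * besselN b x : ℝ) : ℂ)‖ ≤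
            C * (Real.Gamma b)⁻¹ * x ^ (s + e - p) := fun e he => by
        rw [norm_mul]
        refine (mul_le_mul he hn (norm_nonneg _) ((norm_nonneg _).trans he)).trans (le_of_eq ?_)
        rw [show s + e - p = (e - p) + s by ring, Real.rpow_add hx]
        ring
      have h1 := aux (-a) (hC x hx).1
      have h2 := aux (-(c + 1)) (hC x hx).2
      exact ⟨by rwa [← sub_eq_add_neg] at h1, by rwa [← sub_eq_add_neg] at h2⟩
  have hint : ∀ (p : ℕ) (s b : ℝ), 1 ≤ b → s = c + p - 1 → IntegrableOn (fun x : ℝ =>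
      iteratedDeriv p f x * ((x ^ s * besselN b x : ℝ) : ℂ)) (Set.Ioi 0) := fun p s b hb' hs => by
    obtain ⟨C, hC⟩ := hbd p s b hb'
    refine (integrableOn_Ioi_of_power_bounds (hcont p s b hb') (C := C) (q := c - a) (p := 1)
      (by linarith) one_pos (fun x hx _ => ?_) (fun x hx => ?_)).1
    · have := (hC x hx).1
      rwa [show s - a - p = c - a - 1 by rw [hs]; ring] at this
    · have := (hC x (by linarith)).2
      rwa [show s - (c + 1) - p = -1 - 1 by rw [hs]; ring] at this
  have step : ∀ p : ℕ, ∫ x in Set.Ioi (0 : ℝ), iteratedDeriv p f x *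
      ((x ^ (c + p - 1) * besselN (c + p) x : ℝ) : ℂ) =
      -∫ x in Set.Ioi (0 : ℝ), iteratedDeriv (p + 1) f x *
        ((x ^ (c + p) * besselN (c + p + 1) x : ℝ) : ℂ) := fun p => by
    obtain ⟨C, hC⟩ := hbd p (c + p) (c + p + 1) (by have := hcM p; linarith)
    have h := integral_Ioi_mul_deriv_eq_deriv_mul (a := (0 : ℝ)) (a' := (0 : ℂ)) (b' := 0)
      (u := fun x : ℝ => iteratedDeriv p f x) (u' := fun x : ℝ => iteratedDeriv (p + 1) f x)
      (v := fun x : ℝ => ((x ^ (c + p) * besselN (c + p + 1) x : ℝ) : ℂ))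
      (v' := fun x : ℝ => ((x ^ (c + p - 1) * besselN (c + p) x : ℝ) : ℂ))
      (fun x hx => hasDerivAt_iteratedDeriv_of_pos hf p hx)
      (fun x hx => (hasDerivAt_rpow_mul_besselN (hcM p) hx).ofReal_comp)
      (hint p _ _ (hcM p) rfl)
      (hint (p + 1) _ _ (by have := hcM p; linarith) (by push_cast; ring)) ?_ ?_
    · rw [h]; simp
    · refine squeeze_zero_norm' (a := fun x : ℝ => C * x ^ (c - a)) ?_ ?_
      · filter_upwards [self_mem_nhdsWithin] with x hx
        have := (hC x hx).1
        rwa [show c + p - a - p = c - a by ring] at this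
      · have : Tendsto (fun x : ℝ => C * x ^ (c - a)) (𝓝 0) (𝓝 (C * 0 ^ (c - a))) :=
          ((Real.continuousAt_rpow_const 0 (c - a) (Or.inr (by linarith))).tendsto).const_mul C
        rw [Real.zero_rpow (by linarith), mul_zero] at this
        exact this.mono_left nhdsWithin_le_nhds
    · refine squeeze_zero_norm' (a := fun x : ℝ => C * x ^ (-1 : ℝ)) ?_ ?_
      · filter_upwards [eventually_gt_atTop (0 : ℝ)] with x hx
        have := (hC x hx).2
        rwa [show c + p - (c + 1) - p = -1 by ring] at this
      · simpa using (tendsto_rpow_neg_atTop (y := 1) one_pos).const_mul C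
  induction M with
  | zero => simp
  | succ M ih =>
    rw [ih]
    simp_rw [mul_assoc]
    rw [integral_const_mul, step M, integral_const_mul, pow_succ]
    push_cast
    rw [show c + (M + 1 : ℝ) - 1 = c + M by ring, show c + (M + 1 : ℝ) = c + M + 1 by ring]
    ring

/-! ### Expansion of the radial integral -/

lemma one_div_gamma_eq (s : ℝ) (M : ℕ) :
    (∏ i ∈ Finset.range M, (s + i)) / Real.Gamma (s + M) = 1 / Real.Gamma s := by
  have h : ∀ t : ℝ, t / Real.Gamma (t + 1) = 1 / Real.Gamma t := fun t => by
    rcases eq_or_ne t 0 with rfl | ht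
    · simp [Real.Gamma_zero]
    · rw [Real.Gamma_add_one ht, div_mul_eq_div_div, div_self ht]
  induction M with
  | zero => simp
  | succ M ih =>
    rw [← ih, Finset.prod_range_succ, mul_div_assoc, div_eq_mul_one_div _ (Real.Gamma (s + M)),
      ← h (s + M)]
    push_cast
    rw [add_assoc]

/-- The function `z ↦ z^(-a) τ_m(η z^γ)` with `τ_m` the Taylor remainder of `exp (-w)`. -/
def radialFun (a γ : ℝ) (η : ℂ) (m : ℕ) (z : ℂ) : ℂ :=
  z ^ ((-a : ℝ) : ℂ) * expRemainder m (η * z ^ (γ : ℂ))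

lemma differentiableOn_radialFun (a γ : ℝ) (η : ℂ) (m : ℕ) :
    DifferentiableOn ℂ (radialFun a γ η m) {z : ℂ | 0 < z.re} :=
  (differentiableOn_cpow_rightHalfPlane _).mul
    ((differentiable_expRemainder m).comp_differentiableOn
      ((differentiableOn_cpow_rightHalfPlane _).const_mul η))

lemma exists_sector (γ : ℝ) {c₀ C₀ : ℝ} (hc₀ : 0 < c₀) (hC₀ : 0 ≤ C₀) :
    ∃ δ : ℝ, 0 < δ ∧ δ ≤ 1 / 2 ∧ ∀ ε : ℝ, 0 < ε → ∀ η : ℂ, ‖η‖ ≤ C₀ * ε → c₀ * ε ≤ η.re →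
      ∀ x : ℝ, 0 < x → ∀ z : ℂ, ‖z - x‖ ≤ δ * x →
        x / 2 ≤ ‖z‖ ∧ ‖z‖ ≤ 2 * x ∧ c₀ / 2 * (ε * x ^ γ) ≤ (η * z ^ (γ : ℂ)).re := by
  have hcont : ContinuousAt (fun w : ℂ => w ^ (γ : ℂ)) 1 :=
    ((hasDerivAt_id (1 : ℂ)).cpow_const (c := (γ : ℂ)) (Or.inl (by simp))).continuousAt
  have hκ : 0 < c₀ / (2 * (C₀ + 1)) := by positivity
  obtain ⟨δ, hδ, hδ'⟩ := Metric.continuousAt_iff.1 hcont _ hκ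
  refine ⟨min (δ / 2) (1 / 2), by positivity, min_le_right _ _, ?_⟩
  intro ε hε η hη hre x hx z hz
  have hz2 : ‖z - x‖ ≤ 1 / 2 * x := hz.trans (mul_le_mul_of_nonneg_right (min_le_right _ _) hx.le)
  have hz1 : ‖z - x‖ ≤ δ / 2 * x := hz.trans (mul_le_mul_of_nonneg_right (min_le_left _ _) hx.le)
  have hxn : ‖(x : ℂ)‖ = x := by rw [Complex.norm_real, Real.norm_of_nonneg hx.le]
  have hlow : x / 2 ≤ ‖z‖ := by
    have := norm_sub_norm_le (x : ℂ) z
    rw [norm_sub_rev, hxn] at this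
    linarith
  have hup : ‖z‖ ≤ 2 * x := by
    have := norm_sub_norm_le z (x : ℂ)
    rw [hxn] at this
    linarith
  refine ⟨hlow, hup, ?_⟩
  have hx0 : (x : ℂ) ≠ 0 := by exact_mod_cast hx.ne'
  set w : ℂ := z / x with hw
  have hzw : z = x * w := by rw [hw]; field_simp
  have hw1 : ‖w - 1‖ ≤ δ / 2 := by
    have : w - 1 = (z - x) / x := by rw [hw]; field_simp
    rw [this, norm_div, hxn, div_le_iff₀ hx]
    exact hz1
  have hw0 : w ≠ 0 := by
    have : z ≠ 0 := norm_pos_iff.1 (by linarith)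
    exact div_ne_zero this hx0
  have hcl : ‖w ^ (γ : ℂ) - 1‖ ≤ c₀ / (2 * (C₀ + 1)) := by
    have h := hδ' (x := w) (by rw [dist_eq_norm]; linarith)
    rw [dist_eq_norm, Complex.one_cpow] at h
    exact h.le
  have hmul : z ^ (γ : ℂ) = ((x ^ γ : ℝ) : ℂ) * w ^ (γ : ℂ) := by
    rw [hzw, Complex.cpow_def_of_ne_zero (mul_ne_zero hx0 hw0), Complex.log_ofReal_mul hx hw0,
      add_mul, Complex.exp_add, Complex.cpow_def_of_ne_zero hw0, Real.rpow_def_of_pos hx]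
    push_cast
    rfl
  have hexp : (η * z ^ (γ : ℂ)).re = x ^ γ * (η.re + (η * (w ^ (γ : ℂ) - 1)).re) := by
    rw [hmul, ← Complex.add_re, ← Complex.re_ofReal_mul]
    congr 1
    ring
  have hsmall : -(c₀ / 2 * ε) ≤ (η * (w ^ (γ : ℂ) - 1)).re := by
    have h1 := (abs_le.1 (Complex.abs_re_le_norm (η * (w ^ (γ : ℂ) - 1)))).1
    have h2 : ‖η * (w ^ (γ : ℂ) - 1)‖ ≤ C₀ * ε * (c₀ / (2 * (C₀ + 1))) := by
      rw [norm_mul]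
      exact mul_le_mul hη hcl (norm_nonneg _) (by positivity)
    have h3 : C₀ * ε * (c₀ / (2 * (C₀ + 1))) ≤ c₀ / 2 * ε := by
      rw [mul_div_assoc', div_le_iff₀ (by positivity)]
      nlinarith [mul_pos hc₀ hε]
    linarith
  rw [hexp]
  have hxγ : 0 < x ^ γ := Real.rpow_pos_of_pos hx γ
  have : c₀ / 2 * (ε * x ^ γ) = x ^ γ * (c₀ / 2 * ε) := by ring
  rw [this]
  exact mul_le_mul_of_nonneg_left (by linarith) hxγ.le

lemma norm_cpow_le_of_mem {x : ℝ} (hx : 0 < x) {z : ℂ} (h1 : x / 2 ≤ ‖z‖) (h2 : ‖z‖ ≤ 2 * x)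
    (s : ℝ) : ‖z ^ (s : ℂ)‖ ≤ 2 ^ |s| * x ^ s := by
  rw [Complex.norm_cpow_real]
  rcases le_total 0 s with hs | hs
  · rw [abs_of_nonneg hs, ← Real.mul_rpow zero_le_two hx.le]
    exact Real.rpow_le_rpow (norm_nonneg _) h2 hs
  · rw [abs_of_nonpos hs, Real.rpow_neg zero_le_two, ← Real.inv_rpow zero_le_two,
      ← Real.mul_rpow (by positivity) hx.le]
    exact Real.rpow_le_rpow_of_nonpos (by positivity) (by linarith) hs

/-- Bounds for the derivatives of `radialFun`, uniform in the parameter `η`. -/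
lemma exists_norm_iteratedDeriv_radialFun_le (a γ : ℝ) {c₀ C₀ : ℝ} (hc₀ : 0 < c₀) (hC₀ : 0 ≤ C₀)
    (m p : ℕ) : ∃ C : ℝ, 0 ≤ C ∧ ∀ ε : ℝ, 0 < ε → ∀ η : ℂ, ‖η‖ ≤ C₀ * ε → c₀ * ε ≤ η.re →
      ∀ x : ℝ, 0 < x →
        ‖iteratedDeriv p (radialFun a γ η m) x‖ ≤ C * ε ^ m * x ^ (m * γ - a - p) := by
  obtain ⟨δ, hδ, hδ1, H⟩ := exists_sector γ hc₀ hC₀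
  refine ⟨Nat.factorial p * (2 ^ |-a| * (C₀ * 2 ^ |γ|) ^ m) / δ ^ p, by positivity, ?_⟩
  intro ε hε η hη hre x hx
  refine (norm_iteratedDeriv_le_of_pos (differentiableOn_radialFun a γ η m) p hx hδ (by linarith)
    (K := (2 ^ |-a| * x ^ (-a)) * ((C₀ * ε) * (2 ^ |γ| * x ^ γ)) ^ m) fun z hz => ?_).trans
    (le_of_eq ?_)
  · obtain ⟨h1, h2, h3⟩ := H ε hε η hη hre x hx z hz
    have hxγ : 0 < x ^ γ := Real.rpow_pos_of_pos hx γ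
    rw [radialFun, norm_mul]
    refine mul_le_mul (norm_cpow_le_of_mem hx h1 h2 _) ((norm_expRemainder_le m
      (le_trans (by positivity) h3)).trans (pow_le_pow_left₀ (norm_nonneg _) ?_ _))
      (norm_nonneg _) (by positivity)
    rw [norm_mul]
    exact mul_le_mul hη (norm_cpow_le_of_mem hx h1 h2 _) (norm_nonneg _) (by positivity)
  · have e : x ^ (m * γ - a - p) = x ^ (-a) * (x ^ γ) ^ m / x ^ p := by
      rw [Real.rpow_sub hx, Real.rpow_natCast, ← Real.rpow_natCast (x ^ γ), ← Real.rpow_mul hx.le,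
        ← Real.rpow_add hx]
      congr 2
      ring
    rw [e]
    simp only [mul_pow]
    field_simp

lemma exists_norm_iteratedDeriv_radialFun_zero_le (a γ : ℝ) {c₀ C₀ : ℝ} (hc₀ : 0 < c₀)
    (hC₀ : 0 ≤ C₀) (N p : ℕ) : ∃ C : ℝ, ∀ ε : ℝ, 0 < ε → ∀ η : ℂ,
      ‖η‖ ≤ C₀ * ε → c₀ * ε ≤ η.re → ∀ x : ℝ, 0 < x →
        ‖iteratedDeriv p (radialFun a γ η 0) x‖ ≤ C / ε ^ N * x ^ (-(N * γ) - a - p) := by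
  obtain ⟨δ, hδ, hδ1, H⟩ := exists_sector γ hc₀ hC₀
  refine ⟨Nat.factorial p * (2 ^ |-a| * (Nat.factorial N / (c₀ / 2) ^ N)) / δ ^ p, ?_⟩
  intro ε hε η hη hre x hx
  have hxγ : 0 < x ^ γ := Real.rpow_pos_of_pos hx γ
  refine (norm_iteratedDeriv_le_of_pos (differentiableOn_radialFun a γ η 0) p hx hδ (by linarith)
    (K := (2 ^ |-a| * x ^ (-a)) * (Nat.factorial N / (c₀ / 2 * (ε * x ^ γ)) ^ N))
    fun z hz => ?_).trans (le_of_eq ?_)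
  · obtain ⟨h1, h2, h3⟩ := H ε hε η hη hre x hx z hz
    rw [radialFun, norm_mul]
    refine mul_le_mul (norm_cpow_le_of_mem hx h1 h2 _) ?_ (norm_nonneg _) (by positivity)
    have ht : 0 < c₀ / 2 * (ε * x ^ γ) := by positivity
    simp only [expRemainder, Finset.range_zero, Finset.sum_empty, sub_zero, Complex.norm_exp,
      Complex.neg_re]
    refine (Real.exp_le_exp.2 (neg_le_neg h3)).trans ?_
    rw [Real.exp_neg, ← inv_div (_ ^ N)]
    exact inv_anti₀ (by positivity) (Real.pow_div_factorial_le_exp _ ht.le N)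
  · have e : x ^ (-(N * γ) - a - p) = x ^ (-a) / (x ^ γ) ^ N / x ^ p := by
      rw [Real.rpow_sub hx, Real.rpow_natCast, ← Real.rpow_natCast (x ^ γ), ← Real.rpow_mul hx.le,
        ← Real.rpow_sub hx]
      congr 2
      ring
    rw [e]
    simp only [mul_pow]
    field_simp

lemma radialFun_bounds {a γ c : ℝ} (hac : a < c) (hγ : 0 < γ) {c₀ C₀ : ℝ} (hc₀ : 0 < c₀)
    (hC₀ : 0 ≤ C₀) {ε : ℝ} (hε : 0 < ε) {η : ℂ} (hη : ‖η‖ ≤ C₀ * ε) (hre : c₀ * ε ≤ η.re) (p : ℕ) :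
    ∃ C : ℝ, ∀ x : ℝ, 0 < x → ‖iteratedDeriv p (radialFun a γ η 0) x‖ ≤ C * x ^ (-a - p) ∧
      ‖iteratedDeriv p (radialFun a γ η 0) x‖ ≤ C * x ^ (-(c + 1) - p) := by
  obtain ⟨N, hN⟩ := exists_nat_gt ((c + 1 - a) / γ)
  have hN' : c + 1 - a < N * γ := by rwa [div_lt_iff₀ hγ] at hN
  obtain ⟨C₁, hC₁, h₁⟩ := exists_norm_iteratedDeriv_radialFun_le a γ hc₀ hC₀ 0 p
  obtain ⟨C₂, h₂⟩ := exists_norm_iteratedDeriv_radialFun_zero_le a γ hc₀ hC₀ N p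
  refine ⟨max C₁ (C₂ / ε ^ N), fun x hx => ?_⟩
  have b₁ := h₁ ε hε η hη hre x hx
  have b₂ := h₂ ε hε η hη hre x hx
  simp only [CharP.cast_eq_zero, zero_mul, zero_sub, pow_zero, mul_one] at b₁
  have hmax : 0 ≤ max C₁ (C₂ / ε ^ N) := hC₁.trans (le_max_left _ _)
  refine ⟨b₁.trans (mul_le_mul_of_nonneg_right (le_max_left _ _) (Real.rpow_nonneg hx.le _)), ?_⟩
  rcases le_total x 1 with hx1 | hx1
  · refine b₁.trans ((mul_le_mul_of_nonneg_right (le_max_left _ (C₂ / ε ^ N))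
      (Real.rpow_nonneg hx.le _)).trans (mul_le_mul_of_nonneg_left ?_ hmax))
    exact Real.rpow_le_rpow_of_exponent_ge hx hx1 (by linarith)
  · refine b₂.trans ((mul_le_mul_of_nonneg_right (le_max_right C₁ _)
      (Real.rpow_nonneg hx.le _)).trans (mul_le_mul_of_nonneg_left ?_ hmax))
    exact Real.rpow_le_rpow_of_exponent_le hx1 (by linarith)

lemma iteratedDeriv_radialFun_zero (a γ : ℝ) (η : ℂ) (m p : ℕ) {x : ℝ} (hx : 0 < x) :
    iteratedDeriv p (radialFun a γ η 0) x = iteratedDeriv p (radialFun a γ η m) x +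
      ∑ k ∈ Finset.range m, ((-η) ^ k / (Nat.factorial k : ℂ)) *
        (((-1) ^ p * (∏ i ∈ Finset.range p, (-(k * γ - a) + i)) * x ^ (k * γ - a - p) :
          ℝ) : ℂ) := by
  have hmem : {z : ℂ | 0 < z.re} ∈ 𝓝 (x : ℂ) :=
    isOpen_rightHalfPlane.mem_nhds (by simpa using hx)
  have he : radialFun a γ η 0 =ᶠ[𝓝 (x : ℂ)] fun z => radialFun a γ η m z +
      ∑ k ∈ Finset.range m, ((-η) ^ k / (Nat.factorial k : ℂ)) * z ^ ((k * γ - a : ℝ) : ℂ) := by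
    filter_upwards [hmem] with z hz
    have hz0 : z ≠ 0 := fun h => by simp [h] at hz
    simp only [radialFun, expRemainder, Finset.range_zero, Finset.sum_empty, sub_zero]
    rw [mul_sub, Finset.mul_sum, sub_add, ← Finset.sum_sub_distrib, Finset.sum_eq_zero, sub_zero]
    intro k _
    have : z ^ ((k * γ - a : ℝ) : ℂ) = z ^ ((-a : ℝ) : ℂ) * (z ^ (γ : ℂ)) ^ k := by
      rw [← Complex.cpow_nat_mul, ← Complex.cpow_add _ _ hz0]
      congr 1
      push_cast
      ring
    rw [this, neg_mul_eq_neg_mul, mul_pow]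
    ring
  have hcd : ∀ g : ℂ → ℂ, DifferentiableOn ℂ g {z : ℂ | 0 < z.re} → ContDiffAt ℂ p g x :=
    fun g hg => (analyticAt_of_pos hg hx).contDiffAt
  have hpow : ∀ k : ℕ, ContDiffAt ℂ p (fun z : ℂ => z ^ ((k * γ - a : ℝ) : ℂ)) x := fun k =>
    hcd _ (differentiableOn_cpow_rightHalfPlane _)
  rw [he.iteratedDeriv_eq, iteratedDeriv_fun_add (hcd _ (differentiableOn_radialFun a γ η m))
    (ContDiffAt.sum fun k _ => contDiffAt_const.mul (hpow k)),
    iteratedDeriv_fun_sum fun k _ => contDiffAt_const.mul (hpow k)]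
  congr 1
  refine Finset.sum_congr rfl fun k _ => ?_
  rw [iteratedDeriv_const_mul _ (hpow k), iteratedDeriv_cpow_of_pos _ _ hx]

/-- Small-parameter expansion of the radial integral. -/
theorem exists_radial_expansion {a γ c : ℝ} (hc : 1 ≤ c) (hac : a < c) (hγ : 0 < γ)
    {c₀ C₀ : ℝ} (hc₀ : 0 < c₀) (hC₀ : 0 ≤ C₀) (m : ℕ) :
    ∃ C : ℝ, ∀ ε : ℝ, 0 < ε → ∀ η : ℂ, ‖η‖ ≤ C₀ * ε → c₀ * ε ≤ η.re →
      ‖(∫ x in Set.Ioi (0 : ℝ), radialFun a γ η 0 x * ((x ^ (c - 1) * besselN c x : ℝ) : ℂ)) -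
        ∑ k ∈ Finset.range m, ((-η) ^ k / (Nat.factorial k : ℂ)) *
          ((4 ^ (c - a + k * γ) * Real.Gamma (c - a + k * γ) / Real.Gamma (a - k * γ) : ℝ) : ℂ)‖ ≤
      C * ε ^ m := by
  obtain ⟨M, hM⟩ := exists_nat_gt (2 * (m * γ + c - a))
  have hcM : 1 ≤ c + M := by
    have : (0 : ℝ) ≤ M := Nat.cast_nonneg M
    linarith
  obtain ⟨B, hB0, hB⟩ := abs_besselN_add_nat_le hc M
  obtain ⟨C, hC0, hC⟩ := exists_norm_iteratedDeriv_radialFun_le a γ hc₀ hC₀ m M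
  set G : ℝ := (Real.Gamma (c + M))⁻¹
  have hG : 0 ≤ G := inv_nonneg.2 (Real.Gamma_pos_of_pos (by linarith)).le
  set D : ℝ := max G B
  have hD : 0 ≤ D := hG.trans (le_max_left _ _)
  have hβ0 : ∀ x : ℝ, 0 < x → |besselN (c + M) x| ≤ D := fun x hx =>
    (abs_besselN_le hcM hx.le).trans (le_max_left _ _)
  have hβ1 : ∀ x : ℝ, 1 ≤ x → |besselN (c + M) x| ≤ D * x ^ (-((M : ℝ) / 2)) := fun x hx =>
    (hB x hx).trans (mul_le_mul_of_nonneg_right (le_max_right _ _)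
      (Real.rpow_nonneg (by linarith) _))
  have hγm : 0 ≤ m * γ := by positivity
  have hP : 0 < (M : ℝ) / 2 - m * γ - (c - a) := by linarith
  have hcontβ : ContinuousOn (fun x : ℝ => besselN (c + M) x) (Set.Ioi 0) :=
    (continuous_besselN hcM).continuousOn
  have hcontp : ∀ s : ℝ, ContinuousOn (fun x : ℝ => x ^ s) (Set.Ioi 0) := fun s =>
    continuousOn_id.rpow_const fun x hx => Or.inl (ne_of_gt hx)
  refine ⟨C * D * (1 / (m * γ + (c - a)) + 1 / ((M : ℝ) / 2 - m * γ - (c - a))), ?_⟩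
  intro ε hε η hη hre
  set R : ℝ → ℂ := fun x => ((-1) ^ M * iteratedDeriv M (radialFun a γ η m) x) *
    ((x ^ (c + M - 1) * besselN (c + M) x : ℝ) : ℂ)
  have hRcont : ContinuousOn R (Set.Ioi 0) :=
    (continuousOn_const.mul (continuousOn_iteratedDeriv_of_pos
      (differentiableOn_radialFun a γ η m) M)).mul
      (Complex.continuous_ofReal.comp_continuousOn ((hcontp _).mul hcontβ))
  have hRnorm : ∀ x : ℝ, 0 < x → ∀ b : ℝ, |besselN (c + M) x| ≤ D * x ^ b →
      ‖R x‖ ≤ C * ε ^ m * D * x ^ (m * γ + (c - a) - 1 + b) := fun x hx b hb => by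
    have h1 := hC ε hε η hη hre x hx
    have h2 : ‖((x ^ (c + M - 1) * besselN (c + M) x : ℝ) : ℂ)‖ ≤
        x ^ (c + M - 1) * (D * x ^ b) := by
      rw [Complex.norm_real, norm_mul, Real.norm_of_nonneg (Real.rpow_nonneg hx.le _)]
      exact mul_le_mul_of_nonneg_left hb (Real.rpow_nonneg hx.le _)
    simp only [R]
    rw [norm_mul, norm_mul, norm_pow, norm_neg, norm_one, one_pow, one_mul]
    refine (mul_le_mul h1 h2 (norm_nonneg _) ((norm_nonneg _).trans h1)).trans (le_of_eq ?_)
    have : x ^ (m * γ + (c - a) - 1 + b) = x ^ (m * γ - a - M) * x ^ (c + M - 1) * x ^ b := by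
      rw [← Real.rpow_add hx, ← Real.rpow_add hx]
      congr 1
      ring
    rw [this]
    ring
  obtain ⟨hRint, hRle⟩ := integrableOn_Ioi_of_power_bounds hRcont (C := C * ε ^ m * D)
    (q := m * γ + (c - a)) (p := (M : ℝ) / 2 - m * γ - (c - a)) (by linarith) hP
    (fun x hx _ => by simpa using hRnorm x hx 0 (by simpa using hβ0 x hx))
    (fun x hx => by
      have := hRnorm x (by linarith) _ (hβ1 x hx)
      rwa [show m * γ + (c - a) - 1 + -((M : ℝ) / 2) =
        -((M : ℝ) / 2 - m * γ - (c - a)) - 1 by ring] at this)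
  have hmell : ∀ k ∈ Finset.range m,
      IntegrableOn (fun x : ℝ => x ^ (c - a + k * γ - 1) * besselN (c + M) x) (Set.Ioi 0) ∧
      ∫ x in Set.Ioi (0 : ℝ), x ^ (c - a + k * γ - 1) * besselN (c + M) x =
        4 ^ (c - a + k * γ) * Real.Gamma (c - a + k * γ) / Real.Gamma (a - k * γ + M) :=
    fun k hk => by
      have hk0 : 0 ≤ k * γ := by positivity
      have hkm : k * γ ≤ m * γ := by
        refine mul_le_mul_of_nonneg_right ?_ hγ.le
        exact_mod_cast (Finset.mem_range.1 hk).le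
      have hn : ∀ x : ℝ, 0 < x → ∀ b : ℝ, |besselN (c + M) x| ≤ D * x ^ b →
          ‖x ^ (c - a + k * γ - 1) * besselN (c + M) x‖ ≤ D * x ^ (c - a + k * γ - 1 + b) :=
        fun x hx b hb => by
          rw [norm_mul, Real.norm_of_nonneg (Real.rpow_nonneg hx.le _), Real.rpow_add hx]
          refine (mul_le_mul_of_nonneg_left hb (Real.rpow_nonneg hx.le _)).trans (le_of_eq ?_)
          ring
      have hi := (integrableOn_Ioi_of_power_bounds ((hcontp (c - a + k * γ - 1)).mul hcontβ)
        (C := D) (q := c - a + k * γ) (p := (M : ℝ) / 2 - k * γ - (c - a)) (by linarith)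
        (by linarith)
        (fun x hx _ => by simpa using hn x hx 0 (by simpa using hβ0 x hx))
        (fun x hx => by
          have := hn x (by linarith) _ (hβ1 x hx)
          rwa [show c - a + k * γ - 1 + -((M : ℝ) / 2) =
            -((M : ℝ) / 2 - k * γ - (c - a)) - 1 by ring] at this)).1
      refine ⟨hi, ?_⟩
      rw [integral_rpow_mul_besselN hcM (by linarith) (by linarith) hi]
      congr 2
      ring
  have hsplit : ∀ x ∈ Set.Ioi (0 : ℝ), ((-1) ^ M * iteratedDeriv M (radialFun a γ η 0) x) *
      ((x ^ (c + M - 1) * besselN (c + M) x : ℝ) : ℂ) = R x +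
      ∑ k ∈ Finset.range m, (((-η) ^ k / (Nat.factorial k : ℂ)) *
        ((∏ i ∈ Finset.range M, (a - k * γ + i) : ℝ) : ℂ)) *
          ((x ^ (c - a + k * γ - 1) * besselN (c + M) x : ℝ) : ℂ) := fun x hx => by
    rw [iteratedDeriv_radialFun_zero a γ η m M hx, mul_add, add_mul, Finset.mul_sum,
      Finset.sum_mul]
    congr 1
    refine Finset.sum_congr rfl fun k _ => ?_
    have h1 : x ^ (c - a + k * γ - 1) = x ^ (k * γ - a - M) * x ^ (c + M - 1) := by
      rw [← Real.rpow_add hx]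
      congr 1
      ring
    have h2 : ((-1 : ℂ) ^ M) * (-1) ^ M = 1 := by rw [← mul_pow]; simp
    rw [h1, neg_sub]
    push_cast
    linear_combination (-η) ^ k / (Nat.factorial k : ℂ) *
      (∏ i ∈ Finset.range M, ((a : ℂ) - k * γ + i)) * ((x ^ (k * γ - a - M) : ℝ) : ℂ) *
      ((x ^ (c + M - 1) : ℝ) : ℂ) * ((besselN (c + M) x : ℝ) : ℂ) * h2
  have hterm : ∀ k ∈ Finset.range m, Integrable (fun x : ℝ =>
      (((-η) ^ k / (Nat.factorial k : ℂ)) * ((∏ i ∈ Finset.range M, (a - k * γ + i) : ℝ) : ℂ)) *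
          ((x ^ (c - a + k * γ - 1) * besselN (c + M) x : ℝ) : ℂ))
      (volume.restrict (Set.Ioi 0)) := fun k hk => ((hmell k hk).1.ofReal).const_mul _
  rw [integral_iteratedDeriv_mul_besselN hc hac (differentiableOn_radialFun a γ η 0)
    (radialFun_bounds hac hγ hc₀ hC₀ hε hη hre) M, setIntegral_congr_fun measurableSet_Ioi hsplit,
    integral_add hRint (integrable_finsetSum _ hterm), integral_finsetSum _ hterm]
  have hsum : ∀ k ∈ Finset.range m, ∫ x in Set.Ioi (0 : ℝ),
      (((-η) ^ k / (Nat.factorial k : ℂ)) * ((∏ i ∈ Finset.range M, (a - k * γ + i) : ℝ) : ℂ)) *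
          ((x ^ (c - a + k * γ - 1) * besselN (c + M) x : ℝ) : ℂ) =
      ((-η) ^ k / (Nat.factorial k : ℂ)) *
        ((4 ^ (c - a + k * γ) * Real.Gamma (c - a + k * γ) / Real.Gamma (a - k * γ) : ℝ) : ℂ) :=
    fun k hk => by
      rw [integral_const_mul, integral_complex_ofReal, (hmell k hk).2, mul_assoc,
        ← Complex.ofReal_mul,
        div_eq_mul_one_div _ (Real.Gamma (a - k * γ)), ← one_div_gamma_eq (a - k * γ) M]
      congr 2
      ring
  rw [Finset.sum_congr rfl hsum, add_sub_cancel_right]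
  refine hRle.trans (le_of_eq ?_)
  ring

/-! ### Polar coordinates -/

/-- The measure `ρ^(d-1) dρ` on the half-line, as a measure on `ℝ`. -/
def radialMeasure (d : ℕ) : Measure ℝ :=
  (volume.restrict (Set.Ioi 0)).withDensity fun ρ => ENNReal.ofReal (ρ ^ (d - 1))

instance (d : ℕ) : SFinite (radialMeasure d) := by
  unfold radialMeasure
  infer_instance

instance (d : ℕ) : IsFiniteMeasure (ωd d) := by
  unfold ωd
  infer_instance

lemma map_val_volumeIoiPow (d : ℕ) :
    (Measure.volumeIoiPow (d - 1)).map (Subtype.val : Set.Ioi (0 : ℝ) → ℝ) = radialMeasure d := by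
  have he : MeasurableEmbedding (Subtype.val : Set.Ioi (0 : ℝ) → ℝ) :=
    MeasurableEmbedding.subtype_coe measurableSet_Ioi
  ext s hs
  rw [Measure.map_apply measurable_subtype_coe hs, Measure.volumeIoiPow,
    withDensity_apply _ (measurable_subtype_coe hs), radialMeasure, withDensity_apply _ hs,
    ← lintegral_indicator hs, ← lintegral_indicator (measurable_subtype_coe hs)]
  rw [← lintegral_subtype_comap measurableSet_Ioi]
  rfl

lemma map_polar_eq_volume {d : ℕ} (hd : 0 < d) :
    ((ωd d).prod (radialMeasure d)).map (fun p : Sph d × ℝ => p.2 • (p.1 : Ed d)) =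
      (volume : Measure (Ed d)) := by
  have : Nonempty (Fin d) := ⟨⟨0, hd⟩⟩
  have hmp := ((volume : Measure (Ed d)).measurePreserving_homeomorphUnitSphereProd).symm
    (homeomorphUnitSphereProd (Ed d)).toMeasurableEquiv
  have hval : (Measure.comap (Subtype.val : ({0}ᶜ : Set (Ed d)) → Ed d) volume).map Subtype.val =
      (volume : Measure (Ed d)) := by
    rw [map_comap_subtype_coe (measurableSet_singleton _).compl]
    exact Measure.restrict_eq_self_of_ae_mem (by simp [ae_iff])
  have hfin : Module.finrank ℝ (Ed d) = d := finrank_euclideanSpace_fin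
  rw [hfin] at hmp
  have hprod : (ωd d).prod (radialMeasure d) = ((ωd d).prod (Measure.volumeIoiPow (d - 1))).map
      (Prod.map id Subtype.val) := by
    rw [← map_val_volumeIoiPow, ← Measure.map_prod_map _ _ measurable_id measurable_subtype_coe,
      Measure.map_id]
  rw [hprod, Measure.map_map (by fun_prop) (by fun_prop), ← hval, ← hmp.map_eq,
    Measure.map_map measurable_subtype_coe (MeasurableEquiv.measurable _)]
  rfl

lemma ae_prod_radial_pos (d : ℕ) :
    ∀ᵐ p ∂((ωd d).prod (volume.restrict (Set.Ioi (0 : ℝ)))), 0 < p.2 := by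
  have h : ∀ᵐ x ∂(volume.restrict (Set.Ioi (0 : ℝ))), 0 < x :=
    ae_restrict_mem measurableSet_Ioi
  exact Measure.quasiMeasurePreserving_snd.ae h

lemma prod_radialMeasure (d : ℕ) :
    (ωd d).prod (radialMeasure d) = ((ωd d).prod (volume.restrict (Set.Ioi 0))).withDensity
      (fun p => ENNReal.ofReal (p.2 ^ (d - 1))) := by
  have hm : Measurable fun ρ : ℝ => ENNReal.ofReal (ρ ^ (d - 1)) := by fun_prop
  rw [radialMeasure, prod_withDensity_right hm]

lemma integrable_polar_iff {E : Type*} [NormedAddCommGroup E] [NormedSpace ℝ E] {d : ℕ}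
    (hd : 0 < d) {f : Ed d → E} (hf : AEStronglyMeasurable f) :
    Integrable f ↔ Integrable (fun p : Sph d × ℝ => p.2 ^ (d - 1) • f (p.2 • (p.1 : Ed d)))
      ((ωd d).prod (volume.restrict (Set.Ioi 0))) := by
  have hm : Measurable fun p : Sph d × ℝ => ENNReal.ofReal (p.2 ^ (d - 1)) := by fun_prop
  have hΨ : Measurable fun p : Sph d × ℝ => p.2 • (p.1 : Ed d) := by fun_prop
  rw [← map_polar_eq_volume hd] at hf ⊢
  rw [integrable_map_measure hf hΨ.aemeasurable, prod_radialMeasure,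
    integrable_withDensity_iff_integrable_smul' hm (by simp)]
  refine integrable_congr ?_
  filter_upwards [ae_prod_radial_pos d] with p hp
  rw [ENNReal.toReal_ofReal (by positivity)]
  rfl

lemma integral_polar {E : Type*} [NormedAddCommGroup E] [NormedSpace ℝ E] {d : ℕ}
    (hd : 0 < d) {f : Ed d → E} (hf : AEStronglyMeasurable f) :
    ∫ x, f x = ∫ p : Sph d × ℝ, p.2 ^ (d - 1) • f (p.2 • (p.1 : Ed d))
      ∂((ωd d).prod (volume.restrict (Set.Ioi 0))) := by
  have hm : Measurable fun p : Sph d × ℝ => ENNReal.ofReal (p.2 ^ (d - 1)) := by fun_prop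
  have hΨ : Measurable fun p : Sph d × ℝ => p.2 • (p.1 : Ed d) := by fun_prop
  rw [← map_polar_eq_volume hd] at hf ⊢
  rw [integral_map hΨ.aemeasurable hf, prod_radialMeasure,
    integral_withDensity_eq_integral_toReal_smul hm (by simp)]
  refine integral_congr_ae ?_
  filter_upwards [ae_prod_radial_pos d] with p hp
  rw [ENNReal.toReal_ofReal (by positivity)]

/-! ### Moments and Fourier transform of the surface measure -/

lemma iteratedDeriv_const_mul_exp_sq (A b : ℝ) (n : ℕ) :
    iteratedDeriv (n + 2) (fun t : ℝ => A * Real.exp (b * t ^ 2)) = fun t =>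
      2 * b * (t * iteratedDeriv (n + 1) (fun t : ℝ => A * Real.exp (b * t ^ 2)) t +
        (n + 1) * iteratedDeriv n (fun t : ℝ => A * Real.exp (b * t ^ 2)) t) := by
  set h : ℝ → ℝ := fun t => A * Real.exp (b * t ^ 2) with hh
  have hc : ContDiff ℝ ⊤ h := by
    rw [hh]
    fun_prop
  have hdiff : ∀ k, Differentiable ℝ (iteratedDeriv k h) := fun k =>
    hc.differentiable_iteratedDeriv k (by exact_mod_cast WithTop.coe_lt_top _)
  have hd : ∀ k t, HasDerivAt (iteratedDeriv k h) (iteratedDeriv (k + 1) h t) t := fun k t => by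
    rw [iteratedDeriv_succ]
    exact (hdiff k t).hasDerivAt
  have h1 : iteratedDeriv 1 h = fun t => 2 * b * (t * h t) := by
    rw [iteratedDeriv_one]
    funext t
    have := (((hasDerivAt_pow 2 t).const_mul b).exp).const_mul A
    rw [this.deriv]
    simp only [hh]
    push_cast
    ring
  induction n with
  | zero =>
    rw [iteratedDeriv_succ, zero_add, h1]
    funext t
    have h0 := hd 0 t
    rw [iteratedDeriv_zero, zero_add, h1] at h0
    have := (((hasDerivAt_id t).mul h0).const_mul (2 * b)).deriv
    refine Eq.trans this ?_
    simp only [iteratedDeriv_zero, id]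
    push_cast
    ring
  | succ n ih =>
    rw [iteratedDeriv_succ, ih]
    funext t
    have := ((((hasDerivAt_id t).mul (hd (n + 1) t)).add
      ((hd n t).const_mul ((n : ℝ) + 1))).const_mul (2 * b)).deriv
    refine Eq.trans this ?_
    have e : iteratedDeriv (n + 1 + 1) h t = _ := congrFun ih t
    simp only [id, e]
    push_cast
    ring

lemma integral_exp_neg_sq_mul_exp_inner {d : ℕ} (z : Ed d) (t : ℝ) :
    ∫ x : Ed d, Real.exp (-‖x‖ ^ 2) * Real.exp (t * ⟪x, z⟫) =
      π ^ ((d : ℝ) / 2) * Real.exp (‖z‖ ^ 2 / 4 * t ^ 2) := by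
  have h := GaussianFourier.integral_cexp_neg_mul_sq_norm_add (b := 1) (V := Ed d)
    (by simp) (t : ℂ) z
  rw [finrank_euclideanSpace_fin] at h
  have h2 : ∀ x : Ed d, Complex.exp (-1 * (‖x‖ : ℂ) ^ 2 + t * (⟪z, x⟫ : ℝ)) =
      ((Real.exp (-‖x‖ ^ 2) * Real.exp (t * ⟪x, z⟫) : ℝ) : ℂ) := fun x => by
    rw [← Real.exp_add, real_inner_comm]
    push_cast
    ring_nf
  simp_rw [h2] at h
  rw [integral_complex_ofReal] at h
  apply Complex.ofReal_injective
  rw [h]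
  push_cast
  rw [Complex.ofReal_cpow pi_pos.le]
  push_cast
  congr 2
  · simp
  · ring

lemma integral_inner_pow_mul_exp_recursion {d : ℕ} (z : Ed d) :
    (∫ x : Ed d, ⟪x, z⟫ ^ 0 * Real.exp (-‖x‖ ^ 2)) = π ^ ((d : ℝ) / 2) ∧
    (∫ x : Ed d, ⟪x, z⟫ ^ 1 * Real.exp (-‖x‖ ^ 2)) = 0 ∧
    ∀ n : ℕ, (∫ x : Ed d, ⟪x, z⟫ ^ (n + 2) * Real.exp (-‖x‖ ^ 2)) =
      ‖z‖ ^ 2 / 2 * (n + 1) * ∫ x : Ed d, ⟪x, z⟫ ^ n * Real.exp (-‖x‖ ^ 2) := by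
  set ν : Measure (Ed d) := volume.withDensity fun x => ENNReal.ofReal (Real.exp (-‖x‖ ^ 2))
    with hν
  have hm : Measurable fun x : Ed d => ENNReal.ofReal (Real.exp (-‖x‖ ^ 2)) := by fun_prop
  have hmgf : ProbabilityTheory.mgf (fun x : Ed d => ⟪x, z⟫) ν =
      fun t => π ^ ((d : ℝ) / 2) * Real.exp (‖z‖ ^ 2 / 4 * t ^ 2) := by
    funext t
    rw [ProbabilityTheory.mgf, hν, integral_withDensity_eq_integral_toReal_smul hm (by simp),
      ← integral_exp_neg_sq_mul_exp_inner]
    refine integral_congr_ae (Eventually.of_forall fun x => ?_)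
    simp only [smul_eq_mul]
    rw [ENNReal.toReal_ofReal (Real.exp_pos _).le]
  have hset : ProbabilityTheory.integrableExpSet (fun x : Ed d => ⟪x, z⟫) ν = Set.univ := by
    refine Set.eq_univ_of_forall fun t => ?_
    have hne : ProbabilityTheory.mgf (fun x : Ed d => ⟪x, z⟫) ν t ≠ 0 := by
      rw [hmgf]
      positivity
    exact not_imp_comm.mp integral_undef hne
  have hI : ∀ n : ℕ, (∫ x : Ed d, ⟪x, z⟫ ^ n * Real.exp (-‖x‖ ^ 2)) =
      iteratedDeriv n (fun t : ℝ => π ^ ((d : ℝ) / 2) * Real.exp (‖z‖ ^ 2 / 4 * t ^ 2)) 0 := by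
    intro n
    rw [← hmgf, ProbabilityTheory.iteratedDeriv_mgf_zero (by simp [hset]), hν,
      integral_withDensity_eq_integral_toReal_smul hm (by simp)]
    refine integral_congr_ae (Eventually.of_forall fun x => ?_)
    simp only [smul_eq_mul, Pi.pow_apply]
    rw [ENNReal.toReal_ofReal (Real.exp_pos _).le, mul_comm]
  refine ⟨?_, ?_, fun n => ?_⟩
  · rw [hI]; simp
  · rw [hI, iteratedDeriv_one]
    have := ((((hasDerivAt_pow 2 (0 : ℝ)).const_mul (‖z‖ ^ 2 / 4)).exp).const_mul
      (π ^ ((d : ℝ) / 2))).deriv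
    refine Eq.trans this ?_
    simp
  · rw [hI, hI, iteratedDeriv_const_mul_exp_sq]
    ring

lemma integral_sphere_inner_pow_mul_gamma {d : ℕ} (hd : 0 < d) (z : Ed d) (n : ℕ) :
    (∫ v : Sph d, ⟪(v : Ed d), z⟫ ^ n ∂(ωd d)) * (Real.Gamma (((n : ℝ) + d) / 2) / 2) =
      ∫ x : Ed d, ⟪x, z⟫ ^ n * Real.exp (-‖x‖ ^ 2) := by
  rw [integral_polar hd (by fun_prop)]
  have h1 : ∀ p : Sph d × ℝ, p.2 ^ (d - 1) • (⟪p.2 • (p.1 : Ed d), z⟫ ^ n *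
      Real.exp (-‖p.2 • (p.1 : Ed d)‖ ^ 2)) =
      ⟪(p.1 : Ed d), z⟫ ^ n * (p.2 ^ (d - 1 + n) * Real.exp (-p.2 ^ 2)) := by
    intro p
    rw [real_inner_smul_left, norm_smul, norm_eq_of_mem_sphere, smul_eq_mul, mul_one,
      Real.norm_eq_abs, sq_abs]
    ring
  simp_rw [h1]
  rw [integral_prod_mul (fun v : Sph d => ⟪(v : Ed d), z⟫ ^ n)
    (fun ρ : ℝ => ρ ^ (d - 1 + n) * Real.exp (-ρ ^ 2))]
  congr 1
  have h2 := integral_rpow_mul_exp_neg_rpow (p := 2) (q := ((d - 1 + n : ℕ) : ℝ)) (by norm_num)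
    (by have : (0 : ℝ) ≤ ((d - 1 + n : ℕ) : ℝ) := Nat.cast_nonneg _
        linarith)
  simp only [Real.rpow_natCast, Real.rpow_ofNat] at h2
  rw [h2]
  have : (((d - 1 + n : ℕ) : ℝ) + 1) = (n : ℝ) + d := by
    push_cast [Nat.cast_sub hd]
    ring
  rw [this]
  ring

lemma integral_sphere_inner_pow_odd {d : ℕ} (hd : 0 < d) (z : Ed d) (l : ℕ) :
    ∫ v : Sph d, ⟪(v : Ed d), z⟫ ^ (2 * l + 1) ∂(ωd d) = 0 := by
  have h := integral_sphere_inner_pow_mul_gamma hd z (2 * l + 1)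
  have h0 : (∫ x : Ed d, ⟪x, z⟫ ^ (2 * l + 1) * Real.exp (-‖x‖ ^ 2)) = 0 := by
    induction l with
    | zero => exact (integral_inner_pow_mul_exp_recursion z).2.1
    | succ l ih =>
      rw [show 2 * (l + 1) + 1 = 2 * l + 1 + 2 by ring,
        (integral_inner_pow_mul_exp_recursion z).2.2,
        ih (integral_sphere_inner_pow_mul_gamma hd z _), mul_zero]
  rw [h0] at h
  have hΓ : Real.Gamma ((((2 * l + 1 : ℕ) : ℝ) + d) / 2) / 2 ≠ 0 := by
    have := Real.Gamma_pos_of_pos (s := (((2 * l + 1 : ℕ) : ℝ) + d) / 2) (by positivity)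
    positivity
  exact (mul_eq_zero.mp h).resolve_right hΓ

lemma integral_sphere_inner_pow_even {d : ℕ} (hd : 0 < d) (z : Ed d) (l : ℕ) :
    ∫ v : Sph d, ⟪(v : Ed d), z⟫ ^ (2 * l) ∂(ωd d) =
      2 * π ^ ((d : ℝ) / 2) * (2 * l).factorial * (‖z‖ ^ 2 / 4) ^ l /
        (l.factorial * Real.Gamma ((d : ℝ) / 2 + l)) := by
  have h := integral_sphere_inner_pow_mul_gamma hd z (2 * l)
  have h0 : (∫ x : Ed d, ⟪x, z⟫ ^ (2 * l) * Real.exp (-‖x‖ ^ 2)) =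
      π ^ ((d : ℝ) / 2) * (2 * l).factorial * (‖z‖ ^ 2 / 4) ^ l / l.factorial := by
    clear h
    induction l with
    | zero => simpa using (integral_inner_pow_mul_exp_recursion z).1
    | succ l ih =>
      rw [show 2 * (l + 1) = 2 * l + 2 by ring, (integral_inner_pow_mul_exp_recursion z).2.2, ih,
        Nat.factorial_succ, Nat.factorial_succ, Nat.factorial_succ]
      push_cast
      field_simp
      ring
  rw [h0] at h
  have hΓ : 0 < Real.Gamma ((d : ℝ) / 2 + l) := Real.Gamma_pos_of_pos (by positivity)
  have he : (((2 * l : ℕ) : ℝ) + d) / 2 = (d : ℝ) / 2 + l := by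
    push_cast
    ring
  rw [he] at h
  rw [eq_div_iff (by positivity)]
  rw [eq_div_iff (by positivity)] at h
  linear_combination 2 * h

lemma integrable_sphere_of_continuous {E : Type*} [NormedAddCommGroup E] {d : ℕ}
    {f : Sph d → E} (hf : Continuous f) : Integrable f (ωd d) :=
  hf.integrable_of_hasCompactSupport (HasCompactSupport.of_compactSpace f)

/-- The Fourier transform of the surface measure is a normalized Bessel function. -/
lemma integral_sphere_exp_inner {d : ℕ} (hd : 2 ≤ d) (z : Ed d) :
    ∫ v : Sph d, Complex.exp (-(Complex.I * (⟪(v : Ed d), z⟫ : ℝ))) ∂(ωd d) =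
      ((2 * π ^ ((d : ℝ) / 2) * besselN ((d : ℝ) / 2) (‖z‖ ^ 2) : ℝ) : ℂ) := by
  have hd0 : 0 < d := by omega
  have hc : (1 : ℝ) ≤ (d : ℝ) / 2 := by
    have : (2 : ℝ) ≤ d := by exact_mod_cast hd
    linarith
  have hbound : ∀ (n : ℕ) (v : Sph d),
      ‖(-(Complex.I * (⟪(v : Ed d), z⟫ : ℝ))) ^ n / (n.factorial : ℂ)‖ ≤
        ‖z‖ ^ n / n.factorial := fun n v => by
    rw [norm_div, norm_pow, norm_neg, norm_mul, Complex.norm_I, one_mul, Complex.norm_real,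
      Complex.norm_natCast]
    gcongr
    have := norm_inner_le_norm (𝕜 := ℝ) (v : Ed d) z
    rwa [norm_eq_of_mem_sphere, one_mul] at this
  have hsum : HasSum (fun n : ℕ => ∫ v : Sph d,
      (-(Complex.I * (⟪(v : Ed d), z⟫ : ℝ))) ^ n / (n.factorial : ℂ) ∂(ωd d))
      (∫ v : Sph d, Complex.exp (-(Complex.I * (⟪(v : Ed d), z⟫ : ℝ))) ∂(ωd d)) := by
    refine hasSum_integral_of_dominated_convergence (fun n _ => ‖z‖ ^ n / n.factorial) ?_ ?_ ?_ ?_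
      ?_
    · intro n
      exact (by fun_prop : Continuous _).aestronglyMeasurable
    · exact fun n => Eventually.of_forall (hbound n)
    · exact Eventually.of_forall fun _ => Real.summable_pow_div_factorial _
    · exact integrable_const _
    · refine Eventually.of_forall fun v => ?_
      rw [Complex.exp_eq_exp_ℂ]
      exact NormedSpace.expSeries_div_hasSum_exp _
  have hterm : ∀ n : ℕ, (∫ v : Sph d,
      (-(Complex.I * (⟪(v : Ed d), z⟫ : ℝ))) ^ n / (n.factorial : ℂ) ∂(ωd d)) =
      (-Complex.I) ^ n / (n.factorial : ℂ) *
        ((∫ v : Sph d, ⟪(v : Ed d), z⟫ ^ n ∂(ωd d) : ℝ) : ℂ) := fun n => by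
    rw [← integral_complex_ofReal, ← integral_const_mul]
    refine integral_congr_ae (Eventually.of_forall fun v => ?_)
    push_cast
    rw [neg_mul_eq_neg_mul, mul_pow]
    ring
  simp_rw [hterm] at hsum
  have hinj : Function.Injective fun l : ℕ => 2 * l := fun a b h => by
    simpa using h
  rw [← hinj.hasSum_iff] at hsum
  · refine hsum.unique ?_
    have := (((hasSum_besselN hc (‖z‖ ^ 2)).mul_left (2 * π ^ ((d : ℝ) / 2))))
    rw [← Complex.hasSum_ofReal] at this
    convert this using 2 with l
    simp only [Function.comp]
    rw [integral_sphere_inner_pow_even hd0, pow_mul, neg_sq, Complex.I_sq]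
    push_cast
    have h1 : ((2 * l).factorial : ℂ) ≠ 0 := by exact_mod_cast Nat.factorial_ne_zero _
    have h2 : (-(‖z‖ : ℂ) ^ 2 / 4) ^ l = (-1) ^ l * ((‖z‖ : ℂ) ^ 2 / 4) ^ l := by
      rw [← mul_pow]
      ring
    rw [h2]
    field_simp
  · intro n hn
    have hodd : Odd n := by
      rw [← Nat.not_even_iff_odd]
      rintro ⟨k, hk⟩
      exact hn ⟨k, by simp only; omega⟩
    obtain ⟨l, rfl⟩ := hodd
    rw [integral_sphere_inner_pow_odd hd0]
    simp

/-! ### Zonal harmonics and the Funk–Hecke formula for plane waves -/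

/-- The homogeneous zonal harmonic of degree `j` in dimension `d`, as a function of
`τ = ⟪u, z⟫` and `x = ‖z‖ ^ 2`. -/
def zonal (d : ℕ) : ℕ → ℝ → ℝ → ℝ
  | 0, _, _ => 1
  | 1, τ, _ => τ
  | j + 2, τ, x =>
    ((2 * (j : ℝ) + d) * τ * zonal d (j + 1) τ x - (j + 1) * x * zonal d j τ x) / (j + d - 1)

lemma zonal_rec {d : ℕ} (hd : 2 ≤ d) (j : ℕ) (τ x : ℝ) :
    ((j : ℝ) + d - 1) * zonal d (j + 2) τ x =
      (2 * (j : ℝ) + d) * τ * zonal d (j + 1) τ x - (j + 1) * x * zonal d j τ x := by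
  have h2 : (2 : ℝ) ≤ d := by exact_mod_cast hd
  have hj : (0 : ℝ) ≤ j := Nat.cast_nonneg j
  have : ((j : ℝ) + d - 1) ≠ 0 := by linarith
  rw [zonal, mul_div_cancel₀ _ this]

lemma continuous_zonal (d j : ℕ) : Continuous fun p : ℝ × ℝ => zonal d j p.1 p.2 := by
  induction j using Nat.twoStepInduction with
  | zero => simpa only [zonal] using continuous_const
  | one => simpa only [zonal] using continuous_fst
  | more j h0 h1 =>
    simp only [zonal]
    fun_prop

lemma zonal_homogeneous (d j : ℕ) (ρ τ x : ℝ) :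
    zonal d j (ρ * τ) (ρ ^ 2 * x) = ρ ^ j * zonal d j τ x := by
  induction j using Nat.twoStepInduction with
  | zero => simp [zonal]
  | one => simp [zonal]
  | more j h0 h1 =>
    rw [zonal, zonal, h0, h1]
    ring

lemma zonal_one_one {d : ℕ} (hd : 2 ≤ d) (j : ℕ) : zonal d j 1 1 = 1 := by
  induction j using Nat.twoStepInduction with
  | zero => simp [zonal]
  | one => simp [zonal]
  | more j h0 h1 =>
    have h2 : (2 : ℝ) ≤ d := by exact_mod_cast hd
    have hj : (0 : ℝ) ≤ j := Nat.cast_nonneg j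
    have : ((j : ℝ) + d - 1) ≠ 0 := by linarith
    have := zonal_rec hd j 1 1
    rw [h0, h1] at this
    apply mul_left_cancel₀ ‹((j : ℝ) + d - 1) ≠ 0›
    rw [this]
    ring

lemma hasDerivAt_zonal {d : ℕ} (hd : 2 ≤ d) (j : ℕ) (τ x t : ℝ) :
    HasDerivAt (fun s => zonal d j (τ + s) (x + 2 * s * τ + s ^ 2))
      (j * zonal d (j - 1) (τ + t) (x + 2 * t * τ + t ^ 2)) t := by
  have h2 : (2 : ℝ) ≤ d := by exact_mod_cast hd
  have hT : HasDerivAt (fun s : ℝ => τ + s) 1 t := by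
    simpa using (hasDerivAt_id t).const_add τ
  have hX : HasDerivAt (fun s : ℝ => x + 2 * s * τ + s ^ 2) (2 * (τ + t)) t := by
    have := ((((hasDerivAt_id t).const_mul 2).mul_const τ).const_add x).add (hasDerivAt_pow 2 t)
    refine this.congr_deriv ?_
    push_cast
    ring
  induction j using Nat.twoStepInduction with
  | zero => simpa [zonal] using hasDerivAt_const t (1 : ℝ)
  | one => simpa [zonal] using hT
  | more j h0 h1 =>
    have hj : (0 : ℝ) ≤ j := Nat.cast_nonneg j
    have hne : ((j : ℝ) + d - 1) ≠ 0 := by linarith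
    simp only [zonal]
    have := ((((hT.const_mul (2 * (j : ℝ) + d)).mul h1).sub
      ((hX.const_mul ((j : ℝ) + 1)).mul h0)).div_const ((j : ℝ) + d - 1))
    refine this.congr_deriv ?_
    rw [div_eq_iff hne]
    simp only [Nat.add_sub_cancel, show j + 2 - 1 = j + 1 by omega]
    rcases j with _ | j
    · simp only [zonal]
      push_cast
      ring
    · have hr := zonal_rec hd j (τ + t) (x + 2 * t * τ + t ^ 2)
      simp only [Nat.add_sub_cancel]
      push_cast
      linear_combination (-(j : ℝ) - 2) * hr

lemma hasDerivAt_integral_sphere_exp {d : ℕ} {q : Sph d → ℝ} (hq : Continuous q) (u z : Ed d) :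
    HasDerivAt (fun t : ℝ => ∫ v : Sph d,
        (q v : ℂ) * Complex.exp (-(Complex.I * (⟪(v : Ed d), z + t • u⟫ : ℝ))) ∂(ωd d))
      (∫ v : Sph d, -Complex.I * (((q v * ⟪(v : Ed d), u⟫ : ℝ) : ℂ) *
        Complex.exp (-(Complex.I * (⟪(v : Ed d), z⟫ : ℝ)))) ∂(ωd d)) 0 := by
  have key := hasDerivAt_integral_of_dominated_loc_of_deriv_le (μ := ωd d) (x₀ := (0 : ℝ))
    (s := Set.univ) (𝕜 := ℝ)
    (F := fun t v => (q v : ℂ) * Complex.exp (-(Complex.I * (⟪(v : Ed d), z + t • u⟫ : ℝ))))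
    (F' := fun t v => -Complex.I * (((q v * ⟪(v : Ed d), u⟫ : ℝ) : ℂ) *
        Complex.exp (-(Complex.I * (⟪(v : Ed d), z + t • u⟫ : ℝ)))))
    (bound := fun v => |q v * ⟪(v : Ed d), u⟫|) Filter.univ_mem
    (Eventually.of_forall fun t => (by fun_prop : Continuous _).aestronglyMeasurable)
    (integrable_sphere_of_continuous (by fun_prop))
    ((by fun_prop : Continuous _).aestronglyMeasurable)
    (Eventually.of_forall fun v t _ => ?_)
    (integrable_sphere_of_continuous (by fun_prop))
    (Eventually.of_forall fun v t _ => ?_)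
  · simpa using key.2
  · rw [norm_mul, norm_mul, norm_neg, Complex.norm_I, one_mul, Complex.norm_real, Complex.norm_exp,
      Real.norm_eq_abs]
    simp
  · have h1 : HasDerivAt (fun s : ℝ => ⟪(v : Ed d), z + s • u⟫) ⟪(v : Ed d), u⟫ t := by
      simp_rw [inner_add_right, real_inner_smul_right]
      simpa using ((hasDerivAt_id t).mul_const ⟪(v : Ed d), u⟫).const_add ⟪(v : Ed d), z⟫
    have h2 := (((h1.ofReal_comp).const_mul Complex.I).fun_neg.cexp).const_mul (q v : ℂ)
    refine h2.congr_deriv ?_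
    push_cast
    ring

/-- The constants in the Funk–Hecke formula for plane waves. -/
def funkHeckeConst (d j : ℕ) : ℂ :=
  (-Complex.I) ^ j * ((2 * π ^ ((d : ℝ) / 2) / 2 ^ j : ℝ) : ℂ)

lemma funkHeckeConst_succ (d j : ℕ) :
    funkHeckeConst d (j + 1) = -(Complex.I / 2) * funkHeckeConst d j := by
  unfold funkHeckeConst
  push_cast
  field_simp
  ring

lemma integral_sphere_zonal_exp {d : ℕ} (hd : 2 ≤ d) (u : Sph d) (j : ℕ) (z : Ed d) :
    ∫ v : Sph d, (zonal d j ⟪(v : Ed d), (u : Ed d)⟫ 1 : ℂ) *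
        Complex.exp (-(Complex.I * (⟪(v : Ed d), z⟫ : ℝ))) ∂(ωd d) =
      funkHeckeConst d j * ((zonal d j ⟪(u : Ed d), z⟫ (‖z‖ ^ 2) *
        besselN (j + (d : ℝ) / 2) (‖z‖ ^ 2) : ℝ) : ℂ) := by
  have h2 : (2 : ℝ) ≤ d := by exact_mod_cast hd
  have hu : ‖(u : Ed d)‖ = 1 := norm_eq_of_mem_sphere u
  have hcont : ∀ j, Continuous fun v : Sph d => zonal d j ⟪(v : Ed d), (u : Ed d)⟫ 1 := fun j =>
    (continuous_zonal d j).comp (by fun_prop : Continuous fun v : Sph d =>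
      ((⟪(v : Ed d), (u : Ed d)⟫, (1 : ℝ)) : ℝ × ℝ))
  have step : ∀ j, (∀ z : Ed d, ∫ v : Sph d, (zonal d j ⟪(v : Ed d), (u : Ed d)⟫ 1 : ℂ) *
        Complex.exp (-(Complex.I * (⟪(v : Ed d), z⟫ : ℝ))) ∂(ωd d) =
      funkHeckeConst d j * ((zonal d j ⟪(u : Ed d), z⟫ (‖z‖ ^ 2) *
        besselN (j + (d : ℝ) / 2) (‖z‖ ^ 2) : ℝ) : ℂ)) → ∀ z : Ed d,
      ∫ v : Sph d, ((zonal d j ⟪(v : Ed d), (u : Ed d)⟫ 1 * ⟪(v : Ed d), (u : Ed d)⟫ : ℝ) : ℂ) *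
        Complex.exp (-(Complex.I * (⟪(v : Ed d), z⟫ : ℝ))) ∂(ωd d) =
      Complex.I * funkHeckeConst d j *
        ((j * zonal d (j - 1) ⟪(u : Ed d), z⟫ (‖z‖ ^ 2) * besselN (j + (d : ℝ) / 2) (‖z‖ ^ 2) -
          zonal d j ⟪(u : Ed d), z⟫ (‖z‖ ^ 2) * (⟪(u : Ed d), z⟫ / 2 *
            besselN (j + 1 + (d : ℝ) / 2) (‖z‖ ^ 2)) : ℝ) : ℂ) := by
    intro j hj z
    have hc : (1 : ℝ) ≤ j + (d : ℝ) / 2 := by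
      have : (0 : ℝ) ≤ j := Nat.cast_nonneg j
      linarith
    have hder := hasDerivAt_integral_sphere_exp (hcont j) (u : Ed d) z
    simp_rw [hj] at hder
    have hin : ∀ t : ℝ, ⟪(u : Ed d), z + t • (u : Ed d)⟫ = ⟪(u : Ed d), z⟫ + t := fun t => by
      rw [inner_add_right, real_inner_smul_right, real_inner_self_eq_norm_sq, hu]
      ring
    have hno : ∀ t : ℝ, ‖z + t • (u : Ed d)‖ ^ 2 =
        ‖z‖ ^ 2 + 2 * t * ⟪(u : Ed d), z⟫ + t ^ 2 := fun t => by
      rw [norm_add_sq_real, real_inner_smul_right, norm_smul, hu, real_inner_comm,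
        Real.norm_eq_abs, mul_one, sq_abs]
      ring
    simp_rw [hin, hno] at hder
    have hX : HasDerivAt (fun s : ℝ => ‖z‖ ^ 2 + 2 * s * ⟪(u : Ed d), z⟫ + s ^ 2)
        (2 * ⟪(u : Ed d), z⟫) 0 := by
      have := ((((hasDerivAt_id (0 : ℝ)).const_mul 2).mul_const ⟪(u : Ed d), z⟫).const_add
        (‖z‖ ^ 2)).add (hasDerivAt_pow 2 (0 : ℝ))
      refine this.congr_deriv ?_
      simp
    have hB := HasDerivAt.comp (0 : ℝ) (hasDerivAt_besselN hc _) hX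
    have hR := (((hasDerivAt_zonal hd j ⟪(u : Ed d), z⟫ (‖z‖ ^ 2) 0).mul hB).ofReal_comp).const_mul
      (funkHeckeConst d j)
    have := hder.unique hR
    rw [integral_const_mul] at this
    simp only [add_zero, mul_zero, zero_mul, ne_eq, OfNat.ofNat_ne_zero, not_false_eq_true,
      zero_pow, Function.comp] at this
    have e : (j : ℝ) + (d : ℝ) / 2 + 1 = j + 1 + (d : ℝ) / 2 := by ring
    rw [e] at this
    have h3 := congrArg (fun w => Complex.I * w) this
    simp only [← mul_assoc] at h3
    rw [show Complex.I * -Complex.I = 1 by simp, one_mul] at h3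
    rw [h3]
    push_cast
    ring
  have main : ∀ j, (∀ z : Ed d, ∫ v : Sph d, (zonal d j ⟪(v : Ed d), (u : Ed d)⟫ 1 : ℂ) *
        Complex.exp (-(Complex.I * (⟪(v : Ed d), z⟫ : ℝ))) ∂(ωd d) =
      funkHeckeConst d j * ((zonal d j ⟪(u : Ed d), z⟫ (‖z‖ ^ 2) *
        besselN (j + (d : ℝ) / 2) (‖z‖ ^ 2) : ℝ) : ℂ)) := by
    intro j
    induction j using Nat.twoStepInduction with
    | zero =>
      intro z
      have := integral_sphere_exp_inner hd z
      simpa [zonal, funkHeckeConst] using this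
    | one =>
      intro z
      have := step 0 (fun z => by
        simpa [zonal, funkHeckeConst] using integral_sphere_exp_inner hd z) z
      simp only [zonal, one_mul] at this ⊢
      rw [this, funkHeckeConst_succ]
      push_cast
      simp only [zero_add, zero_mul]
      ring
    | more j h0 h1 =>
      intro z
      have hs := step (j + 1) h1 z
      have hj : (0 : ℝ) ≤ j := Nat.cast_nonneg j
      have hc : (1 : ℝ) ≤ j + (d : ℝ) / 2 := by linarith
      have hne : (((j : ℝ) + d - 1 : ℝ) : ℂ) ≠ 0 := by
        rw [Complex.ofReal_ne_zero]
        linarith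
      apply mul_left_cancel₀ hne
      rw [← integral_const_mul]
      have hint : ∀ v : Sph d, (((j : ℝ) + d - 1 : ℝ) : ℂ) *
          ((zonal d (j + 2) ⟪(v : Ed d), (u : Ed d)⟫ 1 : ℂ) *
          Complex.exp (-(Complex.I * (⟪(v : Ed d), z⟫ : ℝ)))) =
          ((2 * (j : ℝ) + d : ℝ) : ℂ) *
          (((zonal d (j + 1) ⟪(v : Ed d), (u : Ed d)⟫ 1 * ⟪(v : Ed d), (u : Ed d)⟫ : ℝ) : ℂ) *
          Complex.exp (-(Complex.I * (⟪(v : Ed d), z⟫ : ℝ)))) - (((j : ℝ) + 1 : ℝ) : ℂ) *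
          ((zonal d j ⟪(v : Ed d), (u : Ed d)⟫ 1 : ℂ) *
          Complex.exp (-(Complex.I * (⟪(v : Ed d), z⟫ : ℝ)))) := fun v => by
        have h := congrArg (fun y : ℝ => (y : ℂ)) (zonal_rec hd j ⟪(v : Ed d), (u : Ed d)⟫ 1)
        simp only [Complex.ofReal_mul, Complex.ofReal_sub, Complex.ofReal_add,
          Complex.ofReal_one] at h ⊢
        linear_combination Complex.exp (-(Complex.I * (⟪(v : Ed d), z⟫ : ℝ))) * h
      simp_rw [hint]
      have hc0 := hcont j
      have hc1 := hcont (j + 1)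
      rw [integral_sub (integrable_sphere_of_continuous (by fun_prop))
        (integrable_sphere_of_continuous (by fun_prop)), integral_const_mul, integral_const_mul,
        hs, h0, funkHeckeConst_succ d j, show funkHeckeConst d (j + 2) =
          -(Complex.I / 2) * (-(Complex.I / 2) * funkHeckeConst d j) by
            rw [funkHeckeConst_succ, funkHeckeConst_succ]]
      have hr := congrArg (fun y : ℝ => (y : ℂ)) (zonal_rec hd j ⟪(u : Ed d), z⟫ (‖z‖ ^ 2))
      have hb := congrArg (fun y : ℝ => (y : ℂ)) (besselN_recurrence hc (‖z‖ ^ 2))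
      have e1 : (j : ℝ) + (d : ℝ) / 2 + 1 = j + 1 + (d : ℝ) / 2 := by ring
      have e2 : (j : ℝ) + (d : ℝ) / 2 + 2 = j + 2 + (d : ℝ) / 2 := by ring
      have e3 : (j : ℝ) + 1 + 1 + (d : ℝ) / 2 = j + 2 + (d : ℝ) / 2 := by ring
      rw [e1, e2] at hb
      simp only [Nat.add_sub_cancel, Nat.cast_add, Nat.cast_one, Nat.cast_ofNat, e3]
      push_cast at hr hb ⊢
      set B0 : ℂ := ((besselN (j + (d : ℝ) / 2) (‖z‖ ^ 2) : ℝ) : ℂ)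
      set B1 : ℂ := ((besselN (j + 1 + (d : ℝ) / 2) (‖z‖ ^ 2) : ℝ) : ℂ)
      set B2 : ℂ := ((besselN (j + 2 + (d : ℝ) / 2) (‖z‖ ^ 2) : ℝ) : ℂ)
      set κ := funkHeckeConst d j
      have hI := Complex.I_sq
      linear_combination (1 / 4 : ℂ) * κ * B2 * hr - (1 / 4 : ℂ) * κ * ((j : ℂ) + 1) *
        (zonal d j ⟪(u : Ed d), z⟫ (‖z‖ ^ 2) : ℂ) * hb - (κ / 2 * (2 * (j : ℂ) + d) *
        (((j : ℂ) + 1) * (zonal d j ⟪(u : Ed d), z⟫ (‖z‖ ^ 2) : ℂ) * B1 -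
        (zonal d (j + 1) ⟪(u : Ed d), z⟫ (‖z‖ ^ 2) : ℂ) * ((⟪(u : Ed d), z⟫ : ℝ) / 2 * B2)) +
        κ / 4 * ((j : ℂ) + d - 1) * (zonal d (j + 2) ⟪(u : Ed d), z⟫ (‖z‖ ^ 2) : ℂ) * B2) * hI
  exact main j z

/-! ### Gegenbauer polynomials as zonal harmonics -/

/-- The `m`-th term of the explicit formula for the Gegenbauer polynomial, extended by zero. -/
def gegenbauerTerm (b : ℝ) (j : ℕ) (t : ℝ) (m : ℕ) : ℝ :=
  if 2 * m ≤ j then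
    (-1 : ℝ) ^ m * 2 ^ (j - 2 * m) * risingFactorial b (j - m) /
      ((Nat.factorial m : ℝ) * (Nat.factorial (j - 2 * m) : ℝ)) * t ^ (j - 2 * m)
  else 0

lemma gegenbauer_eq_sum (b : ℝ) (j : ℕ) (t : ℝ) {N : ℕ} (hN : j / 2 + 1 ≤ N) :
    gegenbauer b j t = ∑ m ∈ Finset.range N, gegenbauerTerm b j t m := by
  rw [gegenbauer, ← Finset.sum_subset (Finset.range_subset_range.mpr hN)]
  · refine Finset.sum_congr rfl fun m hm => ?_
    rw [Finset.mem_range] at hm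
    rw [gegenbauerTerm, if_pos (by omega)]
  · intro m _ hm
    rw [Finset.mem_range] at hm
    rw [gegenbauerTerm, if_neg (by omega)]

lemma risingFactorial_succ (b : ℝ) (n : ℕ) :
    risingFactorial b (n + 1) = risingFactorial b n * (b + n) := by
  rw [risingFactorial, Finset.prod_range_succ, risingFactorial]

lemma gegenbauerTerm_rec_zero (b : ℝ) (j : ℕ) (t : ℝ) :
    ((j : ℝ) + 2) * gegenbauerTerm b (j + 2) t 0 =
      2 * ((j : ℝ) + 1 + b) * t * gegenbauerTerm b (j + 1) t 0 := by
  simp only [gegenbauerTerm, mul_zero, Nat.zero_le, if_true, Nat.sub_zero, pow_zero, one_mul,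
    Nat.factorial_zero, Nat.cast_one]
  rw [show j + 2 = j + 1 + 1 from rfl, risingFactorial_succ b (j + 1), Nat.factorial_succ (j + 1)]
  have h1 : ((j + 1).factorial : ℝ) ≠ 0 := by positivity
  have h2 : ((j : ℝ) + 1 + 1) ≠ 0 := by positivity
  push_cast
  field_simp
  ring

lemma gegenbauerTerm_rec_succ (b : ℝ) (j : ℕ) (t : ℝ) (m : ℕ) :
    ((j : ℝ) + 2) * gegenbauerTerm b (j + 2) t (m + 1) =
      2 * ((j : ℝ) + 1 + b) * t * gegenbauerTerm b (j + 1) t (m + 1) -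
        ((j : ℝ) + 2 * b) * gegenbauerTerm b j t m := by
  by_cases hm : 2 * m ≤ j
  · obtain ⟨k, rfl⟩ := Nat.exists_eq_add_of_le hm
    rcases k with _ | k
    · simp only [gegenbauerTerm, add_zero]
      rw [if_pos (by omega), if_neg (by omega), if_pos le_rfl,
        show 2 * m + 2 - 2 * (m + 1) = 0 by omega, show 2 * m + 2 - (m + 1) = m + 1 by omega,
        show 2 * m - 2 * m = 0 by omega, show 2 * m - m = m by omega, risingFactorial_succ,
        Nat.factorial_succ]
      have h1 : ((m).factorial : ℝ) ≠ 0 := by positivity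
      have h2 : ((m : ℝ) + 1) ≠ 0 := by positivity
      push_cast
      field_simp
      ring
    · simp only [gegenbauerTerm]
      rw [if_pos (by omega), if_pos (by omega), if_pos (by omega),
        show 2 * m + (k + 1) + 2 - 2 * (m + 1) = k + 1 by omega,
        show 2 * m + (k + 1) + 2 - (m + 1) = m + k + 1 + 1 by omega,
        show 2 * m + (k + 1) + 1 - 2 * (m + 1) = k by omega,
        show 2 * m + (k + 1) + 1 - (m + 1) = m + k + 1 by omega,
        show 2 * m + (k + 1) - 2 * m = k + 1 by omega,
        show 2 * m + (k + 1) - m = m + k + 1 by omega, risingFactorial_succ b (m + k + 1),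
        Nat.factorial_succ, Nat.factorial_succ]
      have h1 : ((m).factorial : ℝ) ≠ 0 := by positivity
      have h2 : ((m : ℝ) + 1) ≠ 0 := by positivity
      have h3 : ((k).factorial : ℝ) ≠ 0 := by positivity
      have h4 : ((k : ℝ) + 1) ≠ 0 := by positivity
      push_cast
      field_simp
      ring
  · simp only [gegenbauerTerm]
    rw [if_neg (by omega), if_neg (by omega), if_neg (by omega)]
    ring

lemma gegenbauer_rec (b : ℝ) (j : ℕ) (t : ℝ) :
    ((j : ℝ) + 2) * gegenbauer b (j + 2) t =
      2 * ((j : ℝ) + 1 + b) * t * gegenbauer b (j + 1) t -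
        ((j : ℝ) + 2 * b) * gegenbauer b j t := by
  rw [gegenbauer_eq_sum b (j + 2) t (N := j + 2 + 1) (by omega),
    gegenbauer_eq_sum b (j + 1) t (N := j + 2 + 1) (by omega),
    gegenbauer_eq_sum b j t (N := j + 2) (by omega),
    Finset.sum_range_succ', Finset.sum_range_succ' (fun m => gegenbauerTerm b (j + 1) t m),
    mul_add, mul_add, gegenbauerTerm_rec_zero, Finset.mul_sum, Finset.mul_sum, Finset.mul_sum]
  simp_rw [gegenbauerTerm_rec_succ]
  rw [Finset.sum_sub_distrib]
  ring

lemma gegenbauer_eq_zonal {d : ℕ} (hd : 2 < d) (j : ℕ) (t : ℝ) :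
    gegenbauer (((d : ℝ) - 2) / 2) j t =
      risingFactorial ((d : ℝ) - 2) j / j.factorial * zonal d j t 1 := by
  have h2 : (2 : ℝ) < d := by exact_mod_cast hd
  induction j using Nat.twoStepInduction with
  | zero => simp [gegenbauer, zonal, risingFactorial]
  | one =>
    simp only [gegenbauer, zonal, risingFactorial]
    norm_num
    exact Or.inl (by ring)
  | more j h0 h1 =>
    have hne : (j : ℝ) + 2 ≠ 0 := by positivity
    have hr := gegenbauer_rec (((d : ℝ) - 2) / 2) j t
    have hz := zonal_rec hd.le j t 1
    have hq : ∀ i : ℕ, ((i : ℝ) + 1) *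
        (risingFactorial ((d : ℝ) - 2) (i + 1) / (i + 1).factorial) =
        risingFactorial ((d : ℝ) - 2) i / i.factorial * (d - 2 + i) := fun i => by
      have h1 : (i.factorial : ℝ) ≠ 0 := by positivity
      rw [risingFactorial_succ, Nat.factorial_succ]
      push_cast
      field_simp
    have hq0 := hq j
    have hq1 := hq (j + 1)
    rw [h0, h1] at hr
    apply mul_left_cancel₀ hne
    rw [hr]
    push_cast at hq1
    set q0 := risingFactorial ((d : ℝ) - 2) j / j.factorial
    set q1 := risingFactorial ((d : ℝ) - 2) (j + 1) / (j + 1).factorial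
    set q2 := risingFactorial ((d : ℝ) - 2) (j + 1 + 1) / (j + 1 + 1).factorial
    linear_combination (-q1) * hz - zonal d (j + 2) t 1 * hq1 + zonal d j t 1 * hq0

/-- The normalized Gegenbauer polynomials are the zonal harmonics. -/
lemma gegenbauerN_eq_zonal {d : ℕ} (hd : 2 ≤ d) (j : ℕ) (t : ℝ) :
    gegenbauerN (((d : ℝ) - 2) / 2) j t = zonal d j t 1 := by
  rcases hd.eq_or_lt with rfl | hd'
  · rw [gegenbauerN, if_pos (by norm_num)]
    induction j using Nat.twoStepInduction with
    | zero => simp [zonal]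
    | one => simp [zonal]
    | more j h0 h1 =>
      have hne : (j : ℝ) + 1 ≠ 0 := by positivity
      have hz := zonal_rec hd j t 1
      push_cast
      rw [Polynomial.Chebyshev.T_add_two]
      push_cast at h0 h1
      simp only [Polynomial.eval_sub, Polynomial.eval_mul, Polynomial.eval_X,
        Polynomial.eval_ofNat, h0, h1]
      apply mul_left_cancel₀ hne
      push_cast at hz
      linear_combination -hz
  · have h2 : (2 : ℝ) < d := by exact_mod_cast hd'
    rw [gegenbauerN, if_neg (by linarith), gegenbauer_eq_zonal hd', gegenbauer_eq_zonal hd',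
      zonal_one_one hd, mul_one, mul_div_cancel_left₀]
    have : 0 < risingFactorial ((d : ℝ) - 2) j := Finset.prod_pos fun i _ => by
      have : (0 : ℝ) ≤ i := Nat.cast_nonneg i
      linarith
    positivity

/-! ### The characteristic exponent -/

lemma rpow_abs_mul_sign (α x : ℝ) :
    |x| ^ α * Real.sign x = x * |x| ^ (α - 1) := by
  rcases eq_or_ne x 0 with rfl | hx
  · simp
  · have h1 : |x| ^ α = |x| ^ (α - 1) * |x| := by
      rw [← Real.rpow_add_one (abs_pos.mpr hx).ne', sub_add_cancel]
    rcases hx.lt_or_gt with h | h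
    · rw [h1, Real.sign_of_neg h, abs_of_neg h]
      ring
    · rw [h1, Real.sign_of_pos h, abs_of_pos h]
      ring

/-- The integrand of the characteristic exponent, in a manifestly continuous form. -/
def charKernel (α x : ℝ) : ℂ :=
  ((|x| ^ α : ℝ) : ℂ) - Complex.I * ((Real.tan (π * α / 2) * (x * |x| ^ (α - 1)) : ℝ) : ℂ)

lemma continuous_charKernel {α : ℝ} (hα : 1 < α) : Continuous (charKernel α) := by
  have h1 : Continuous fun x : ℝ => |x| ^ α :=
    continuous_abs.rpow_const fun _ => Or.inr (by linarith)
  have h2 : Continuous fun x : ℝ => |x| ^ (α - 1) :=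
    continuous_abs.rpow_const fun _ => Or.inr (by linarith)
  unfold charKernel
  fun_prop

lemma charKernel_mul {α ρ : ℝ} (hρ : 0 < ρ) (x : ℝ) :
    charKernel α (ρ * x) = ((ρ ^ α : ℝ) : ℂ) * charKernel α x := by
  have h1 : ρ ^ α = ρ ^ (α - 1) * ρ := by
    rw [← Real.rpow_add_one hρ.ne', sub_add_cancel]
  unfold charKernel
  rw [abs_mul, abs_of_pos hρ, Real.mul_rpow hρ.le (abs_nonneg x),
    Real.mul_rpow hρ.le (abs_nonneg x), h1]
  push_cast
  ring

lemma charKernel_zero {α : ℝ} (hα : 1 < α) : charKernel α 0 = 0 := by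
  simp [charKernel, Real.zero_rpow (by linarith : α ≠ 0)]

lemma charKernel_re (α x : ℝ) : (charKernel α x).re = |x| ^ α := by
  unfold charKernel
  rw [Complex.sub_re, Complex.ofReal_re, Complex.I_mul_re, Complex.ofReal_im, neg_zero, sub_zero]

lemma integrable_pow_mul_exp_radial {d : ℕ} {α : ℝ} (hα : 1 < α) {c₀ : ℝ} (hc₀ : 0 < c₀) (n : ℕ) :
    Integrable (fun p : Sph d × ℝ => p.2 ^ n * Real.exp (-c₀ * p.2 ^ α))
      ((ωd d).prod (volume.restrict (Set.Ioi 0))) := by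
  have h := integrableOn_rpow_mul_exp_neg_mul_rpow (s := n) (p := α) (b := c₀)
    (by have : (0 : ℝ) ≤ n := Nat.cast_nonneg n
        linarith) (by linarith) hc₀
  simp only [Real.rpow_natCast] at h
  exact Integrable.comp_snd h (ωd d)

section

variable {d : ℕ} {α : ℝ} {Λ : Measure (Sph d)}

lemma charExp_eq (z : Ed d) :
    charExp d α Λ z = ∫ v, charKernel α ⟪z, (v : Ed d)⟫ ∂Λ := by
  refine integral_congr_ae (Eventually.of_forall fun v => ?_)
  simp only [charKernel, ← rpow_abs_mul_sign]
  push_cast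
  ring

lemma charExp_smul {ρ : ℝ} (hρ : 0 < ρ) (z : Ed d) :
    charExp d α Λ (ρ • z) = ((ρ ^ α : ℝ) : ℂ) * charExp d α Λ z := by
  rw [charExp_eq, charExp_eq, ← integral_const_mul]
  refine integral_congr_ae (Eventually.of_forall fun v => ?_)
  simp only
  rw [real_inner_smul_left, charKernel_mul hρ]

lemma charExp_smul_sphere {ρ : ℝ} (hρ : 0 < ρ) (v : Sph d) :
    charExp d α Λ (ρ • (v : Ed d)) = ((ρ ^ α : ℝ) : ℂ) * Vfun d α Λ v :=
  charExp_smul hρ _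

lemma norm_exp_neg_charExp_smul_le {c₀ : ℝ} (hc : ∀ u, c₀ ≤ (Vfun d α Λ u).re)
    {ρ : ℝ} (hρ : 0 < ρ) (v : Sph d) :
    ‖Complex.exp (-charExp d α Λ (ρ • (v : Ed d)))‖ ≤ Real.exp (-c₀ * ρ ^ α) := by
  rw [charExp_smul_sphere hρ, Complex.norm_exp, Complex.neg_re, Complex.re_ofReal_mul]
  gcongr
  have : 0 < ρ ^ α := by positivity
  nlinarith [hc v]

variable [IsFiniteMeasure Λ]

lemma continuous_charExp (hα : 1 < α) : Continuous (charExp d α Λ) := by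
  have hK := continuous_charKernel hα
  have h := continuous_parametric_integral_of_continuous (μ := Λ)
    (f := fun (z : Ed d) (v : Sph d) => charKernel α ⟪z, (v : Ed d)⟫)
    (by unfold Function.uncurry; fun_prop) isCompact_univ
  simp only [Measure.restrict_univ] at h
  exact h.congr fun z => (charExp_eq z).symm

lemma continuous_Vfun (hα : 1 < α) : Continuous (Vfun d α Λ) :=
  (continuous_charExp hα).comp continuous_subtype_val

lemma charExp_re (hα : 1 < α) (z : Ed d) :
    (charExp d α Λ z).re = ∫ v, |⟪z, (v : Ed d)⟫| ^ α ∂Λ := by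
  have hK := continuous_charKernel hα
  have hi : Integrable (fun v : Sph d => charKernel α ⟪z, (v : Ed d)⟫) Λ :=
    (by fun_prop : Continuous fun v : Sph d => charKernel α ⟪z, (v : Ed d)⟫)
      |>.integrable_of_hasCompactSupport (HasCompactSupport.of_compactSpace _)
  rw [charExp_eq]
  have := integral_re (𝕜 := ℂ) hi
  simp only [RCLike.re_to_complex, charKernel_re] at this
  exact this.symm

lemma exists_norm_Vfun_le (hα : 1 < α) : ∃ C₀ : ℝ, 0 ≤ C₀ ∧ ∀ u, ‖Vfun d α Λ u‖ ≤ C₀ := by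
  obtain ⟨C, hC⟩ := isCompact_univ.exists_bound_of_continuousOn
    (continuous_Vfun (Λ := Λ) hα).continuousOn
  exact ⟨max C 0, le_max_right _ _, fun u => (hC u trivial).trans (le_max_left _ _)⟩

lemma Vfun_re_pos (hα : 1 < α) {μ : Measure (Ed d)} [IsProbabilityMeasure μ]
    (hμ : IsStableChar d α Λ μ) (hnd : Nondegenerate d μ) (u : Sph d) :
    0 < (Vfun d α Λ u).re := by
  have hre : (Vfun d α Λ u).re = ∫ v : Sph d, |⟪(u : Ed d), (v : Ed d)⟫| ^ α ∂Λ :=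
    charExp_re hα _
  have hcont : Continuous fun v : Sph d => |⟪(u : Ed d), (v : Ed d)⟫| ^ α := by
    exact Continuous.rpow_const (by fun_prop) fun _ => Or.inr (by linarith)
  have h0 : 0 ≤ fun v : Sph d => |⟪(u : Ed d), (v : Ed d)⟫| ^ α := fun v => by
    simp only [Pi.zero_apply]
    positivity
  rcases (integral_nonneg h0).lt_or_eq with h | h
  · rwa [hre]
  exfalso
  rw [eq_comm, integral_eq_zero_iff_of_nonneg h0 (hcont.integrable_of_hasCompactSupport
    (HasCompactSupport.of_compactSpace _))] at h
  have hzero : ∀ᵐ v : Sph d ∂Λ, ⟪(u : Ed d), (v : Ed d)⟫ = 0 := by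
    filter_upwards [h] with v hv
    have := (Real.rpow_eq_zero_iff_of_nonneg (abs_nonneg _)).mp hv
    exact abs_eq_zero.mp this.1
  have hexp : ∀ t : ℝ, charExp d α Λ (t • (u : Ed d)) = 0 := fun t => by
    rw [charExp_eq]
    refine integral_eq_zero_of_ae ?_
    filter_upwards [hzero] with v hv
    rw [real_inner_smul_left, hv, mul_zero, charKernel_zero hα]
    rfl
  have hm : Measurable fun x : Ed d => ⟪(u : Ed d), x⟫ := by fun_prop
  have hdirac : μ.map (fun x : Ed d => ⟪(u : Ed d), x⟫) = Measure.dirac 0 := by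
    have : IsProbabilityMeasure (μ.map (fun x : Ed d => ⟪(u : Ed d), x⟫)) :=
      Measure.isProbabilityMeasure_map hm.aemeasurable
    refine Measure.ext_of_charFun (funext fun t => ?_)
    rw [charFun_apply_real, charFun_dirac, integral_map hm.aemeasurable (by fun_prop)]
    have := hμ (t • (u : Ed d))
    rw [hexp] at this
    simp only [real_inner_smul_left, neg_zero, Complex.exp_zero] at this
    simp only [inner_zero_left, Complex.ofReal_zero, zero_mul, Complex.exp_zero, ← this]
    refine integral_congr_ae (Eventually.of_forall fun x => ?_)
    simp only
    push_cast
    ring_nf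
  have hu : (u : Ed d) ≠ 0 := ne_zero_of_mem_unit_sphere u
  have hW : (ℝ ∙ (u : Ed d))ᗮ ≠ ⊤ := by
    intro h
    rw [Submodule.orthogonal_eq_top_iff, Submodule.span_singleton_eq_bot] at h
    exact hu h
  have hlt := hnd 0 _ hW
  have hset : (fun x : Ed d => 0 + x) '' ((ℝ ∙ (u : Ed d))ᗮ : Set (Ed d)) =
      (fun x : Ed d => ⟪(u : Ed d), x⟫) ⁻¹' {0} := by
    ext x
    simp [Submodule.mem_orthogonal_singleton_iff_inner_right]
  rw [hset, ← Measure.map_apply hm (measurableSet_singleton _), hdirac] at hlt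
  simp at hlt

lemma exists_le_Vfun_re (hα : 1 < α) {μ : Measure (Ed d)} [IsProbabilityMeasure μ]
    (hμ : IsStableChar d α Λ μ) (hnd : Nondegenerate d μ) :
    ∃ c₀ : ℝ, 0 < c₀ ∧ ∀ u, c₀ ≤ (Vfun d α Λ u).re := by
  rcases isEmpty_or_nonempty (Sph d) with h | h
  · exact ⟨1, one_pos, fun u => h.elim u⟩
  · obtain ⟨u₀, -, hu₀⟩ := isCompact_univ.exists_isMinOn (Set.univ_nonempty (α := Sph d))
      (Complex.continuous_re.comp (continuous_Vfun (Λ := Λ) hα)).continuousOn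
    exact ⟨_, Vfun_re_pos hα hμ hnd u₀, fun u => hu₀ (Set.mem_univ u)⟩

lemma integrable_exp_neg_charExp (hd : 0 < d) (hα : 1 < α) {c₀ : ℝ} (hc₀ : 0 < c₀)
    (hc : ∀ u, c₀ ≤ (Vfun d α Λ u).re) :
    Integrable fun z : Ed d => Complex.exp (-charExp d α Λ z) := by
  have hcont := continuous_charExp (Λ := Λ) hα
  have hcE : Continuous fun z : Ed d => Complex.exp (-charExp d α Λ z) := by fun_prop
  rw [integrable_polar_iff hd hcE.aestronglyMeasurable]
  refine (integrable_pow_mul_exp_radial hα hc₀ (d - 1)).mono' ?_ ?_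
  · exact (by fun_prop : Continuous fun p : Sph d × ℝ => p.2 ^ (d - 1) •
      Complex.exp (-charExp d α Λ (p.2 • (p.1 : Ed d)))).aestronglyMeasurable
  · filter_upwards [ae_prod_radial_pos d] with p hp
    rw [norm_smul, norm_pow, Real.norm_eq_abs, abs_of_pos hp]
    gcongr
    exact norm_exp_neg_charExp_smul_le hc hp p.1

end

/-! ### Projections of the density in terms of Hankel-type integrals -/

/-- The Hankel-type integral `2 ∫ y^(j+d-1) β(y²) exp (-η y^α) dy` in the variable `x = y²`. -/
def hankelIntegral (d j : ℕ) (α : ℝ) (η : ℂ) : ℂ :=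
  ∫ x in Set.Ioi (0 : ℝ), radialFun ((j : ℝ) / 2) (α / 2) η 0 x *
    ((x ^ ((j : ℝ) + (d : ℝ) / 2 - 1) * besselN ((j : ℝ) + (d : ℝ) / 2) x : ℝ) : ℂ)

lemma radialFun_zero_ofReal (a γ : ℝ) (η : ℂ) {x : ℝ} (hx : 0 < x) :
    radialFun a γ η 0 x = ((x ^ (-a) : ℝ) : ℂ) * Complex.exp (-(η * ((x ^ γ : ℝ) : ℂ))) := by
  simp [radialFun, expRemainder, Complex.ofReal_cpow hx.le]

lemma hankelIntegral_eq {d : ℕ} (hd : 0 < d) (j : ℕ) (α : ℝ) (η : ℂ) :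
    hankelIntegral d j α η = 2 * ∫ y in Set.Ioi (0 : ℝ),
      ((y ^ (d - 1) * (y ^ j * besselN ((j : ℝ) + (d : ℝ) / 2) (y ^ 2)) : ℝ) : ℂ) *
        Complex.exp (-(((y ^ α : ℝ) : ℂ) * η)) := by
  rw [hankelIntegral, ← integral_comp_rpow_Ioi_of_pos (p := 2) (by norm_num),
    ← integral_const_mul]
  refine setIntegral_congr_fun measurableSet_Ioi fun y hy => ?_
  have hy : 0 < y := hy
  rw [radialFun_zero_ofReal _ _ _ (by positivity), ← Real.rpow_mul hy.le, ← Real.rpow_mul hy.le,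
    ← Real.rpow_mul hy.le, Real.rpow_two, show (2 : ℝ) * (α / 2) = α by ring]
  have hpow : y ^ ((2 : ℝ) - 1) * y ^ (2 * -((j : ℝ) / 2)) *
      y ^ (2 * ((j : ℝ) + (d : ℝ) / 2 - 1)) = y ^ (d - 1) * y ^ j := by
    rw [← Real.rpow_add hy, ← Real.rpow_add hy, ← Real.rpow_natCast, ← Real.rpow_natCast,
      ← Real.rpow_add hy, Nat.cast_sub hd]
    congr 1
    push_cast
    ring
  have hpow' := congrArg (fun x : ℝ => (x : ℂ)) hpow
  rw [Complex.real_smul, mul_comm η]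
  push_cast at hpow' ⊢
  linear_combination 2 * Complex.exp (-(((y ^ α : ℝ) : ℂ) * η)) *
    ((besselN ((j : ℝ) + (d : ℝ) / 2) (y ^ 2) : ℝ) : ℂ) * hpow'

lemma integral_rescale_hankel {d : ℕ} (hd : 0 < d) (j : ℕ) (α : ℝ) (V : ℂ) {r : ℝ} (hr : 0 < r) :
    ∫ ρ in Set.Ioi (0 : ℝ),
      ((ρ ^ (d - 1) * ((r * ρ) ^ j * besselN ((j : ℝ) + (d : ℝ) / 2) ((r * ρ) ^ 2)) : ℝ) : ℂ) *
        Complex.exp (-(((ρ ^ α : ℝ) : ℂ) * V)) =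
      ((r ^ (-(d : ℝ)) / 2 : ℝ) : ℂ) * hankelIntegral d j α (((r ^ (-α) : ℝ) : ℂ) * V) := by
  set F : ℝ → ℂ := fun y =>
    ((y ^ (d - 1) * (y ^ j * besselN ((j : ℝ) + (d : ℝ) / 2) (y ^ 2)) : ℝ) : ℂ) *
        Complex.exp (-(((y ^ α : ℝ) : ℂ) * (((r ^ (-α) : ℝ) : ℂ) * V))) with hF
  have h1 : ∀ ρ ∈ Set.Ioi (0 : ℝ),
      ((ρ ^ (d - 1) * ((r * ρ) ^ j * besselN ((j : ℝ) + (d : ℝ) / 2) ((r * ρ) ^ 2)) : ℝ) : ℂ) *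
        Complex.exp (-(((ρ ^ α : ℝ) : ℂ) * V)) = (((r ^ (d - 1))⁻¹ : ℝ) : ℂ) * F (r * ρ) := by
    intro ρ hρ
    have hρ : 0 < ρ := hρ
    have e1 : ((((r * ρ) ^ α : ℝ) : ℂ) * (((r ^ (-α) : ℝ) : ℂ) * V)) = ((ρ ^ α : ℝ) : ℂ) * V := by
      rw [← mul_assoc, ← Complex.ofReal_mul, Real.mul_rpow hr.le hρ.le, mul_right_comm,
        ← Real.rpow_add hr, add_neg_cancel, Real.rpow_zero, one_mul]
    simp only [hF]
    rw [e1, mul_pow r ρ (d - 1)]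
    have hr' : (r : ℂ) ≠ 0 := Complex.ofReal_ne_zero.mpr hr.ne'
    push_cast
    field_simp
  rw [setIntegral_congr_fun measurableSet_Ioi h1, integral_const_mul,
    integral_comp_mul_left_Ioi F 0 hr, mul_zero, hankelIntegral_eq hd, Complex.real_smul, ← hF]
  have e2 : r ^ (-(d : ℝ)) = (r ^ (d - 1))⁻¹ * r⁻¹ := by
    rw [Real.rpow_neg hr.le, Real.rpow_natCast, ← mul_inv, ← pow_succ, Nat.sub_add_cancel hd]
  rw [e2]
  generalize ∫ y in Set.Ioi (0 : ℝ), F y = T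
  push_cast
  ring

/-- Fubini and the Funk–Hecke formula: integrating the zonal harmonic against an inverse Fourier
transform. -/
lemma integral_zonal_mul_fourier {d : ℕ} (hd : 2 ≤ d) (j : ℕ) {E : Ed d → ℂ} (hEc : Continuous E)
    (hE : Integrable E) (u : Sph d) (r : ℝ) :
    (Integrable fun z : Ed d => ((zonal d j ⟪(u : Ed d), r • z⟫ (‖r • z‖ ^ 2) *
        besselN (j + (d : ℝ) / 2) (‖r • z‖ ^ 2) : ℝ) : ℂ) * E z) ∧
    ∫ v : Sph d, (zonal d j ⟪(u : Ed d), (v : Ed d)⟫ 1 : ℂ) *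
      (∫ z : Ed d, Complex.exp (-(Complex.I * (⟪r • (v : Ed d), z⟫ : ℝ))) * E z) ∂(ωd d) =
    funkHeckeConst d j * ∫ z : Ed d, ((zonal d j ⟪(u : Ed d), r • z⟫ (‖r • z‖ ^ 2) *
        besselN (j + (d : ℝ) / 2) (‖r • z‖ ^ 2) : ℝ) : ℂ) * E z := by
  have hq : Continuous fun v : Sph d => zonal d j ⟪(v : Ed d), (u : Ed d)⟫ 1 :=
    (continuous_zonal d j).comp (by fun_prop : Continuous fun v : Sph d =>
      ((⟪(v : Ed d), (u : Ed d)⟫, (1 : ℝ)) : ℝ × ℝ))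
  obtain ⟨K, hK⟩ := isCompact_univ.exists_bound_of_continuousOn hq.continuousOn
  have hint : Integrable (fun p : Sph d × Ed d => (zonal d j ⟪(p.1 : Ed d), (u : Ed d)⟫ 1 : ℂ) *
      (Complex.exp (-(Complex.I * (⟪r • (p.1 : Ed d), p.2⟫ : ℝ))) * E p.2))
      ((ωd d).prod volume) := by
    refine Integrable.mono' (g := fun p => K * ‖E p.2‖)
      ((hE.norm.comp_snd (ωd d)).const_mul K) ?_ ?_
    · have hq' : Continuous fun p : Sph d × Ed d => zonal d j ⟪(p.1 : Ed d), (u : Ed d)⟫ 1 :=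
        hq.comp continuous_fst
      exact (by fun_prop : Continuous _).aestronglyMeasurable
    · refine Eventually.of_forall fun p => ?_
      rw [norm_mul, norm_mul, Complex.norm_real, Complex.norm_exp]
      simp only [Complex.neg_re, Complex.mul_re, Complex.I_re, zero_mul, Complex.I_im,
        Complex.ofReal_im, mul_zero, sub_zero, neg_zero, Real.exp_zero, one_mul]
      gcongr
      exact hK _ trivial
  have hFH : ∀ z : Ed d, ∫ v : Sph d, (zonal d j ⟪(v : Ed d), (u : Ed d)⟫ 1 : ℂ) *
      (Complex.exp (-(Complex.I * (⟪r • (v : Ed d), z⟫ : ℝ))) * E z) ∂(ωd d) =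
      funkHeckeConst d j * (((zonal d j ⟪(u : Ed d), r • z⟫ (‖r • z‖ ^ 2) *
        besselN (j + (d : ℝ) / 2) (‖r • z‖ ^ 2) : ℝ) : ℂ) * E z) := fun z => by
    rw [← mul_assoc, ← integral_sphere_zonal_exp hd u j (r • z), ← integral_mul_const]
    refine integral_congr_ae (Eventually.of_forall fun v => ?_)
    simp only [real_inner_smul_left, real_inner_smul_right]
    ring
  constructor
  · have h := hint.integral_prod_right
    simp only [hFH] at h
    have hκ : funkHeckeConst d j ≠ 0 := by
      unfold funkHeckeConst
      refine mul_ne_zero (pow_ne_zero _ (neg_ne_zero.mpr Complex.I_ne_zero)) ?_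
      rw [Complex.ofReal_ne_zero]
      positivity
    exact (integrable_const_mul_iff (IsUnit.mk0 _ hκ) _).mp h
  · have h := integral_integral_swap (f := fun (v : Sph d) (z : Ed d) =>
      (zonal d j ⟪(v : Ed d), (u : Ed d)⟫ 1 : ℂ) *
      (Complex.exp (-(Complex.I * (⟪r • (v : Ed d), z⟫ : ℝ))) * E z)) hint
    simp only [hFH, integral_const_mul] at h
    rw [← h]
    refine integral_congr_ae (Eventually.of_forall fun v => ?_)
    simp only
    rw [real_inner_comm]

section

variable {d : ℕ} {α : ℝ} {Λ : Measure (Sph d)} [IsFiniteMeasure Λ]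

lemma integral_zonal_mul_exp_neg_charExp (hd : 2 ≤ d) (hα : 1 < α) {c₀ : ℝ} (hc₀ : 0 < c₀)
    (hc : ∀ u, c₀ ≤ (Vfun d α Λ u).re) (j : ℕ) (u : Sph d) {r : ℝ} (hr : 0 < r) :
    (Integrable (fun θ : Sph d => (zonal d j ⟪(u : Ed d), (θ : Ed d)⟫ 1 : ℂ) *
      (((r ^ (-(d : ℝ)) / 2 : ℝ) : ℂ) *
        hankelIntegral d j α (((r ^ (-α) : ℝ) : ℂ) * Vfun d α Λ θ))) (ωd d)) ∧
    ∫ v : Sph d, (zonal d j ⟪(u : Ed d), (v : Ed d)⟫ 1 : ℂ) *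
      (∫ z : Ed d, Complex.exp (-(Complex.I * (⟪r • (v : Ed d), z⟫ : ℝ))) *
        Complex.exp (-charExp d α Λ z)) ∂(ωd d) =
    funkHeckeConst d j * ∫ θ : Sph d, (zonal d j ⟪(u : Ed d), (θ : Ed d)⟫ 1 : ℂ) *
      (((r ^ (-(d : ℝ)) / 2 : ℝ) : ℂ) *
        hankelIntegral d j α (((r ^ (-α) : ℝ) : ℂ) * Vfun d α Λ θ)) ∂(ωd d) := by
  have hd0 : 0 < d := by omega
  have hcont := continuous_charExp (Λ := Λ) hα
  have hcE : Continuous fun z : Ed d => Complex.exp (-charExp d α Λ z) := by fun_prop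
  obtain ⟨hi, he⟩ := integral_zonal_mul_fourier hd j hcE
    (integrable_exp_neg_charExp hd0 hα hc₀ hc) u r
  have hm := hi.aestronglyMeasurable
  rw [integrable_polar_iff hd0 hm] at hi
  rw [integral_polar hd0 hm] at he
  have hcongr : ∀ᵐ p ∂((ωd d).prod (volume.restrict (Set.Ioi (0 : ℝ)))),
      p.2 ^ (d - 1) • (((zonal d j ⟪(u : Ed d), r • p.2 • (p.1 : Ed d)⟫
        (‖r • p.2 • (p.1 : Ed d)‖ ^ 2) *
        besselN (j + (d : ℝ) / 2) (‖r • p.2 • (p.1 : Ed d)‖ ^ 2) : ℝ) : ℂ) *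
        Complex.exp (-charExp d α Λ (p.2 • (p.1 : Ed d)))) =
      (zonal d j ⟪(u : Ed d), (p.1 : Ed d)⟫ 1 : ℂ) *
      (((p.2 ^ (d - 1) * ((r * p.2) ^ j * besselN ((j : ℝ) + (d : ℝ) / 2) ((r * p.2) ^ 2)) : ℝ)
        : ℂ) * Complex.exp (-(((p.2 ^ α : ℝ) : ℂ) * Vfun d α Λ p.1))) := by
    filter_upwards [ae_prod_radial_pos d] with p hp
    have h1 : ‖r • p.2 • (p.1 : Ed d)‖ ^ 2 = (r * p.2) ^ 2 * 1 := by
      rw [smul_smul, norm_smul, norm_eq_of_mem_sphere, Real.norm_eq_abs, mul_one, sq_abs, mul_one]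
    have h2 : ⟪(u : Ed d), r • p.2 • (p.1 : Ed d)⟫ = r * p.2 * ⟪(u : Ed d), (p.1 : Ed d)⟫ := by
      rw [smul_smul, real_inner_smul_right]
    rw [h1, h2, zonal_homogeneous, charExp_smul_sphere hp, mul_one, Complex.real_smul]
    push_cast
    ring
  rw [integrable_congr hcongr] at hi
  rw [integral_congr_ae hcongr, integral_prod _ hi] at he
  have hi' := hi.integral_prod_left
  simp only [integral_const_mul, integral_rescale_hankel hd0 j α _ hr] at hi' he
  exact ⟨hi', he⟩

end

/-! ### The expansion of the projections of the density -/

section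

variable {d : ℕ} {α : ℝ} {Λ : Measure (Sph d)}

lemma integrable_sphere_zonal_mul (j : ℕ) (u : Sph d) {f : Sph d → ℂ} (hf : Continuous f) :
    Integrable (fun θ : Sph d => (zonal d j ⟪(u : Ed d), (θ : Ed d)⟫ 1 : ℂ) * f θ) (ωd d) := by
  have hq : Continuous fun v : Sph d => zonal d j ⟪(u : Ed d), (v : Ed d)⟫ 1 :=
    (continuous_zonal d j).comp (by fun_prop : Continuous fun v : Sph d =>
      ((⟪(u : Ed d), (v : Ed d)⟫, (1 : ℝ)) : ℝ × ℝ))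
  exact integrable_sphere_of_continuous (by fun_prop)

lemma exists_abs_zonal_le (d j : ℕ) :
    ∃ K, 0 ≤ K ∧ ∀ u v : Sph d, |zonal d j ⟪(u : Ed d), (v : Ed d)⟫ 1| ≤ K := by
  have hq : Continuous fun p : Sph d × Sph d => zonal d j ⟪(p.1 : Ed d), (p.2 : Ed d)⟫ 1 :=
    (continuous_zonal d j).comp (by fun_prop : Continuous fun p : Sph d × Sph d =>
      ((⟪(p.1 : Ed d), (p.2 : Ed d)⟫, (1 : ℝ)) : ℝ × ℝ))
  obtain ⟨K, hK⟩ := isCompact_univ.exists_bound_of_continuousOn hq.continuousOn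
  exact ⟨max K 0, le_max_right _ _, fun u v => (hK (u, v) trivial).trans (le_max_left _ _)⟩

lemma projC_eq_zonal (hd : 2 ≤ d) (j : ℕ) (f : Sph d → ℂ) (u : Sph d) :
    projC d j f u = ((cdim d j : ℂ) / (sphereArea d : ℂ)) *
      ∫ v, (zonal d j ⟪(u : Ed d), (v : Ed d)⟫ 1 : ℂ) * f v ∂(ωd d) := by
  simp only [projC, gegenbauerN_eq_zonal hd]

/-- The common factor in front of the zonal integrals. -/
def projConst (d j : ℕ) : ℂ :=
  (cdim d j : ℂ) / (sphereArea d : ℂ) * ((((2 * Real.pi) ^ d)⁻¹ : ℝ) : ℂ) * funkHeckeConst d j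

lemma projC_density [IsFiniteMeasure Λ] (hd : 2 ≤ d) (hα : 1 < α) {c₀ : ℝ} (hc₀ : 0 < c₀)
    (hc : ∀ u, c₀ ≤ (Vfun d α Λ u).re) {g : Ed d → ℝ} (hg : IsDensityOf d α Λ g) (j : ℕ)
    (u : Sph d) {r : ℝ} (hr : 0 < r) :
    projC d j (fun v => (g (r • (v : Ed d)) : ℂ)) u = projConst d j *
      ∫ θ : Sph d, (zonal d j ⟪(u : Ed d), (θ : Ed d)⟫ 1 : ℂ) *
      (((r ^ (-(d : ℝ)) / 2 : ℝ) : ℂ) *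
        hankelIntegral d j α (((r ^ (-α) : ℝ) : ℂ) * Vfun d α Λ θ)) ∂(ωd d) := by
  have h := (integral_zonal_mul_exp_neg_charExp hd hα hc₀ hc j u hr).2
  rw [projC_eq_zonal hd, projConst, mul_assoc _ (funkHeckeConst d j), ← h,
    mul_assoc]
  congr 1
  refine Eq.trans ?_ (integral_const_mul (μ := ωd d) (((((2 * Real.pi) ^ d)⁻¹ : ℝ) : ℂ)) _)
  refine integral_congr_ae (Eventually.of_forall fun v => ?_)
  simp only [hg (r • (v : Ed d))]
  ring

lemma phiTerm_eq_integral (hd : 2 ≤ d) (j k : ℕ) (u : Sph d) {r : ℝ} (hr : 0 < r) :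
    phiTerm d α Λ j k r u = projConst d j *
      ∫ θ : Sph d, (zonal d j ⟪(u : Ed d), (θ : Ed d)⟫ 1 : ℂ) * (((r ^ (-(d : ℝ)) / 2 : ℝ) : ℂ) *
        ((-(((r ^ (-α) : ℝ) : ℂ) * Vfun d α Λ θ)) ^ k / (Nat.factorial k : ℂ) *
        ((4 ^ ((j : ℝ) + (d : ℝ) / 2 - (j : ℝ) / 2 + k * (α / 2)) *
          Real.Gamma ((j : ℝ) + (d : ℝ) / 2 - (j : ℝ) / 2 + k * (α / 2)) /
          Real.Gamma ((j : ℝ) / 2 - k * (α / 2)) : ℝ) : ℂ))) ∂(ωd d) := by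
  have e1 : (j : ℝ) + (d : ℝ) / 2 - (j : ℝ) / 2 + k * (α / 2) = ((j : ℝ) + k * α + d) / 2 := by
    ring
  have e2 : (j : ℝ) / 2 - k * (α / 2) = ((j : ℝ) - k * α) / 2 := by ring
  rw [phiTerm, SHk, projC_eq_zonal hd, e1, e2]
  have h4 : (4 : ℝ) ^ (((j : ℝ) + k * α + d) / 2) = 2 ^ j * (2 ^ α) ^ k * 2 ^ d := by
    rw [show (4 : ℝ) = 2 ^ (2 : ℝ) by norm_num, ← Real.rpow_mul (by norm_num),
      show 2 * (((j : ℝ) + k * α + d) / 2) = j + α * k + d by ring, Real.rpow_add (by norm_num),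
      Real.rpow_add (by norm_num), Real.rpow_mul (by norm_num), Real.rpow_natCast,
      Real.rpow_natCast, Real.rpow_natCast]
  have hrk : r ^ ((k : ℝ) * α + d) = ((r ^ (-α)) ^ k * r ^ (-(d : ℝ)))⁻¹ := by
    rw [← Real.rpow_natCast, ← Real.rpow_mul hr.le, ← Real.rpow_add hr, ← Real.rpow_neg hr.le]
    congr 1
    ring
  have hπ : Real.pi ^ (-(d : ℝ) / 2) * Real.pi ^ d = Real.pi ^ ((d : ℝ) / 2) := by
    rw [← Real.rpow_natCast, ← Real.rpow_add Real.pi_pos]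
    congr 1
    ring
  have hint : ∀ G : ℝ, ∫ θ : Sph d, (zonal d j ⟪(u : Ed d), (θ : Ed d)⟫ 1 : ℂ) *
        (((r ^ (-(d : ℝ)) / 2 : ℝ) : ℂ) *
        ((-(((r ^ (-α) : ℝ) : ℂ) * Vfun d α Λ θ)) ^ k / (Nat.factorial k : ℂ) * (G : ℂ))) ∂(ωd d) =
      ((r ^ (-(d : ℝ)) / 2 * ((-1) ^ k * (r ^ (-α)) ^ k) / Nat.factorial k * G : ℝ) : ℂ) *
      ∫ θ : Sph d, (zonal d j ⟪(u : Ed d), (θ : Ed d)⟫ 1 : ℂ) * Vfun d α Λ θ ^ k ∂(ωd d) := by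
    intro G
    rw [← integral_const_mul]
    refine integral_congr_ae (Eventually.of_forall fun θ => ?_)
    simp only
    rw [neg_pow, mul_pow]
    push_cast
    ring
  rw [hint, h4, hrk, projConst, funkHeckeConst]
  generalize ∫ θ : Sph d, (zonal d j ⟪(u : Ed d), (θ : Ed d)⟫ 1 : ℂ) * Vfun d α Λ θ ^ k ∂(ωd d) = T
  rw [neg_pow ((2 : ℝ) ^ α) k]
  have hreal : (-1) ^ k * ((2 : ℝ) ^ α) ^ k * Real.pi ^ (-(d : ℝ) / 2) /
      ((Nat.factorial k : ℝ) * ((r ^ (-α)) ^ k * r ^ (-(d : ℝ)))⁻¹) *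
      (Real.Gamma (((j : ℝ) + k * α + d) / 2) / Real.Gamma (((j : ℝ) - k * α) / 2)) =
    ((2 * Real.pi) ^ d)⁻¹ * (2 * Real.pi ^ ((d : ℝ) / 2) / 2 ^ j) *
      (r ^ (-(d : ℝ)) / 2 * ((-1) ^ k * (r ^ (-α)) ^ k) / (Nat.factorial k : ℝ) *
      (2 ^ j * (2 ^ α) ^ k * 2 ^ d * Real.Gamma (((j : ℝ) + k * α + d) / 2) /
        Real.Gamma (((j : ℝ) - k * α) / 2))) := by
    rw [← hπ, mul_pow]
    field_simp
  rw [hreal]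
  push_cast
  ring

theorem exists_projC_density_expansion [IsFiniteMeasure Λ] (hd : 2 ≤ d) (hα : 1 < α) {c₀ : ℝ}
    (hc₀ : 0 < c₀) (hc : ∀ u, c₀ ≤ (Vfun d α Λ u).re) {g : Ed d → ℝ} (hg : IsDensityOf d α Λ g)
    (j n : ℕ) : ∃ C : ℝ, ∀ r : ℝ, 0 < r → ∀ u : Sph d,
      ‖projC d j (fun v => (g (r • (v : Ed d)) : ℂ)) u -
          ∑ k ∈ Finset.range (n + 1), phiTerm d α Λ j k r u‖ ≤
        C * r ^ (-(((n : ℝ) + 1) * α + d)) := by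
  obtain ⟨C₀, hC₀, hV⟩ := exists_norm_Vfun_le (d := d) (Λ := Λ) hα
  obtain ⟨K, hK0, hK⟩ := exists_abs_zonal_le d j
  have hd' : (2 : ℝ) ≤ d := by exact_mod_cast hd
  have hj : (0 : ℝ) ≤ j := Nat.cast_nonneg j
  obtain ⟨C, hC⟩ := exists_radial_expansion (a := (j : ℝ) / 2) (γ := α / 2)
    (c := (j : ℝ) + (d : ℝ) / 2) (by linarith) (by linarith) (by linarith) hc₀ hC₀ (n + 1)
  refine ⟨‖projConst d j‖ * (K * (C / 2) * (ωd d).real Set.univ), fun r hr u => ?_⟩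
  have hε : 0 < r ^ (-α) := Real.rpow_pos_of_pos hr _
  have hVc := continuous_Vfun (d := d) (Λ := Λ) hα
  have hI := (integral_zonal_mul_exp_neg_charExp hd hα hc₀ hc j u hr).1
  rw [projC_density hd hα hc₀ hc hg j u hr, Finset.sum_congr rfl fun k _ =>
    phiTerm_eq_integral hd j k u hr, ← Finset.mul_sum, ← integral_finsetSum, ← mul_sub,
    ← integral_sub hI, norm_mul, mul_assoc]
  · gcongr
    have hbound : ∀ θ : Sph d, ‖(zonal d j ⟪(u : Ed d), (θ : Ed d)⟫ 1 : ℂ) *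
        (((r ^ (-(d : ℝ)) / 2 : ℝ) : ℂ) *
          hankelIntegral d j α (((r ^ (-α) : ℝ) : ℂ) * Vfun d α Λ θ)) -
        ∑ k ∈ Finset.range (n + 1), (zonal d j ⟪(u : Ed d), (θ : Ed d)⟫ 1 : ℂ) *
        (((r ^ (-(d : ℝ)) / 2 : ℝ) : ℂ) *
        ((-(((r ^ (-α) : ℝ) : ℂ) * Vfun d α Λ θ)) ^ k / (Nat.factorial k : ℂ) *
        ((4 ^ ((j : ℝ) + (d : ℝ) / 2 - (j : ℝ) / 2 + k * (α / 2)) *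
          Real.Gamma ((j : ℝ) + (d : ℝ) / 2 - (j : ℝ) / 2 + k * (α / 2)) /
          Real.Gamma ((j : ℝ) / 2 - k * (α / 2)) : ℝ) : ℂ)))‖ ≤
        K * (r ^ (-(d : ℝ)) / 2 * (C * (r ^ (-α)) ^ (n + 1))) := by
      intro θ
      rw [← Finset.mul_sum, ← Finset.mul_sum, ← mul_sub, ← mul_sub, norm_mul, norm_mul,
        Complex.norm_real, Complex.norm_real, Real.norm_eq_abs, Real.norm_eq_abs,
        abs_of_pos (a := r ^ (-(d : ℝ)) / 2) (by positivity)]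
      gcongr
      · exact hK u θ
      · refine hC (r ^ (-α)) hε _ ?_ ?_
        · rw [norm_mul, Complex.norm_real, Real.norm_eq_abs, abs_of_pos hε, mul_comm]
          gcongr
          exact hV θ
        · rw [Complex.re_ofReal_mul, mul_comm]
          gcongr
          exact hc θ
    refine (norm_integral_le_of_norm_le_const (Eventually.of_forall hbound)).trans_eq ?_
    have hpow : r ^ (-(((n : ℝ) + 1) * α + d)) = r ^ (-(d : ℝ)) * (r ^ (-α)) ^ (n + 1) := by
      rw [← Real.rpow_natCast, ← Real.rpow_mul hr.le, ← Real.rpow_add hr]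
      congr 1
      push_cast
      ring
    rw [hpow]
    ring
  · exact integrable_finsetSum _ fun k _ => integrable_sphere_zonal_mul j u (by fun_prop)
  · exact fun k _ => integrable_sphere_zonal_mul j u (by fun_prop)

end

/-! ### The measure tested against Schwartz functions -/

section

open scoped FourierTransform SchwartzMap

variable {d : ℕ} {α : ℝ} {Λ : Measure (Sph d)}

lemma density_eq_fourier {g : Ed d → ℝ} (hg : IsDensityOf d α Λ g) (x : Ed d) :
    (g x : ℂ) = 𝓕 (fun w : Ed d => Complex.exp (-charExp d α Λ ((2 * Real.pi) • w))) x := by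
  have h := Measure.integral_comp_smul (volume : Measure (Ed d)) (fun z : Ed d =>
    Complex.exp (-(Complex.I * (⟪x, z⟫ : ℂ))) * Complex.exp (-charExp d α Λ z)) (2 * Real.pi)
  rw [finrank_euclideanSpace_fin, abs_of_pos (by positivity), Complex.real_smul] at h
  rw [hg x, ← h, Real.fourier_eq']
  refine integral_congr_ae (Eventually.of_forall fun w => ?_)
  simp only [smul_eq_mul, real_inner_smul_right]
  rw [real_inner_comm]
  congr 2
  push_cast
  ring

lemma integrable_exp_neg_charExp_two_pi_smul [IsFiniteMeasure Λ] (hd : 0 < d) (hα : 1 < α)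
    {c₀ : ℝ} (hc₀ : 0 < c₀) (hc : ∀ u, c₀ ≤ (Vfun d α Λ u).re) :
    Integrable fun w : Ed d => Complex.exp (-charExp d α Λ ((2 * Real.pi) • w)) :=
  (integrable_exp_neg_charExp hd hα hc₀ hc).comp_smul (by positivity)

lemma continuous_density [IsFiniteMeasure Λ] (hd : 0 < d) (hα : 1 < α) {c₀ : ℝ} (hc₀ : 0 < c₀)
    (hc : ∀ u, c₀ ≤ (Vfun d α Λ u).re) {g : Ed d → ℝ} (hg : IsDensityOf d α Λ g) :
    Continuous g := by
  have h : Continuous (𝓕 (fun w : Ed d => Complex.exp (-charExp d α Λ ((2 * Real.pi) • w)))) :=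
    VectorFourier.fourierIntegral_continuous Real.continuous_fourierChar
      (by simpa using! continuous_inner) (integrable_exp_neg_charExp_two_pi_smul hd hα hc₀ hc)
  have h' : Continuous fun x => ((g x : ℂ)).re := by
    simp only [density_eq_fourier hg]
    exact Complex.continuous_re.comp h
  simpa using h'

lemma integral_schwartz_eq [IsFiniteMeasure Λ] (hd : 0 < d) (hα : 1 < α) {c₀ : ℝ} (hc₀ : 0 < c₀)
    (hc : ∀ u, c₀ ≤ (Vfun d α Λ u).re) {g : Ed d → ℝ} (hg : IsDensityOf d α Λ g)
    {μ : Measure (Ed d)} [IsProbabilityMeasure μ] (hμ : IsStableChar d α Λ μ) (f : 𝓢(Ed d, ℂ)) :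
    ∫ x, f x ∂μ = ∫ x, f x * (g x : ℂ) := by
  have hFf : Integrable (𝓕 (f : Ed d → ℂ)) := (𝓕 f : 𝓢(Ed d, ℂ)).integrable
  have h1 : ∀ w : Ed d, VectorFourier.fourierIntegral 𝐞 μ (-(innerₗ (Ed d))).flip
      (fun _ => (1 : ℂ)) w = Complex.exp (-charExp d α Λ ((2 * Real.pi) • w)) := fun w => by
    rw [← hμ, VectorFourier.fourierIntegral]
    refine integral_congr_ae (Eventually.of_forall fun x => ?_)
    simp only [LinearMap.flip_apply, LinearMap.neg_apply, neg_neg, innerₗ_apply_apply,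
      Circle.smul_def, Real.fourierChar_apply, smul_eq_mul, mul_one, real_inner_smul_left]
    congr 1
    push_cast
    ring
  have h2 : ∀ x : Ed d, VectorFourier.fourierIntegral 𝐞 volume (-(innerₗ (Ed d)))
      (𝓕 (f : Ed d → ℂ)) x = f x :=
    fun x => by
    have h := congrFun (f.continuous.fourierInv_fourier_eq f.integrable hFf) x
    rw [← h, Real.fourierInv_eq]
    simp [VectorFourier.fourierIntegral]
  have h3 := VectorFourier.integral_fourierIntegral_smul_eq_flip (L := -(innerₗ (Ed d)))
    (μ := volume) (ν := μ) (f := 𝓕 (f : Ed d → ℂ)) (g := fun _ => (1 : ℂ))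
    Real.continuous_fourierChar (by simpa using! continuous_inner.neg) hFf (integrable_const 1)
  have h4 := VectorFourier.integral_fourierIntegral_smul_eq_flip (L := innerₗ (Ed d))
    (μ := volume) (ν := volume) (f := f)
    (g := fun w : Ed d => Complex.exp (-charExp d α Λ ((2 * Real.pi) • w)))
    Real.continuous_fourierChar (by simpa using! continuous_inner) f.integrable
    (integrable_exp_neg_charExp_two_pi_smul hd hα hc₀ hc)
  simp only [h1, h2, smul_eq_mul, mul_one] at h3
  rw [h3]
  refine h4.trans (integral_congr_ae (Eventually.of_forall fun x => ?_))
  simp only [density_eq_fourier hg, smul_eq_mul, flip_innerₗ]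
  rfl

end

/-! ### The density of the radial part -/

section

variable {ν : Measure ℝ} [IsProbabilityMeasure ν] {T : Set ℝ} {f : ℝ → ℝ}

lemma integrableOn_of_measure_eq_ofReal_integral
    (h : ∀ s : Set ℝ, MeasurableSet s → ν s = ENNReal.ofReal (∫ r in s ∩ T, f r)) :
    IntegrableOn f T := by
  by_contra hn
  have h1 := h Set.univ MeasurableSet.univ
  rw [Set.univ_inter, integral_undef hn] at h1
  simp at h1

lemma eq_withDensity_of_measure_eq_ofReal_integral
    (h : ∀ s : Set ℝ, MeasurableSet s → ν s = ENNReal.ofReal (∫ r in s ∩ T, f r)) :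
    0 ≤ᵐ[volume.restrict T] f ∧
      ν = (volume.restrict T).withDensity fun r => ENNReal.ofReal (f r) := by
  have hi := integrableOn_of_measure_eq_ofReal_integral h
  have htot : ∫ r in T, f r = 1 := by
    have h1 := h Set.univ MeasurableSet.univ
    rw [Set.univ_inter, measure_univ, eq_comm, ENNReal.ofReal_eq_one] at h1
    exact h1
  have h0 : 0 ≤ᵐ[volume.restrict T] f := by
    refine ae_nonneg_of_forall_setIntegral_nonneg hi fun s hs _ => ?_
    by_contra! hlt
    have hc := integral_add_compl hs hi
    rw [htot] at hc
    have hle : ν sᶜ ≤ 1 := prob_le_one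
    rw [h _ hs.compl, ENNReal.ofReal_le_one, ← Measure.restrict_restrict hs.compl] at hle
    linarith
  refine ⟨h0, ?_⟩
  ext s hs
  rw [withDensity_apply _ hs, h s hs, Measure.restrict_restrict hs,
    ofReal_integral_eq_lintegral_ofReal (hi.mono_set Set.inter_subset_right)]
  exact ae_restrict_of_ae_restrict_of_subset Set.inter_subset_right h0

lemma integral_eq_of_measure_eq_ofReal_integral
    (h : ∀ s : Set ℝ, MeasurableSet s → ν s = ENNReal.ofReal (∫ r in s ∩ T, f r)) (χ : ℝ → ℝ) :
    ∫ r, χ r ∂ν = ∫ r in T, f r * χ r := by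
  have hi := integrableOn_of_measure_eq_ofReal_integral h
  obtain ⟨h0, hν⟩ := eq_withDensity_of_measure_eq_ofReal_integral h
  rw [hν, integral_withDensity_eq_integral_toReal_smul₀ hi.aemeasurable.ennreal_ofReal
    (Eventually.of_forall fun _ => ENNReal.ofReal_lt_top)]
  refine integral_congr_ae ?_
  filter_upwards [h0] with r hr
  rw [ENNReal.toReal_ofReal hr, smul_eq_mul]

end

lemma contDiff_comp_norm {E : Type*} [NormedAddCommGroup E] [InnerProductSpace ℝ E] {χ : ℝ → ℝ}
    (hχ : ContDiff ℝ ((⊤ : ℕ∞) : WithTop ℕ∞) χ) (hs : tsupport χ ⊆ Set.Ioi 0) :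
    ContDiff ℝ ((⊤ : ℕ∞) : WithTop ℕ∞) fun x : E => χ ‖x‖ := by
  rw [contDiff_iff_contDiffAt]
  intro x
  by_cases hx : x = 0
  · have h0 : ∀ᶠ t in 𝓝 (0 : ℝ), χ t = 0 := by
      have hmem : (tsupport χ)ᶜ ∈ 𝓝 (0 : ℝ) :=
        (isClosed_tsupport χ).isOpen_compl.mem_nhds fun h => lt_irrefl (0 : ℝ) (hs h)
      filter_upwards [hmem] with t ht
      exact image_eq_zero_of_notMem_tsupport ht
    have h1 : ∀ᶠ y in 𝓝 x, χ ‖y‖ = 0 := by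
      have ht : Tendsto (fun y : E => ‖y‖) (𝓝 x) (𝓝 0) := by
        simpa [hx] using (continuous_norm (E := E)).tendsto x
      exact ht.eventually h0
    exact (contDiffAt_const (c := (0 : ℝ))).congr_of_eventuallyEq h1
  · exact hχ.contDiffAt.comp x (contDiffAt_norm ℝ hx)

lemma hasCompactSupport_comp_norm {E : Type*} [NormedAddCommGroup E] [ProperSpace E] {χ : ℝ → ℝ}
    (hχ : HasCompactSupport χ) : HasCompactSupport fun x : E => χ ‖x‖ := by
  obtain ⟨R, hR⟩ := hχ.isBounded.subset_closedBall 0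
  refine HasCompactSupport.intro (isCompact_closedBall (0 : E) R) fun x hx => ?_
  refine image_eq_zero_of_notMem_tsupport fun h => hx ?_
  have := hR h
  simpa using this

section

variable {d : ℕ} {α : ℝ} {Λ : Measure (Sph d)} [IsFiniteMeasure Λ]

lemma continuous_radial_average {g : Ed d → ℝ} (hg : Continuous g) :
    Continuous fun r : ℝ => r ^ (d - 1) * ∫ v : Sph d, g (r • (v : Ed d)) ∂(ωd d) := by
  have h := continuous_parametric_integral_of_continuous (μ := ωd d)
    (f := fun (r : ℝ) (v : Sph d) => g (r • (v : Ed d)))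
    (by unfold Function.uncurry; fun_prop) isCompact_univ
  simp only [Measure.restrict_univ] at h
  fun_prop

lemma radialDensity_eq (hd : 0 < d) (hα : 1 < α) {c₀ : ℝ} (hc₀ : 0 < c₀)
    (hc : ∀ u, c₀ ≤ (Vfun d α Λ u).re) {g : Ed d → ℝ} (hg : IsDensityOf d α Λ g)
    {μ : Measure (Ed d)} [IsProbabilityMeasure μ] (hμ : IsStableChar d α Λ μ) {gX : ℝ → ℝ}
    (hgXpdf : ∀ s : Set ℝ, MeasurableSet s →
      μ.map (fun x : Ed d => ‖x‖) s = ENNReal.ofReal (∫ r in s ∩ Set.Ioi 0, gX r))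
    (hgXcont : ContinuousOn gX (Set.Ioi 0)) {r : ℝ} (hr : 0 < r) :
    gX r = r ^ (d - 1) * ∫ v : Sph d, g (r • (v : Ed d)) ∂(ωd d) := by
  have hgc := continuous_density hd hα hc₀ hc hg
  have hav := continuous_radial_average hgc
  have hpm : IsProbabilityMeasure (μ.map (fun x : Ed d => ‖x‖)) :=
    Measure.isProbabilityMeasure_map (by fun_prop)
  have hgXi := integrableOn_of_measure_eq_ofReal_integral hgXpdf
  have hfc : ContinuousOn (fun r => gX r -
      r ^ (d - 1) * ∫ v : Sph d, g (r • (v : Ed d)) ∂(ωd d)) (Set.Ioi 0) :=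
    hgXcont.sub hav.continuousOn
  have hae := isOpen_Ioi.ae_eq_zero_of_integral_contDiff_smul_eq_zero
    (hfc.locallyIntegrableOn measurableSet_Ioi (μ := volume)) fun χ hχ hχc hχs => ?_
  · have hae' : (fun r => gX r - r ^ (d - 1) * ∫ v : Sph d, g (r • (v : Ed d)) ∂(ωd d))
        =ᵐ[volume.restrict (Set.Ioi 0)] fun _ => 0 :=
      (ae_restrict_iff' measurableSet_Ioi).mpr hae
    have := Measure.eqOn_open_of_ae_eq hae' isOpen_Ioi hfc continuousOn_const hr
    exact sub_eq_zero.mp this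
  · have hχ0 : ∀ r, r ∉ Set.Ioi (0 : ℝ) → χ r = 0 := fun r hr =>
      image_eq_zero_of_notMem_tsupport fun h => hr (hχs h)
    have hcd : ContDiff ℝ ((⊤ : ℕ∞) : WithTop ℕ∞) fun x : Ed d => χ ‖x‖ := contDiff_comp_norm hχ hχs
    have hcs : HasCompactSupport fun x : Ed d => χ ‖x‖ := hasCompactSupport_comp_norm hχc
    have hcs' : HasCompactSupport fun x : Ed d => ((χ ‖x‖ : ℝ) : ℂ) :=
      hcs.comp_left Complex.ofReal_zero
    have hS : ∫ x, ((χ ‖x‖ : ℝ) : ℂ) ∂μ = ∫ x, ((χ ‖x‖ : ℝ) : ℂ) * (g x : ℂ) :=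
      integral_schwartz_eq hd hα hc₀ hc hg hμ
        (hcs'.toSchwartzMap (Complex.ofRealCLM.contDiff.comp hcd))
    have hS' : ∫ x, χ ‖x‖ ∂μ = ∫ x, χ ‖x‖ * g x := by
      simp only [← Complex.ofReal_mul,
        integral_complex_ofReal] at hS
      exact_mod_cast hS
    have hleft : ∫ x, χ ‖x‖ ∂μ = ∫ r in Set.Ioi 0, gX r * χ r := by
      rw [← integral_eq_of_measure_eq_ofReal_integral hgXpdf χ,
        integral_map (by fun_prop) hχ.continuous.aestronglyMeasurable]
    have hcont : Continuous fun x : Ed d => χ ‖x‖ * g x := by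
      have := hcd.continuous
      fun_prop
    have hint : Integrable fun x : Ed d => χ ‖x‖ * g x :=
      hcont.integrable_of_hasCompactSupport hcs.mul_right
    have hright : ∫ x, χ ‖x‖ * g x = ∫ r in Set.Ioi 0,
        (r ^ (d - 1) * ∫ v : Sph d, g (r • (v : Ed d)) ∂(ωd d)) * χ r := by
      rw [integral_polar hd hcont.aestronglyMeasurable, integral_prod_symm]
      · refine setIntegral_congr_fun measurableSet_Ioi fun r hr => ?_
        have hr : 0 < r := hr
        simp only [norm_smul, norm_eq_of_mem_sphere, Real.norm_eq_abs, abs_of_pos hr, mul_one,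
          smul_eq_mul]
        rw [integral_const_mul, integral_const_mul]
        ring
      · exact (integrable_polar_iff hd hcont.aestronglyMeasurable).mp hint
    rw [← setIntegral_eq_integral_of_forall_compl_eq_zero (s := Set.Ioi 0)
      fun r hr => by rw [hχ0 r hr, zero_smul]]
    have hsupp : ∀ F : ℝ → ℝ, ContinuousOn F (Set.Ioi 0) →
        IntegrableOn (fun r => F r * χ r) (Set.Ioi 0) := fun F hF => by
      have h1 : IntegrableOn (fun r => F r * χ r) (tsupport χ) :=
        ((hF.mono hχs).mul hχ.continuous.continuousOn).integrableOn_compact hχc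
      refine (IntegrableOn.integrable_of_forall_notMem_eq_zero h1 fun r hr => ?_).integrableOn
      rw [image_eq_zero_of_notMem_tsupport hr, mul_zero]
    have heq := hleft.symm.trans (hS'.trans hright)
    rw [← sub_eq_zero, ← integral_sub (hsupp _ hgXcont) (hsupp _ hav.continuousOn)] at heq
    refine Eq.trans ?_ heq
    refine integral_congr_ae (Eventually.of_forall fun r => ?_)
    simp only [smul_eq_mul]
    ring

end

/-! ### The projection onto constants -/

section

variable {d : ℕ} {α : ℝ} {Λ : Measure (Sph d)}

lemma projC_zero (hd : 2 ≤ d) (f : Sph d → ℂ) (u : Sph d) :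
    projC d 0 f u = (sphereArea d : ℂ)⁻¹ * ∫ v, f v ∂(ωd d) := by
  simp [projC_eq_zonal hd, cdim, zonal]

lemma sphereArea_pos (hd : 0 < d) : 0 < sphereArea d := by
  have : (0 : ℝ) < d := Nat.cast_pos.mpr hd
  have := Real.Gamma_pos_of_pos (half_pos this)
  unfold sphereArea
  positivity

lemma radTerm_eq (hd : 2 ≤ d) (k : ℕ) {r : ℝ} (hr : 0 < r) (u : Sph d) :
    radTerm d α Λ k r = ((r ^ (d - 1) * sphereArea d : ℝ) : ℂ) * phiTerm d α Λ 0 k r u := by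
  have hA : (sphereArea d : ℂ) ≠ 0 :=
    Complex.ofReal_ne_zero.mpr (sphereArea_pos (by omega : 0 < d)).ne'
  have hpow : r ^ ((k : ℝ) * α + d) = r ^ ((k : ℝ) * α + 1) * r ^ (d - 1) := by
    rw [← Real.rpow_natCast r (d - 1), ← Real.rpow_add hr, Nat.cast_sub (by omega)]
    congr 1
    push_cast
    ring
  have hr' : (r : ℂ) ≠ 0 := Complex.ofReal_ne_zero.mpr hr.ne'
  have hpos : ((r ^ ((k : ℝ) * α + 1) : ℝ) : ℂ) ≠ 0 :=
    Complex.ofReal_ne_zero.mpr (Real.rpow_pos_of_pos hr _).ne'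
  rw [radTerm, phiTerm, SHk, projC_zero hd, hpow, Nat.cast_zero, zero_add, zero_sub, pow_zero,
    one_mul]
  push_cast
  field_simp

lemma ofReal_radialDensity_sub (hd : 2 ≤ d) {g : Ed d → ℝ} {r y : ℝ} (hr : 0 < r)
    (hy : y = r ^ (d - 1) * ∫ v : Sph d, g (r • (v : Ed d)) ∂(ωd d)) (n : ℕ) (u : Sph d) :
    (y : ℂ) - ∑ k ∈ Finset.range n, radTerm d α Λ k r =
      ((r ^ (d - 1) * sphereArea d : ℝ) : ℂ) *
        (projC d 0 (fun v => (g (r • (v : Ed d)) : ℂ)) u -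
          ∑ k ∈ Finset.range n, phiTerm d α Λ 0 k r u) := by
  have hA : (sphereArea d : ℂ) ≠ 0 :=
    Complex.ofReal_ne_zero.mpr (sphereArea_pos (by omega : 0 < d)).ne'
  rw [mul_sub, Finset.mul_sum, Finset.sum_congr rfl fun k _ => radTerm_eq hd k hr u,
    projC_zero hd, integral_complex_ofReal, hy]
  congr 1
  push_cast
  field_simp

end

end StablePaper

namespace StablePaper

/-- Proposition: for `α ∈ (1,2)` and fixed `j`, as `r → ∞`,
`sup_u |proj_j(g(r·))(u) - Σ_{k=0}^n ((-2^α)^k π^{-d/2}/(k! r^{kα+d}))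
(Γ((j+kα+d)/2)/Γ((j-kα)/2)) S_{j,k}(u)| = O(r^{-(n+1)α-d})`, and the density of `|X|`
has the corresponding asymptotic expansion with error `O(r^{-(n+1)α-1})`. -/
theorem stmt18 (d : ℕ) (hd : 2 ≤ d) (α : ℝ) (hα1 : 1 < α) (hα2 : α < 2)
    (Λ : Measure (Sph d)) [IsFiniteMeasure Λ] (hΛ : Λ ≠ 0)
    (μ : Measure (Ed d)) [IsProbabilityMeasure μ] (hμ : IsStableChar d α Λ μ)
    (hnd : Nondegenerate d μ)
    (g : Ed d → ℝ) (hg : IsDensityOf d α Λ g) (j : ℕ)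
    (gX : ℝ → ℝ)
    (hgXpdf : ∀ s : Set ℝ, MeasurableSet s →
      μ.map (fun x : Ed d => ‖x‖) s = ENNReal.ofReal (∫ r in s ∩ Set.Ioi 0, gX r))
    (hgXcont : ContinuousOn gX (Set.Ioi 0)) :
    (∀ n : ℕ, ∃ C R₀ : ℝ, ∀ r : ℝ, R₀ ≤ r → ∀ u : Sph d,
      ‖projC d j (fun v => (g (r • (v : Ed d)) : ℂ)) u -
          ∑ k ∈ Finset.range (n + 1), phiTerm d α Λ j k r u‖ ≤
        C * r ^ (-(((n : ℝ) + 1) * α + d))) ∧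
    ∀ n : ℕ, ∃ C R₀ : ℝ, ∀ r : ℝ, R₀ ≤ r →
      ‖(gX r : ℂ) - ∑ k ∈ Finset.range (n + 1), radTerm d α Λ k r‖ ≤
        C * r ^ (-(((n : ℝ) + 1) * α + 1)) := by
  obtain ⟨c₀, hc₀, hc⟩ := exists_le_Vfun_re hα1 hμ hnd
  refine ⟨fun n => ?_, fun n => ?_⟩
  · obtain ⟨C, hC⟩ := exists_projC_density_expansion hd hα1 hc₀ hc hg j n
    exact ⟨C, 1, fun r hr u => hC r (one_pos.trans_le hr) u⟩
  · obtain ⟨C, hC⟩ := exists_projC_density_expansion hd hα1 hc₀ hc hg 0 n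
    refine ⟨sphereArea d * C, 1, fun r hr => ?_⟩
    have hr0 : 0 < r := one_pos.trans_le hr
    have hd0 : 0 < d := by omega
    have : Nonempty (Fin d) := ⟨⟨0, hd0⟩⟩
    obtain ⟨u⟩ : Nonempty (Sph d) := (NormedSpace.sphere_nonempty.mpr zero_le_one).to_subtype
    rw [ofReal_radialDensity_sub hd hr0
      (radialDensity_eq hd0 hα1 hc₀ hc hg hμ hgXpdf hgXcont hr0) (n + 1) u, norm_mul,
      Complex.norm_real, Real.norm_eq_abs,
      abs_of_pos (mul_pos (pow_pos hr0 _) (sphereArea_pos hd0))]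
    have hpow : r ^ (-(((n : ℝ) + 1) * α + 1)) = r ^ (d - 1) *
        r ^ (-(((n : ℝ) + 1) * α + d)) := by
      rw [← Real.rpow_natCast r (d - 1), ← Real.rpow_add hr0, Nat.cast_sub (by omega)]
      congr 1
      push_cast
      ring
    calc _ ≤ r ^ (d - 1) * sphereArea d * (C * r ^ (-(((n : ℝ) + 1) * α + d))) := by
          have := sphereArea_pos hd0
          gcongr
          exact hC r hr0 u
      _ = _ := by rw [hpow]; ring

end StablePaper
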